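/- Let f : ℕ → ℝ be a completely multiplicative function with |f(n)| ≤ 1 for all n, and let L₁, …, L_ℓ : ℕ² → ℕ be linear forms. Then the averages (1/N²) · Σ_{1 ≤ m, n ≤ N} f(∏_{j=1}^ℓ L_j(m, n)) converge as N → ∞. -/

import Mathlib

open Filter Finset
open scoped BigOperators

set_option linter.unusedSectionVars false

section

theorem sq_expect_mul_le {X : Type*} [Fintype X] (u v : X → ℝ) :
    (𝔼 x, u x * v x) ^ 2 ≤ (𝔼 x, u x ^ 2) * 𝔼 x, v x ^ 2 :=
  expect_mul_sq_le_sq_mul_sq _ _ _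

theorem abs_expect_pow_two_pow_le {X : Type*} [Fintype X] [Nonempty X] (u : X → ℝ) (k : ℕ) :
    |𝔼 x, u x| ^ 2 ^ k ≤ 𝔼 x, |u x| ^ 2 ^ k := by
  induction k generalizing u with
  | zero => simpa using abs_expect_le univ u
  | succ k ih =>
    rw [pow_succ, pow_mul]
    calc (|𝔼 x, u x| ^ 2 ^ k) ^ 2 ≤ (𝔼 x, |u x| ^ 2 ^ k) ^ 2 := by
          gcongr; exact ih u
      _ ≤ 𝔼 x, (|u x| ^ 2 ^ k) ^ 2 := by
          have := sq_expect_mul_le (fun x => |u x| ^ 2 ^ k) (fun _ => 1)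
          simpa using this
      _ = _ := by simp_rw [← pow_mul]

theorem expect_add_right_eq {G : Type*} [AddCommGroup G] [Fintype G] (u : G → ℝ) (a : G) :
    𝔼 x, u (x + a) = 𝔼 x, u x :=
  Fintype.expect_equiv (Equiv.addRight a) _ _ (fun _ => rfl)

theorem expect_add_left_eq {G : Type*} [AddCommGroup G] [Fintype G] (u : G → ℝ) (a : G) :
    𝔼 x, u (a + x) = 𝔼 x, u x :=
  Fintype.expect_equiv (Equiv.addLeft a) _ _ (fun _ => rfl)

theorem expect_prod_type {X Y : Type*} [Fintype X] [Fintype Y] (u : X × Y → ℝ) :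
    𝔼 z, u z = 𝔼 x, 𝔼 y, u (x, y) := by
  rw [← univ_product_univ, expect_product]

/-- The `k`-th Gowers box sum, that is the `2 ^ k`-th power of the `U^k` norm for `k ≥ 1`. -/
noncomputable def gowersU {F : Type} [AddCommGroup F] [Fintype F] : ℕ → (F → ℝ) → ℝ
  | 0, g => 𝔼 x, g x
  | k + 1, g => 𝔼 h, gowersU k (fun x => g x * g (x + h))

section
variable {F : Type} [Field F] [Fintype F]

theorem gowersU_one (g : F → ℝ) : gowersU 1 g = (𝔼 x, g x) ^ 2 := by
  simp only [gowersU]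
  rw [expect_comm, sq, expect_mul]
  refine expect_congr rfl fun x _ => ?_
  rw [← mul_expect, expect_add_left_eq g x]

theorem expect_linear_comp {V : Type} [AddCommGroup V] [Module F V] [Fintype V]
    (L : V →ₗ[F] F) (m : V) (hm : L m ≠ 0) (φ : V → ℝ) (hφ : ∀ (s : F) X, φ (X + s • m) = φ X)
    (g : F → ℝ) : 𝔼 X, g (L X) * φ X = (𝔼 x, g x) * 𝔼 X, φ X := by
  have h1 : ∀ s : F, 𝔼 X, g (L X + s * L m) * φ X = 𝔼 X, g (L X) * φ X := by
    intro s
    rw [← expect_add_right_eq (fun X => g (L X) * φ X) (s • m)]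
    refine expect_congr rfl fun X _ => ?_
    simp [hφ]
  have h2 : 𝔼 s : F, 𝔼 X, g (L X + s * L m) * φ X = 𝔼 X, g (L X) * φ X := by
    simp_rw [h1]; exact Fintype.expect_const _
  rw [← h2, expect_comm, mul_expect]
  refine expect_congr rfl fun X _ => ?_
  rw [← expect_mul]
  congr 1
  rw [← expect_add_left_eq g (L X)]
  exact Fintype.expect_equiv (Equiv.mulRight₀ _ hm) _ _ (fun _ => rfl)

/-- The generalised von Neumann inequality. -/
theorem generalized_von_neumann {V : Type} [AddCommGroup V] [Module F V] [Fintype V]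
    (L : V →ₗ[F] F) (k : ℕ) (M : Fin (k + 1) → V) (hL : ∀ i, L (M i) ≠ 0)
    (ψ : Fin (k + 1) → V → ℝ) (hψ : ∀ i X, |ψ i X| ≤ 1)
    (hinv : ∀ i (s : F) X, ψ i (X + s • M i) = ψ i X) (g : F → ℝ) :
    |𝔼 X, g (L X) * ∏ i, ψ i X| ^ 2 ^ (k + 1) ≤ gowersU (k + 1) g := by
  induction k generalizing g with
  | zero =>
    rw [gowersU_one]
    simp only [Nat.reduceAdd, Fin.prod_univ_one, zero_add, pow_one]
    rw [expect_linear_comp L (M 0) (hL 0) (ψ 0) (hinv 0), sq_abs, mul_pow]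
    refine mul_le_of_le_one_right (sq_nonneg _) ?_
    rw [sq_le_one_iff_abs_le_one]
    exact (abs_expect_le _ _).trans (expect_le univ_nonempty fun X _ => hψ 0 X)
  | succ k ih =>
    set m := M (Fin.last _) with hm
    set P : V → ℝ := fun X => g (L X) * ∏ i : Fin (k + 1), ψ i.castSucc X with hP
    set φ := ψ (Fin.last _) with hφ
    have e1 : 𝔼 X, g (L X) * ∏ i, ψ i X = 𝔼 X, φ X * 𝔼 s : F, P (X + s • m) := by
      have h0 : ∀ s : F, 𝔼 X, φ X * P (X + s • m) = 𝔼 X, g (L X) * ∏ i, ψ i X := by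
        intro s
        rw [← expect_add_right_eq (fun X => g (L X) * ∏ i, ψ i X) (s • m)]
        refine expect_congr rfl fun X _ => ?_
        rw [Fin.prod_univ_castSucc, hinv, hP]
        ring
      have h2 : 𝔼 s : F, 𝔼 X, φ X * P (X + s • m) = 𝔼 X, g (L X) * ∏ i, ψ i X := by
        simp_rw [h0]; exact Fintype.expect_const _
      rw [← h2, expect_comm]
      exact expect_congr rfl fun X _ => (mul_expect _ _ _).symm
    have e2 : (𝔼 X, g (L X) * ∏ i, ψ i X) ^ 2 ≤ 𝔼 X, (𝔼 s : F, P (X + s • m)) ^ 2 := by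
      rw [e1]
      refine (sq_expect_mul_le _ _).trans ?_
      refine mul_le_of_le_one_left (expect_nonneg fun _ _ => sq_nonneg _) ?_
      exact expect_le univ_nonempty fun X _ => (sq_le_one_iff_abs_le_one _).2 (hψ _ X)
    have e3 : 𝔼 X, (𝔼 s : F, P (X + s • m)) ^ 2 = 𝔼 h : F, 𝔼 X, P X * P (X + h • m) := by
      have h0 : ∀ X, (𝔼 s : F, P (X + s • m)) ^ 2
          = 𝔼 s : F, 𝔼 h : F, P (X + s • m) * P (X + s • m + h • m) := by
        intro X
        rw [sq, expect_mul]
        refine expect_congr rfl fun s _ => ?_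
        rw [mul_expect, ← expect_add_left_eq (fun h => P (X + s • m) * P (X + h • m)) s]
        simp only [add_smul, add_assoc]
      simp_rw [h0]
      rw [expect_comm]
      have h3 : ∀ s : F, 𝔼 X, 𝔼 h : F, P (X + s • m) * P (X + s • m + h • m)
          = 𝔼 h : F, 𝔼 X, P X * P (X + h • m) := by
        intro s
        rw [expect_add_right_eq (fun X => 𝔼 h : F, P X * P (X + h • m)) (s • m), expect_comm]
      simp_rw [h3]; exact Fintype.expect_const _
    have e4 : ∀ h : F, |𝔼 X, P X * P (X + h • m)| ^ 2 ^ (k + 1)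
        ≤ gowersU (k + 1) (fun x => g x * g (x + h * L m)) := by
      intro h
      have := ih (fun i => M i.castSucc) (fun i => hL _)
        (fun i X => ψ i.castSucc X * ψ i.castSucc (X + h • m)) (fun i X => by
          rw [abs_mul]; exact mul_le_one₀ (hψ _ _) (abs_nonneg _) (hψ _ _))
        (fun i s X => by
          simp only [hinv, add_right_comm X (s • M i.castSucc) (h • m)])
        (fun x => g x * g (x + h * L m))
      refine le_trans (le_of_eq ?_) this
      congr 2
      refine expect_congr rfl fun X _ => ?_
      simp only [hP, prod_mul_distrib, map_add, map_smul, smul_eq_mul]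
      ring
    calc |𝔼 X, g (L X) * ∏ i, ψ i X| ^ 2 ^ (k + 1 + 1)
        = ((𝔼 X, g (L X) * ∏ i, ψ i X) ^ 2) ^ 2 ^ (k + 1) := by
          rw [← sq_abs, ← pow_mul, pow_succ 2 (k + 1), mul_comm]
      _ ≤ |𝔼 h : F, 𝔼 X, P X * P (X + h • m)| ^ 2 ^ (k + 1) := by
          refine pow_le_pow_left₀ (sq_nonneg _) ?_ _
          exact (e2.trans_eq e3).trans (le_abs_self _)
      _ ≤ 𝔼 h : F, |𝔼 X, P X * P (X + h • m)| ^ 2 ^ (k + 1) := abs_expect_pow_two_pow_le _ _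
      _ ≤ 𝔼 h : F, gowersU (k + 1) (fun x => g x * g (x + h * L m)) :=
          expect_le_expect fun h _ => e4 h
      _ = gowersU (k + 1 + 1) g := by
          rw [gowersU]
          exact Fintype.expect_equiv (Equiv.mulRight₀ _ (hL (Fin.last _))) _ _ (fun _ => rfl)

end

end

section

/-- Functions on `V` that are controlled by averages of products of bounded functions, the `i`-th of
which is invariant under the `i`-th direction `M i` (lifted to an auxiliary module). -/
inductive Structured (F : Type) [Field F] {ι : Type} [Fintype ι] {V : Type} [AddCommGroup V]
    [Module F V] (M : ι → V) : ℝ → (V → ℝ) → Prop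
  | base (Θ : Type) [AddCommGroup Θ] [Module F Θ] [Fintype Θ] (τ : ι → Θ) (ψ : ι → V → Θ → ℝ)
      (hb : ∀ i X θ, |ψ i X θ| ≤ 1)
      (hinv : ∀ i (s : F) X θ, ψ i (X + s • M i) (θ + s • τ i) = ψ i X θ) :
      Structured F M 1 (fun X => 𝔼 θ, ∏ i, ψ i X θ)
  | add {C₁ C₂ : ℝ} {Ψ₁ Ψ₂ : V → ℝ} : Structured F M C₁ Ψ₁ → Structured F M C₂ Ψ₂ →
      Structured F M (C₁ + C₂) (fun X => Ψ₁ X + Ψ₂ X)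
  | smul {C : ℝ} {Ψ : V → ℝ} (c : ℝ) : Structured F M C Ψ →
      Structured F M (|c| * C) (fun X => c * Ψ X)
  | mono {C C' : ℝ} {Ψ : V → ℝ} : C ≤ C' → Structured F M C Ψ → Structured F M C' Ψ

namespace Structured

variable {F : Type} [Field F] {ι : Type} [Fintype ι] {V : Type} [AddCommGroup V] [Module F V]
  {V' : Type} [AddCommGroup V'] [Module F V'] {M : ι → V} {C C' : ℝ} {Ψ Ψ' : V → ℝ}

theorem nonneg (h : Structured F M C Ψ) : 0 ≤ C := by
  induction h with
  | base => exact zero_le_one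
  | add _ _ h₁ h₂ => exact add_nonneg h₁ h₂
  | smul c _ h => exact mul_nonneg (abs_nonneg _) h
  | mono hC _ h => exact h.trans hC

theorem congr (h : Structured F M C Ψ) (he : ∀ X, Ψ X = Ψ' X) : Structured F M C Ψ' := by
  obtain rfl : Ψ = Ψ' := funext he
  exact h

theorem comp (h : Structured F M C Ψ) (L : V' →ₗ[F] V) (M' : ι → V') (c : ι → F)
    (hL : ∀ i, L (M' i) = c i • M i) : Structured F M' C (fun X => Ψ (L X)) := by
  induction h with
  | base Θ τ ψ hb hinv =>
    refine .base Θ (fun i => c i • τ i) (fun i X θ => ψ i (L X) θ) (fun i X θ => hb _ _ _) ?_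
    intro i s X θ
    simp only [map_add, map_smul, hL, smul_smul]
    exact hinv i (s * c i) _ _
  | add _ _ h₁ h₂ => exact .add h₁ h₂
  | smul c _ h => exact .smul c h
  | mono hC _ h => exact .mono hC h

theorem rescale (h : Structured F M C Ψ) (M' : ι → V) (c : ι → F)
    (hM : ∀ i, M' i = c i • M i) : Structured F M' C Ψ :=
  h.comp LinearMap.id M' c hM

theorem reindex {κ : Type} [Fintype κ] (h : Structured F M C Ψ) (σ : κ ≃ ι) :
    Structured F (fun j => M (σ j)) C Ψ := by
  induction h with
  | base Θ τ ψ hb hinv =>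
    refine (Structured.base (M := fun j => M (σ j)) Θ (fun j => τ (σ j)) (fun j => ψ (σ j))
      (fun j => hb _) (fun j => hinv _)).congr fun X => ?_
    exact expect_congr rfl fun θ _ => Equiv.prod_comp σ (fun i => ψ i X θ)
  | add _ _ h₁ h₂ => exact .add h₁ h₂
  | smul c _ h => exact .smul c h
  | mono hC _ h => exact .mono hC h

theorem mul (h : Structured F M C Ψ) (h' : Structured F M C' Ψ') :
    Structured F M (C * C') (fun X => Ψ X * Ψ' X) := by
  induction h with
  | base Θ τ ψ hb hinv =>
    induction h' with
    | base Θ' τ' ψ' hb' hinv' =>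
      refine ((Structured.base (Θ × Θ') (fun i => (τ i, τ' i))
        (fun i X θ => ψ i X θ.1 * ψ' i X θ.2) (fun i X θ => ?_) (fun i s X θ => ?_)).congr
        (fun X => ?_)).mono (one_mul 1).ge
      · rw [abs_mul]; exact mul_le_one₀ (hb _ _ _) (abs_nonneg _) (hb' _ _ _)
      · simp [hinv, hinv']
      · rw [expect_prod_type, expect_mul_expect]
        simp only [prod_mul_distrib]
    | add _ _ h₁ h₂ =>
      exact ((h₁.add h₂).congr fun X => by ring).mono (by linarith)
    | smul c _ h => exact ((h.smul c).congr fun X => by ring).mono (le_of_eq (by ring))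
    | mono hC _ h => exact h.mono (by simpa using hC)
  | add _ _ h₁ h₂ => exact ((h₁.add h₂).congr fun X => by ring).mono (le_of_eq (by ring))
  | smul c _ h => exact ((h.smul c).congr fun X => by ring).mono (le_of_eq (by ring))
  | mono hC _ h => exact h.mono (mul_le_mul_of_nonneg_right hC h'.nonneg)

theorem expect {Y : Type} [AddCommGroup Y] [Module F Y] [Fintype Y] {τ : ι → Y} {Φ : V × Y → ℝ}
    (h : Structured F (fun i => (M i, τ i)) C Φ) : Structured F M C (fun X => 𝔼 y, Φ (X, y)) := by
  induction h with
  | base Θ τ' ψ hb hinv =>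
    refine (Structured.base (M := M) (Y × Θ) (fun i => (τ i, τ' i))
      (fun i X θ => ψ i (X, θ.1) θ.2) (fun i X θ => hb _ _ _) (fun i s X θ => ?_)).congr
      (fun X => ?_)
    · exact hinv i s (X, θ.1) θ.2
    · rw [expect_prod_type]
  | add _ _ h₁ h₂ => exact (h₁.add h₂).congr fun X => (expect_add_distrib _ _ _).symm
  | smul c _ h => exact (h.smul c).congr fun X => mul_expect _ _ _
  | mono hC _ h => exact h.mono hC

theorem of_invariant [DecidableEq ι] (i : ι) (hb : ∀ X, |Ψ X| ≤ 1)
    (hinv : ∀ (s : F) X, Ψ (X + s • M i) = Ψ X) : Structured F M 1 Ψ := by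
  refine (Structured.base (M := M) PUnit (fun _ => 0) (fun j X _ => if j = i then Ψ X else 1)
    (fun j X θ => ?_) (fun j s X θ => ?_)).congr fun X => ?_
  · split_ifs
    · exact hb X
    · simp
  · split_ifs with hj
    · rw [hj]; exact hinv s X
    · rfl
  · simp

theorem prod [DecidableEq ι] {κ : Type*} (s : Finset κ) (Φ : κ → V → ℝ)
    (h : ∀ a ∈ s, Structured F M 1 (Φ a)) (hι : Nonempty ι) :
    Structured F M 1 (fun X => ∏ a ∈ s, Φ a X) := by
  classical
  induction s using Finset.induction_on with
  | empty => exact (of_invariant (Ψ := fun _ => 1) hι.some (by simp) (by simp)).congr (by simp)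
  | insert a s ha ih =>
    refine (((h a (by simp)).mul (ih fun b hb => h b (by simp [hb]))).congr fun X => ?_).mono
      (one_mul 1).le
    rw [prod_insert ha]

theorem sum {κ : Type*} (s : Finset κ) (Φ : κ → V → ℝ) (D : κ → ℝ)
    (h : ∀ a ∈ s, Structured F M (D a) (Φ a)) (hs : s.Nonempty) :
    Structured F M (∑ a ∈ s, D a) (fun X => ∑ a ∈ s, Φ a X) := by
  classical
  induction hs using Finset.Nonempty.cons_induction with
  | singleton a => simpa using h a (by simp)
  | cons a s ha hs ih =>
    simp only [sum_cons]
    exact (h a (by simp)).add (ih fun b hb => h b (by simp [hb]))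

theorem abs_expect_mul_le [Fintype F] [Fintype V] {k : ℕ} {M : Fin (k + 1) → V}
    (h : Structured F M C Ψ) (L : V →ₗ[F] F) (hL : ∀ i, L (M i) ≠ 0) (g : F → ℝ) {ε : ℝ}
    (hε : 0 ≤ ε) (hg : gowersU (k + 1) g ≤ ε ^ 2 ^ (k + 1)) :
    |𝔼 X, g (L X) * Ψ X| ≤ C * ε := by
  induction h with
  | base Θ τ ψ hb hinv =>
    have := generalized_von_neumann (L.comp (LinearMap.fst F V Θ)) k (fun i => (M i, τ i))
      (fun i => by simpa using hL i) (fun i X => ψ i X.1 X.2) (fun i X => hb _ _ _)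
      (fun i s X => hinv i s X.1 X.2) g
    rw [one_mul]
    refine le_of_pow_le_pow_left₀ (n := 2 ^ (k + 1)) (by positivity) hε (le_trans ?_ hg)
    refine le_trans (le_of_eq ?_) this
    rw [expect_prod_type]
    simp [mul_expect]
  | @add _ _ Ψ₁ Ψ₂ _ _ h₁ h₂ =>
    simp only [mul_add, expect_add_distrib]
    refine (abs_add_le _ _).trans ?_
    linarith
  | @smul _ Ψ₁ c _ h =>
    simp only [mul_left_comm _ c, ← mul_expect, abs_mul]
    rw [mul_assoc]
    exact mul_le_mul_of_nonneg_left h (abs_nonneg _)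
  | mono hC _ h => exact h.trans (mul_le_mul_of_nonneg_right hC hε)

end Structured

end

section

section
variable {F : Type} [Field F] [Fintype F] {n : ℕ}

/-- The sum of the coordinates selected by a vertex of the discrete cube. -/
def vertexSum {k : ℕ} (ω : Fin k → Bool) : (Fin k → F) →ₗ[F] F :=
  ∑ i, if ω i then LinearMap.proj i else 0

theorem vertexSum_apply {k : ℕ} (ω : Fin k → Bool) (t : Fin k → F) :
    vertexSum ω t = ∑ i, if ω i then t i else 0 := by
  simp only [vertexSum, LinearMap.sum_apply]
  refine sum_congr rfl fun i _ => ?_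
  split_ifs <;> rfl

/-- The vertex of the cube supported on the first two coordinates. -/
def edgeVertex (n : ℕ) : Fin (n + 2) → Bool := fun i => decide (i = 0 ∨ i = 1)

/-- The vertices of the cube other than the origin and `edgeVertex`. -/
def otherVertices (n : ℕ) : Finset (Fin (n + 2) → Bool) :=
  univ.filter fun ω => ω ≠ (fun _ => false) ∧ ω ≠ edgeVertex n

theorem vertexSum_edgeVertex (t : Fin (n + 2) → F) : vertexSum (edgeVertex n) t = t 0 + t 1 := by
  rw [vertexSum_apply, Fin.sum_univ_succ, Fin.sum_univ_succ]
  have h : ∀ x : Fin n, x.succ.succ ≠ 1 := fun x hx => by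
    simpa using congrArg Fin.val hx
  simp [edgeVertex, Fin.succ_ne_zero, h]

/-- The weight of a cube `t` based at the pair `z`. -/
noncomputable def boxWeight (f : F → ℝ) (z : F × F) (t : Fin (n + 2) → F) : ℝ :=
  ∏ ω ∈ otherVertices n, f (z.1 + vertexSum ω t) * f (z.2 + vertexSum ω t)

/-- The averaging operator over cubes with two opposite corners of a face singled out. -/
noncomputable def boxOp (n : ℕ) (f : F → ℝ) : Module.End ℝ (F × F → ℝ) where
  toFun G z := 𝔼 t : Fin (n + 2) → F, boxWeight f z t *
    G (z.1 + vertexSum (edgeVertex n) t, z.2 + vertexSum (edgeVertex n) t)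
  map_add' G G' := by
    funext z; simp only [Pi.add_apply, mul_add, expect_add_distrib]
  map_smul' c G := by
    funext z; simp only [Pi.smul_apply, smul_eq_mul, RingHom.id_apply, mul_expect, mul_left_comm]

theorem boxOp_apply (f : F → ℝ) (G : F × F → ℝ) (z : F × F) :
    boxOp n f G z = 𝔼 t : Fin (n + 2) → F, boxWeight f z t *
      G (z.1 + vertexSum (edgeVertex n) t, z.2 + vertexSum (edgeVertex n) t) := rfl

/-- The function `(x, y) ↦ f x * f y`. -/
def pairFn (f : F → ℝ) (z : F × F) : ℝ := f z.1 * f z.2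

theorem abs_pairFn_le {f : F → ℝ} (hf : ∀ x, |f x| ≤ 1) (z : F × F) : |pairFn f z| ≤ 1 := by
  rw [pairFn, abs_mul]; exact mul_le_one₀ (hf _) (abs_nonneg _) (hf _)

theorem abs_prod_le_one {κ : Type*} (s : Finset κ) (u : κ → ℝ) (h : ∀ a ∈ s, |u a| ≤ 1) :
    |∏ a ∈ s, u a| ≤ 1 := by
  rw [abs_prod]; exact prod_le_one (fun _ _ => abs_nonneg _) h

theorem abs_expect_le_one {X : Type*} [Fintype X] [Nonempty X] (u : X → ℝ) (h : ∀ x, |u x| ≤ 1) :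
    |𝔼 x, u x| ≤ 1 :=
  (abs_expect_le _ _).trans (expect_le univ_nonempty fun x _ => h x)

theorem abs_boxWeight_le {f : F → ℝ} (hf : ∀ x, |f x| ≤ 1) (z : F × F) (t : Fin (n + 2) → F) :
    |boxWeight f z t| ≤ 1 :=
  abs_prod_le_one _ _ fun ω _ => by
    rw [abs_mul]; exact mul_le_one₀ (hf _) (abs_nonneg _) (hf _)

theorem abs_boxOp_le {f : F → ℝ} (hf : ∀ x, |f x| ≤ 1) {G : F × F → ℝ} (hG : ∀ z, |G z| ≤ 1)
    (z : F × F) : |boxOp n f G z| ≤ 1 := by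
  rw [boxOp_apply]
  refine abs_expect_le_one _ fun t => ?_
  rw [abs_mul]; exact mul_le_one₀ (abs_boxWeight_le hf _ _) (abs_nonneg _) (hG _)

theorem abs_boxOp_pow_le {f : F → ℝ} (hf : ∀ x, |f x| ≤ 1) (l : ℕ) (z : F × F) :
    |(boxOp n f ^ l) (pairFn f) z| ≤ 1 := by
  induction l generalizing z with
  | zero => exact abs_pairFn_le hf z
  | succ l ih => rw [pow_succ', Module.End.mul_apply]; exact abs_boxOp_le hf ih z

/-- Shifting a pair diagonally by a vertex of a cube, as a linear map. -/
def diagShift {k : ℕ} (ω : Fin k → Bool) : (F × F) × (Fin k → F) →ₗ[F] F × F :=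
  LinearMap.fst F _ _ +
    (LinearMap.prod (vertexSum ω) (vertexSum ω)).comp (LinearMap.snd F _ _)

theorem diagShift_apply {k : ℕ} (ω : Fin k → Bool) (X : (F × F) × (Fin k → F)) :
    diagShift ω X = (X.1.1 + vertexSum ω X.2, X.1.2 + vertexSum ω X.2) := rfl

theorem structured_boxOp {f : F → ℝ} (hf : ∀ x, |f x| ≤ 1) {M : Fin (n + 2) → F × F}
    (τ : Fin (n + 2) → Fin (n + 2) → F)
    (h₁ : ∀ ω ∈ otherVertices n, ∃ i, (M i).1 + vertexSum ω (τ i) = 0)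
    (h₂ : ∀ ω ∈ otherVertices n, ∃ i, (M i).2 + vertexSum ω (τ i) = 0)
    {C : ℝ} {G : F × F → ℝ}
    (hG : Structured F (fun i => ((M i).1 + (τ i 0 + τ i 1), (M i).2 + (τ i 0 + τ i 1))) C G) :
    Structured F M C (boxOp n f G) := by
  have hw : Structured F (fun i => (M i, τ i)) 1
      (fun X : (F × F) × (Fin (n + 2) → F) => boxWeight f X.1 X.2) := by
    refine Structured.prod _ _ (fun ω hω => ?_) ⟨0⟩
    refine Structured.mono (one_mul 1).le (Structured.mul ?_ ?_)
    · obtain ⟨i, hi⟩ := h₁ ω hω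
      refine Structured.of_invariant i (fun X => hf _) fun s X => ?_
      congr 1
      simp only [Prod.fst_add, Prod.snd_add, Prod.smul_fst, Prod.smul_snd, map_add, map_smul,
        smul_eq_mul]
      linear_combination s * hi
    · obtain ⟨i, hi⟩ := h₂ ω hω
      refine Structured.of_invariant i (fun X => hf _) fun s X => ?_
      congr 1
      simp only [Prod.fst_add, Prod.snd_add, Prod.smul_fst, Prod.smul_snd, map_add, map_smul,
        smul_eq_mul]
      linear_combination s * hi
  have hG' := hG.comp (diagShift (edgeVertex n)) (fun i => (M i, τ i)) (fun _ => 1) (fun i => by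
    simp [diagShift_apply, vertexSum_edgeVertex])
  exact (((hw.mul hG').mono (one_mul C).le).expect).congr fun z => rfl

theorem vertexSum_single {k : ℕ} (ω : Fin k → Bool) (i : Fin k) (a : F) :
    vertexSum ω (Pi.single i a) = if ω i then a else 0 := by
  rw [vertexSum_apply, sum_eq_single i]
  · simp
  · intro j _ hj; simp [Pi.single_eq_of_ne hj]
  · simp

theorem exists_of_mem_otherVertices {ω : Fin (n + 2) → Bool} (h : ω ∈ otherVertices n) :
    (∃ i, i ≠ 0 ∧ i ≠ 1 ∧ ω i = true) ∨ (ω 0 = true ∧ ω 1 = false) ∨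
      (ω 0 = false ∧ ω 1 = true) := by
  simp only [otherVertices, mem_filter, mem_univ, true_and] at h
  by_contra! hc
  obtain ⟨h1, h2, h3⟩ := hc
  have hi : ∀ i, i ≠ 0 → i ≠ 1 → ω i = false := fun i h0 h1' => by
    simpa using h1 i h0 h1'
  cases h0 : ω 0
  · have : ω 1 = false := by simpa using h3 h0
    refine h.1 (funext fun i => ?_)
    by_cases a : i = 0
    · rw [a, h0]
    by_cases b : i = 1
    · rw [b, this]
    exact hi i a b
  · have : ω 1 = true := by simpa using h2 h0
    refine h.2 (funext fun i => ?_)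
    by_cases a : i = 0
    · simp [a, h0, edgeVertex]
    by_cases b : i = 1
    · simp [b, this, edgeVertex]
    simp [edgeVertex, a, b, hi i a b]

theorem structured_boxOp_of_diagonal {f : F → ℝ} (hf : ∀ x, |f x| ≤ 1)
    {M : Fin (n + 2) → F × F} (hM : ∀ i, (M i).1 = (M i).2) {G : F × F → ℝ}
    (hG : ∀ z, |G z| ≤ 1) : Structured F M 1 (boxOp n f G) := by
  have key : ∀ ω ∈ otherVertices n, ∃ i, (M i).1 + vertexSum ω (Pi.single i (-(M i).1)) = 0 := by
    intro ω hω
    obtain ⟨i, -, -, h⟩ | ⟨h, -⟩ | ⟨-, h⟩ := exists_of_mem_otherVertices hω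
    · exact ⟨i, by simp [vertexSum_single, h]⟩
    · exact ⟨0, by simp [vertexSum_single, h]⟩
    · exact ⟨1, by simp [vertexSum_single, h]⟩
  refine structured_boxOp hf (fun i => Pi.single i (-(M i).1)) key ?_ ?_
  · simpa only [hM] using key
  · exact Structured.of_invariant 0 hG fun s X => by
      congr 1; ext <;> simp [hM]

/-- One application of `boxOp`, with prescribed lifts in the first two directions. -/
theorem structured_boxOp_lift {f : F → ℝ} (hf : ∀ x, |f x| ≤ 1) {M : Fin (n + 2) → F × F}
    (hM : ∀ i, i ≠ 0 → i ≠ 1 → (M i).1 = (M i).2) (u₀ v₀ u₁ v₁ : F)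
    (hx₀ : (M 0).1 + u₀ = 0 ∨ (M 1).1 + u₁ = 0) (hx₁ : (M 0).1 + v₀ = 0 ∨ (M 1).1 + v₁ = 0)
    (hy₀ : (M 0).2 + u₀ = 0 ∨ (M 1).2 + u₁ = 0) (hy₁ : (M 0).2 + v₀ = 0 ∨ (M 1).2 + v₁ = 0)
    {M' : Fin (n + 2) → F × F} (hM' : ∀ i, i ≠ 0 → i ≠ 1 → M' i = M i) (c : F)
    (h₀ : ((M 0).1 + (u₀ + v₀), (M 0).2 + (u₀ + v₀)) = c • M' 0)
    (h₁ : ((M 1).1 + (u₁ + v₁), (M 1).2 + (u₁ + v₁)) = c • M' 1)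
    {C : ℝ} {G : F × F → ℝ} (hG : Structured F M' C G) : Structured F M C (boxOp n f G) := by
  classical
  set τ : Fin (n + 2) → Fin (n + 2) → F := fun i =>
    if i = 0 then Pi.single 0 u₀ + Pi.single 1 v₀
    else if i = 1 then Pi.single 0 u₁ + Pi.single 1 v₁ else Pi.single i (-(M i).1) with hτ
  have key : ∀ p : F × F → F, (∀ i, i ≠ 0 → i ≠ 1 → p (M i) = (M i).1) →
      (p (M 0) + u₀ = 0 ∨ p (M 1) + u₁ = 0) → (p (M 0) + v₀ = 0 ∨ p (M 1) + v₁ = 0) →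
      ∀ ω ∈ otherVertices n, ∃ i, p (M i) + vertexSum ω (τ i) = 0 := by
    intro p hp h0 h1 ω hω
    obtain ⟨i, hi0, hi1, h⟩ | ⟨h, h'⟩ | ⟨h, h'⟩ := exists_of_mem_otherVertices hω
    · exact ⟨i, by simp [hτ, hi0, hi1, vertexSum_single, h, hp i hi0 hi1]⟩
    · obtain h0 | h0 := h0
      · exact ⟨0, by simp [hτ, vertexSum_single, h, h', h0]⟩
      · exact ⟨1, by simp [hτ, vertexSum_single, h, h', h0]⟩
    · obtain h1 | h1 := h1
      · exact ⟨0, by simp [hτ, vertexSum_single, h, h', h1]⟩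
      · exact ⟨1, by simp [hτ, vertexSum_single, h, h', h1]⟩
  refine structured_boxOp hf τ (key Prod.fst (fun _ _ _ => rfl) hx₀ hx₁)
    (key Prod.snd (fun i a b => (hM i a b).symm) hy₀ hy₁) ?_
  refine hG.rescale _ (fun i => if i = 0 ∨ i = 1 then c else 1) fun i => ?_
  by_cases a : i = 0
  · subst a; simpa [hτ] using h₀
  by_cases b : i = 1
  · subst b; simpa [hτ] using h₁
  simp [hτ, a, b, hM' i a b, Ne.symm a, Ne.symm b]

theorem structured_boxOp_pow_aux {f : F → ℝ} (hf : ∀ x, |f x| ≤ 1) (l j : ℕ) (hj : j ≤ l)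
    (M : Fin (n + 2) → F × F) (hM : ∀ i, i ≠ 0 → i ≠ 1 → (M i).1 = (M i).2)
    (h : (M 0 = ((j : F), (j : F) + 1) ∧ M 1 = ((j : F) + 1, (j : F))) ∨
      (M 0 = ((j : F) + 1, (j : F)) ∧ M 1 = ((j : F), (j : F) + 1))) :
    Structured F M 1 ((boxOp n f ^ l) (pairFn f)) := by
  induction l generalizing j M with
  | zero =>
    obtain rfl : j = 0 := by omega
    rw [pow_zero, Module.End.one_apply]
    refine Structured.mono (one_mul 1).le (Structured.mul ?_ ?_)
    · obtain ⟨h0, h1⟩ | ⟨h0, h1⟩ := h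
      · exact Structured.of_invariant 0 (fun X => hf _) fun s X => by simp [h0]
      · exact Structured.of_invariant 1 (fun X => hf _) fun s X => by simp [h1]
    · obtain ⟨h0, h1⟩ | ⟨h0, h1⟩ := h
      · exact Structured.of_invariant 1 (fun X => hf _) fun s X => by simp [h1]
      · exact Structured.of_invariant 0 (fun X => hf _) fun s X => by simp [h0]
  | succ l ih =>
    rw [pow_succ', Module.End.mul_apply]
    by_cases hjl : j ≤ l
    · have hG := ih j hjl (fun i => if i = 0 then ((M 0).2, (M 0).1) else
        if i = 1 then ((M 1).2, (M 1).1) else M i) (fun i a b => by simp [a, b, hM i a b])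
        (by obtain ⟨h0, h1⟩ | ⟨h0, h1⟩ := h <;> simp [h0, h1])
      refine structured_boxOp_lift hf hM (-(M 0).1) (-(M 0).2) (-(M 1).2) (-(M 1).1)
        (by simp) (by simp) (by simp) (by simp) (fun i a b => by simp [a, b]) (-1) ?_ ?_ hG
      · ext <;> simp
      · ext <;> simp
    · obtain rfl : j = l + 1 := by omega
      obtain ⟨h0, h1⟩ | ⟨h0, h1⟩ := h
      · have hG := ih l le_rfl (fun i => if i = 0 then ((l : F) + 1, (l : F)) else
          if i = 1 then ((l : F), (l : F) + 1) else M i) (fun i a b => by simp [a, b, hM i a b])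
          (by simp)
        refine structured_boxOp_lift hf hM (-(M 0).1) (-(M 0).1) (-(M 1).2) (-(M 1).2)
          (by simp) (by simp) (by simp) (by simp) (fun i a b => by simp [a, b]) (-1) ?_ ?_ hG
        · ext <;> simp [h0] <;> ring
        · ext <;> simp [h1] <;> ring
      · have hG := ih l le_rfl (fun i => if i = 0 then ((l : F), (l : F) + 1) else
          if i = 1 then ((l : F) + 1, (l : F)) else M i) (fun i a b => by simp [a, b, hM i a b])
          (by simp)
        refine structured_boxOp_lift hf hM (-(M 0).2) (-(M 0).2) (-(M 1).1) (-(M 1).1)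
          (by simp) (by simp) (by simp) (by simp) (fun i a b => by simp [a, b]) (-1) ?_ ?_ hG
        · ext <;> simp [h0] <;> ring
        · ext <;> simp [h1] <;> ring

theorem structured_boxOp_pow {f : F → ℝ} (hf : ∀ x, |f x| ≤ 1) {l j : ℕ} (hj : j ≤ l)
    {M : Fin (n + 2) → F × F} {α β : Fin (n + 2)} (hαβ : α ≠ β) (c d : F)
    (hM : ∀ i, i ≠ α → i ≠ β → (M i).1 = (M i).2)
    (hα : M α = c • ((j : F), (j : F) + 1)) (hβ : M β = d • ((j : F) + 1, (j : F))) :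
    Structured F M 1 ((boxOp n f ^ l) (pairFn f)) := by
  obtain ⟨σ, hσα, hσβ⟩ : ∃ σ : Fin (n + 2) ≃ Fin (n + 2), σ α = 0 ∧ σ β = 1 := by
    refine ⟨(Equiv.swap α 0).trans (Equiv.swap (Equiv.swap α 0 β) 1), ?_, ?_⟩
    · simp only [Equiv.trans_apply, Equiv.swap_apply_left]
      refine Equiv.swap_apply_of_ne_of_ne (fun h => ?_) (by simp)
      have h2 : Equiv.swap α 0 α = Equiv.swap α 0 β := by
        rw [Equiv.swap_apply_left]; exact h
      exact hαβ ((Equiv.swap α 0).injective h2)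
    · simp
  have h := structured_boxOp_pow_aux hf l j hj (fun i => if i = 0 then ((j : F), (j : F) + 1) else
    if i = 1 then ((j : F) + 1, (j : F)) else M (σ.symm i)) (fun i a b => by
      simp only [a, b, if_false]
      refine hM _ (fun h => a ?_) (fun h => b ?_)
      · rw [← hσα, ← h, Equiv.apply_symm_apply]
      · rw [← hσβ, ← h, Equiv.apply_symm_apply]) (by simp)
  refine (h.reindex σ).rescale M (fun i => if i = α then c else if i = β then d else 1) fun i => ?_
  by_cases a : i = α
  · subst a; simp [hσα, hα]
  by_cases b : i = β
  · subst b; simp [hσβ, hβ, a]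
  have h0 : σ i ≠ 0 := fun h => a (σ.injective (h.trans hσα.symm))
  have h1 : σ i ≠ 1 := fun h => b (σ.injective (h.trans hσβ.symm))
  simp [a, b, h0, h1]

end

end

section

section
variable {F : Type} [Field F] [Fintype F] {n : ℕ}

/-- Composition with a kernel, as an operator on kernels. -/
noncomputable def kernelOp (A : F × F → ℝ) : Module.End ℝ (F × F → ℝ) where
  toFun B z := 𝔼 y, A (z.1, y) * B (y, z.2)
  map_add' G G' := by
    funext z; simp only [Pi.add_apply, mul_add, expect_add_distrib]
  map_smul' c G := by
    funext z; simp only [Pi.smul_apply, smul_eq_mul, RingHom.id_apply, mul_expect, mul_left_comm]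

theorem kernelOp_apply (A B : F × F → ℝ) (z : F × F) :
    kernelOp A B z = 𝔼 y, A (z.1, y) * B (y, z.2) := rfl

theorem structured_kernelOp {k : ℕ} {D D' D'' : Fin k → F} {A B : F × F → ℝ} {C C' : ℝ}
    (hA : Structured F (fun i => (D i, D' i)) C A) (hB : Structured F (fun i => (D' i, D'' i)) C' B) :
    Structured F (fun i => (D i, D'' i)) (C * C') (kernelOp A B) := by
  let L₁ : (F × F) × F →ₗ[F] F × F :=
    LinearMap.prod ((LinearMap.fst F F F).comp (LinearMap.fst F _ _)) (LinearMap.snd F _ _)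
  let L₂ : (F × F) × F →ₗ[F] F × F :=
    LinearMap.prod (LinearMap.snd F _ _) ((LinearMap.snd F F F).comp (LinearMap.fst F _ _))
  have h₁ := hA.comp L₁ (fun i => ((D i, D'' i), D' i)) (fun _ => 1) (fun i => by simp [L₁])
  have h₂ := hB.comp L₂ (fun i => ((D i, D'' i), D' i)) (fun _ => 1) (fun i => by simp [L₂])
  exact (h₁.mul h₂).expect.congr fun z => rfl

/-- The sum of the absolute values of the coefficients of a polynomial. -/
noncomputable def coeffSum (Q : Polynomial ℝ) : ℝ := ∑ i ∈ range (Q.natDegree + 1), |Q.coeff i|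

/-- A polynomial in `boxOp` applied to `pairFn`, involving only powers at least `m`. -/
noncomputable def boxPoly (n : ℕ) (f : F → ℝ) (m : ℕ) (Q : Polynomial ℝ) : F × F → ℝ :=
  Polynomial.aeval (boxOp n f) (Polynomial.X ^ m * Q) (pairFn f)

theorem boxPoly_apply (f : F → ℝ) (m : ℕ) (Q : Polynomial ℝ) (z : F × F) :
    boxPoly n f m Q z = ∑ i ∈ range (Q.natDegree + 1),
      Q.coeff i * (boxOp n f ^ (m + i)) (pairFn f) z := by
  rw [boxPoly, map_mul, map_pow, Polynomial.aeval_X, Polynomial.aeval_eq_sum_range, mul_sum]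
  simp [pow_add]

theorem structured_boxPoly {f : F → ℝ} {M : Fin (n + 2) → F × F} {m : ℕ} (Q : Polynomial ℝ)
    (h : ∀ l, m ≤ l → Structured F M 1 ((boxOp n f ^ l) (pairFn f))) :
    Structured F M (coeffSum Q) (boxPoly n f m Q) := by
  refine (Structured.sum _ (fun i z => Q.coeff i * (boxOp n f ^ (m + i)) (pairFn f) z)
    (fun i => |Q.coeff i|) (fun i _ => ?_) (by simp)).congr fun z => (boxPoly_apply f m Q z).symm
  exact (Structured.smul _ (h _ (Nat.le_add_right _ _))).mono (mul_one _).le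

/-- The displacement vector attached to an integer vector `e`. -/
noncomputable def dispVec (F : Type) [Field F] (e : Fin (n + 1) → ℕ) : Fin (n + 2) → F :=
  Fin.cons (∏ i, (e i : F))⁻¹ fun i => (e i : F)

theorem structured_step {f : F → ℝ} (hf : ∀ x, |f x| ≤ 1) {m : ℕ} (Q : Polynomial ℝ)
    (e : Fin (n + 1) → ℕ) (i : Fin (n + 1)) (he : ∀ j, (e j : F) ≠ 0) (hi : (e i : F) + 1 ≠ 0)
    (hm : e i ≤ m) :
    Structured F (fun j => (dispVec F e j, dispVec F (Function.update e i (e i + 1)) j))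
      (coeffSum Q) (boxPoly n f m Q) := by
  refine structured_boxPoly Q fun l hl => ?_
  have hc : ∀ j, ((Function.update e i (e i + 1) j : ℕ) : F)
      = Function.update (fun j => (e j : F)) i ((e i : F) + 1) j := fun j => by
    by_cases h : j = i
    · subst h; simp
    · simp [h]
  refine structured_boxOp_pow hf (hm.trans hl) (α := i.succ) (β := 0) (Fin.succ_ne_zero i) 1
    (((e i : F) * ((e i : F) + 1) * ∏ j ∈ univ \ {i}, (e j : F))⁻¹) (fun j hj h0 => ?_) ?_ ?_
  · obtain ⟨j, rfl⟩ := Fin.exists_succ_eq.2 h0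
    have : j ≠ i := fun h => hj (by rw [h])
    simp [dispVec, this]
  · simp [dispVec]
  · simp only [dispVec, Fin.cons_zero, hc, prod_update_of_mem (mem_univ i)]
    have hP : ∏ j ∈ univ \ {i}, (e j : F) ≠ 0 := prod_ne_zero_iff.2 fun j _ => he j
    have hei := he i
    rw [prod_eq_mul_prod_sdiff_singleton_of_mem (mem_univ i)]
    ext
    · simp only [Prod.smul_mk, smul_eq_mul]
      field_simp
    · simp only [Prod.smul_mk, smul_eq_mul]
      field_simp

theorem structured_chain {f : F → ℝ} (hf : ∀ x, |f x| ≤ 1) {m p' : ℕ} (hm : p' ≤ m) (hm1 : 1 ≤ m)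
    (Q : Polynomial ℝ) (hp' : ∀ r, 1 ≤ r → r ≤ p' → (r : F) ≠ 0) (s : ℕ)
    (e e' : Fin (n + 1) → ℕ) (he1 : ∀ i, 1 ≤ e i) (hle : ∀ i, e i ≤ e' i) (he' : ∀ i, e' i ≤ p')
    (hs : ∑ i, (e' i - e i) = s) (J : ℕ) (hJ : s ≤ J) :
    Structured F (fun j => (dispVec F e j, dispVec F e' j))
      (coeffSum Q ^ (J + 1)) ((kernelOp (boxPoly n f m Q) ^ J) (boxPoly n f m Q)) := by
  induction s generalizing e J with
  | zero =>
    obtain rfl : e = e' := funext fun i => by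
      have := (sum_eq_zero_iff.1 hs) i (mem_univ i)
      have := hle i
      omega
    have h1 : Structured F (fun j => (dispVec F e j, dispVec F e j)) (coeffSum Q)
        (boxPoly n f m Q) := by
      refine structured_boxPoly Q fun l hl => ?_
      obtain ⟨l, rfl⟩ : ∃ l', l = l' + 1 := ⟨l - 1, by omega⟩
      rw [pow_succ', Module.End.mul_apply]
      exact structured_boxOp_of_diagonal hf (fun _ => rfl) (abs_boxOp_pow_le hf l)
    clear hJ
    induction J with
    | zero => simpa using h1
    | succ J ih =>
      rw [pow_succ' (kernelOp _), Module.End.mul_apply, pow_succ' (coeffSum Q)]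
      exact structured_kernelOp h1 ih
  | succ s ih =>
    obtain ⟨i, hi⟩ : ∃ i, e i < e' i := by
      by_contra! hc
      have : ∑ i, (e' i - e i) = 0 := sum_eq_zero fun i _ => by have := hc i; omega
      omega
    obtain ⟨J, rfl⟩ : ∃ J', J = J' + 1 := ⟨J - 1, by omega⟩
    rw [pow_succ' (kernelOp _), Module.End.mul_apply, pow_succ' (coeffSum Q)]
    refine structured_kernelOp (D' := dispVec F (Function.update e i (e i + 1))) ?_ ?_
    · refine structured_step hf Q e i (fun j => hp' _ (he1 j) ((hle j).trans (he' j))) ?_ ?_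
      · have := hp' (e i + 1) (by omega) (by have := he' i; omega)
        exact_mod_cast this
      · have := he' i; omega
    · refine ih _ (fun j => ?_) (fun j => ?_) ?_ J (by omega)
      · by_cases h : j = i
        · subst h; simp
        · simpa [h] using he1 j
      · by_cases h : j = i
        · subst h; simpa using hi
        · simpa [h] using hle j
      · rw [← add_sum_erase _ _ (mem_univ i)] at hs ⊢
        rw [Function.update_self]
        have : ∑ x ∈ univ.erase i, (e' x - Function.update e i (e i + 1) x)
            = ∑ x ∈ univ.erase i, (e' x - e x) :=
          sum_congr rfl fun x hx => by rw [Function.update_of_ne (ne_of_mem_erase hx)]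
        omega

theorem structured_kernel_pow {f : F → ℝ} (hf : ∀ x, |f x| ≤ 1) {m p p' : ℕ} (hp : 1 ≤ p)
    (hpp : p ≤ p') (hm : p' ≤ m) (Q : Polynomial ℝ) (hp' : ∀ r, 1 ≤ r → r ≤ p' → (r : F) ≠ 0)
    (J : ℕ) (hJ : (n + 1) * p' ≤ J) (M : Fin (n + 2) → F × F) (c : F)
    (h₀ : M 0 = c • ((p' : F) ^ (n + 1), (p : F) ^ (n + 1)))
    (hM : ∀ i, i ≠ 0 → M i = ((p : F), (p' : F))) :
    Structured F M (coeffSum Q ^ (J + 1))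
      ((kernelOp (boxPoly n f m Q) ^ J) (boxPoly n f m Q)) := by
  have hp0 : (p : F) ≠ 0 := hp' p hp hpp
  have hp0' : (p' : F) ≠ 0 := hp' p' (hp.trans hpp) le_rfl
  have h := structured_chain hf hm (by omega) Q hp' _ (fun _ : Fin (n + 1) => p) (fun _ => p')
    (fun _ => hp) (fun _ => hpp) (fun _ => le_rfl) rfl J (by
      simp only [sum_const, card_univ, Fintype.card_fin, smul_eq_mul]
      exact (Nat.mul_le_mul_left _ (Nat.sub_le _ _)).trans hJ)
  refine h.rescale M (fun i => if i = 0 then c * ((p : F) ^ (n + 1) * (p' : F) ^ (n + 1)) else 1)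
    fun i => ?_
  by_cases hi : i = 0
  · subst hi
    simp only [h₀, dispVec, Fin.cons_zero, prod_const, card_univ, Fintype.card_fin, if_true]
    ext
    · simp only [Prod.smul_mk, smul_eq_mul]; field_simp
    · simp only [Prod.smul_mk, smul_eq_mul]; field_simp
  · obtain ⟨j, rfl⟩ := Fin.exists_succ_eq.2 hi
    simp [hM _ hi, dispVec]

end

end

section

section
variable {X : Type*} [Fintype X]

/-- The normalised `L²` norm on a finite set. -/
noncomputable def l2norm (u : X → ℝ) : ℝ := √(𝔼 x, u x ^ 2)

theorem l2norm_nonneg (u : X → ℝ) : 0 ≤ l2norm u := Real.sqrt_nonneg _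

theorem l2norm_sq (u : X → ℝ) : l2norm u ^ 2 = 𝔼 x, u x ^ 2 :=
  Real.sq_sqrt (expect_nonneg fun _ _ => sq_nonneg _)

theorem abs_expect_mul_le_l2norm (u v : X → ℝ) : |𝔼 x, u x * v x| ≤ l2norm u * l2norm v := by
  refine abs_le_of_sq_le_sq ?_ (mul_nonneg (l2norm_nonneg _) (l2norm_nonneg _))
  rw [mul_pow, l2norm_sq, l2norm_sq]
  exact sq_expect_mul_le u v

theorem l2norm_le_of_sq_le {u : X → ℝ} {c : ℝ} (hc : 0 ≤ c) (h : 𝔼 x, u x ^ 2 ≤ c ^ 2) :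
    l2norm u ≤ c := by
  refine le_of_sq_le_sq ?_ hc
  rwa [l2norm_sq]

theorem l2norm_add_le (u v : X → ℝ) : l2norm (u + v) ≤ l2norm u + l2norm v := by
  refine l2norm_le_of_sq_le (add_nonneg (l2norm_nonneg _) (l2norm_nonneg _)) ?_
  have h : 𝔼 x, (u + v) x ^ 2 = 𝔼 x, u x ^ 2 + 2 * 𝔼 x, u x * v x + 𝔼 x, v x ^ 2 := by
    rw [mul_expect, ← expect_add_distrib, ← expect_add_distrib]
    exact expect_congr rfl fun x _ => by simp only [Pi.add_apply]; ring
  have := (abs_le.1 (abs_expect_mul_le_l2norm u v)).2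
  rw [h, ← l2norm_sq, ← l2norm_sq]
  nlinarith

theorem l2norm_neg (u : X → ℝ) : l2norm (-u) = l2norm u := by simp [l2norm]

theorem l2norm_sub_le (u v : X → ℝ) : l2norm (u - v) ≤ l2norm u + l2norm v := by
  rw [sub_eq_add_neg, ← l2norm_neg v]; exact l2norm_add_le _ _

theorem l2norm_smul (c : ℝ) (u : X → ℝ) : l2norm (c • u) = |c| * l2norm u := by
  simp only [l2norm, Pi.smul_apply, smul_eq_mul, mul_pow, ← mul_expect]
  rw [Real.sqrt_mul (sq_nonneg c), Real.sqrt_sq_eq_abs]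

theorem l2norm_zero : l2norm (0 : X → ℝ) = 0 := by simp [l2norm]

theorem l2norm_sum_le {ι : Type*} (s : Finset ι) (u : ι → X → ℝ) :
    l2norm (∑ i ∈ s, u i) ≤ ∑ i ∈ s, l2norm (u i) := by
  classical
  induction s using Finset.induction_on with
  | empty => simp [l2norm_zero]
  | insert a s ha ih =>
    rw [sum_insert ha, sum_insert ha]
    exact (l2norm_add_le _ _).trans (by gcongr)

theorem l2norm_le_one [Nonempty X] {u : X → ℝ} (h : ∀ x, |u x| ≤ 1) : l2norm u ≤ 1 :=
  l2norm_le_of_sq_le zero_le_one <| by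
    rw [one_pow]
    exact expect_le univ_nonempty fun x _ => (sq_le_one_iff_abs_le_one _).2 (h x)

/-- Self-adjoint operators with spectrum in `[0, 1]`. -/
structure PosContr (A : Module.End ℝ (X → ℝ)) : Prop where
  symm : ∀ u v, 𝔼 x, u x * A v x = 𝔼 x, A u x * v x
  nonneg : ∀ u, 0 ≤ 𝔼 x, u x * A u x
  le : ∀ u, 𝔼 x, u x * A u x ≤ 𝔼 x, u x ^ 2

variable {A : Module.End ℝ (X → ℝ)}

theorem PosContr.one_sub_symm (h : PosContr A) (u v : X → ℝ) :
    𝔼 x, u x * (1 - A) v x = 𝔼 x, (1 - A) u x * v x := by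
  simp only [LinearMap.sub_apply, Module.End.one_apply, Pi.sub_apply, mul_sub, sub_mul,
    expect_sub_distrib, h.symm u v]

theorem PosContr.one_sub_nonneg (h : PosContr A) (u : X → ℝ) :
    0 ≤ 𝔼 x, u x * (1 - A) u x := by
  have := h.le u
  simp only [LinearMap.sub_apply, Module.End.one_apply, Pi.sub_apply, mul_sub,
    expect_sub_distrib, ← sq]
  linarith

theorem PosContr.one_sub_pow_symm (h : PosContr A) (j : ℕ) (u v : X → ℝ) :
    𝔼 x, u x * ((1 - A) ^ j) v x = 𝔼 x, ((1 - A) ^ j) u x * v x := by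
  induction j generalizing u v with
  | zero => rfl
  | succ j ih =>
    rw [pow_succ, Module.End.mul_apply, ih, h.one_sub_symm]
    rw [← Module.End.mul_apply, ← pow_succ', pow_succ]

theorem PosContr.l2norm_one_sub_le (h : PosContr A) (u : X → ℝ) :
    l2norm ((1 - A) u) ≤ l2norm u := by
  refine l2norm_le_of_sq_le (l2norm_nonneg _) ?_
  rw [l2norm_sq]
  have h1 := h.one_sub_nonneg (A u)
  have h2 := h.nonneg ((1 - A) u)
  have h3 := h.nonneg u
  have e1 : A ((1 - A) u) = A u - A (A u) := by simp
  have e2 : (1 - A) (A u) = A u - A (A u) := by simp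
  have e3 : (1 - A) u = u - A u := by simp
  have hs := h.symm (A u) u
  have hs' := h.symm u (A u)
  rw [e1, e3] at h2
  rw [e2] at h1
  rw [e3]
  simp only [Pi.sub_apply] at *
  have key : 𝔼 x, A u x * (A u x - A (A u) x) + 𝔼 x, (u x - A u x) * (A u x - A (A u) x)
      = 𝔼 x, u x * A u x - 𝔼 x, u x * A (A u) x := by
    rw [← expect_add_distrib, ← expect_sub_distrib]
    exact expect_congr rfl fun x _ => by ring
  have key2 : 𝔼 x, (u x - A u x) ^ 2
      = 𝔼 x, u x ^ 2 - 2 * 𝔼 x, u x * A u x + 𝔼 x, A u x * A u x := by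
    rw [mul_expect, ← expect_sub_distrib, ← expect_add_distrib]
    exact expect_congr rfl fun x _ => by ring
  linarith

theorem PosContr.l2norm_one_sub_pow_le (h : PosContr A) (j : ℕ) (u : X → ℝ) :
    l2norm (((1 - A) ^ j) u) ≤ l2norm u := by
  induction j with
  | zero => simp
  | succ j ih =>
    rw [pow_succ', Module.End.mul_apply]
    exact (h.l2norm_one_sub_le _).trans ih

theorem PosContr.expect_le_div (h : PosContr A) (v : X → ℝ) (M : ℕ) :
    𝔼 x, v x * (A * (1 - A) ^ (2 * M)) v x ≤ (𝔼 x, v x ^ 2) / (2 * M + 1) := by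
  have comm : Commute A (1 - A) := (Commute.one_right A).sub_right (Commute.refl A)
  have split : ∀ (B : Module.End ℝ (X → ℝ)) (i : ℕ), Commute B (1 - A) →
      𝔼 x, v x * (B * (1 - A) ^ (2 * i)) v x
        = 𝔼 x, ((1 - A) ^ i) v x * B (((1 - A) ^ i) v) x := by
    intro B i hB
    rw [two_mul, pow_add, ← mul_assoc, (hB.pow_right i).eq, mul_assoc, Module.End.mul_apply,
      h.one_sub_pow_symm, Module.End.mul_apply]
  set e : ℕ → ℝ := fun j => 𝔼 x, v x * (A * (1 - A) ^ j) v x with he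
  have anti : Antitone e := by
    refine antitone_nat_of_succ_le fun j => ?_
    have e1 : e j - e (j + 1) = 𝔼 x, v x * (A * A * (1 - A) ^ j) v x := by
      have : A * A * (1 - A) ^ j = A * (1 - A) ^ j - A * (1 - A) ^ (j + 1) := by
        rw [pow_succ', ← mul_assoc A (1 - A), mul_sub A 1 A, mul_one, sub_mul, sub_sub_cancel]
      rw [this]
      simp only [he, LinearMap.sub_apply, Pi.sub_apply, mul_sub, expect_sub_distrib]
    have e2 : 0 ≤ 𝔼 x, v x * (A * A * (1 - A) ^ j) v x := by
      obtain ⟨i, rfl | rfl⟩ := Nat.even_or_odd' j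
      · rw [split _ _ (comm.mul_left comm), Module.End.mul_apply, h.symm]
        exact expect_nonneg fun x _ => mul_self_nonneg _
      · rw [pow_succ', ← mul_assoc, split _ _ ((comm.mul_left comm).mul_left (Commute.refl _)),
          mul_assoc, Module.End.mul_apply, h.symm, comm.eq, Module.End.mul_apply]
        exact h.one_sub_nonneg _
    linarith
  have tel : ∀ J : ℕ, ∑ j ∈ range J, A * (1 - A) ^ j = 1 - (1 - A) ^ J := by
    intro J
    induction J with
    | zero => simp
    | succ J ih => rw [sum_range_succ, ih, pow_succ', sub_mul, one_mul]; abel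
  have hsum : ∑ j ∈ range (2 * M + 1), e j ≤ 𝔼 x, v x ^ 2 := by
    have e1 : ∑ j ∈ range (2 * M + 1), e j
        = 𝔼 x, v x * (∑ j ∈ range (2 * M + 1), A * (1 - A) ^ j) v x := by
      simp only [he, LinearMap.sum_apply, Finset.sum_apply, mul_sum]
      rw [expect_sum_comm]
    have e2 := split (1 - A) M (Commute.refl _)
    rw [← pow_succ'] at e2
    have e3 := h.one_sub_nonneg (((1 - A) ^ M) v)
    rw [e1, tel]
    rw [LinearMap.sub_apply]
    simp only [Module.End.one_apply, Pi.sub_apply, mul_sub, expect_sub_distrib, ← sq]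
    linarith
  rw [le_div_iff₀ (by positivity)]
  have h2 : ∑ j ∈ range (2 * M + 1), e (2 * M) ≤ ∑ j ∈ range (2 * M + 1), e j :=
    sum_le_sum fun j hj => anti (by have := mem_range.1 hj; omega)
  rw [sum_const, card_range, nsmul_eq_mul] at h2
  push_cast at h2
  linarith

/-- A polynomial divisible by `X ^ r` which approximates `1` away from `0`. -/
noncomputable def cutoffPoly (M r : ℕ) : Polynomial ℝ := (1 - (1 - Polynomial.X) ^ M) ^ r

theorem X_pow_dvd_cutoffPoly (M r : ℕ) : Polynomial.X ^ r ∣ cutoffPoly M r := by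
  refine pow_dvd_pow_of_dvd ?_ r
  have := sub_dvd_pow_sub_pow (1 : Polynomial ℝ) (1 - Polynomial.X) M
  simpa using this

theorem PosContr.l2norm_sub_cutoff_le (h : PosContr A) (w : X → ℝ) (M r : ℕ) :
    l2norm (w - Polynomial.aeval A (cutoffPoly M r) w) ≤ 2 ^ r * l2norm (((1 - A) ^ M) w) := by
  suffices l2norm (w - Polynomial.aeval A (cutoffPoly M r) w)
      ≤ (2 ^ r - 1) * l2norm (((1 - A) ^ M) w) from
    this.trans (by nlinarith [l2norm_nonneg (((1 - A) ^ M) w)])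
  have e : ∀ r, Polynomial.aeval A (cutoffPoly M r) = (1 - (1 - A) ^ M) ^ r := fun r => by
    simp [cutoffPoly]
  rw [e]
  induction r with
  | zero => simp [l2norm_zero]
  | succ r ih =>
    set B := (1 - A) ^ M with hB
    set D := w - ((1 - B) ^ r) w with hD
    have : w - ((1 - B) ^ (r + 1)) w = B w + (D - B D) := by
      rw [pow_succ', Module.End.mul_apply, hD]
      simp only [LinearMap.sub_apply, Module.End.one_apply, map_sub]
      abel
    rw [this]
    have h1 := l2norm_add_le (B w) (D - B D)
    have h2 := l2norm_sub_le D (B D)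
    have h3 : l2norm (B D) ≤ l2norm D := h.l2norm_one_sub_pow_le M D
    rw [pow_succ]
    nlinarith [l2norm_nonneg (B w)]

end

end

section

section
variable {F : Type} [Field F] [Fintype F] {n : ℕ}

theorem expect_fin_succ {k : ℕ} (u : (Fin (k + 1) → F) → ℝ) :
    𝔼 t, u t = 𝔼 h, 𝔼 t : Fin k → F, u (Fin.cons h t) := by
  rw [← expect_prod_type (fun p : F × (Fin k → F) => u (Fin.cons p.1 p.2))]
  exact (Fintype.expect_equiv (Fin.consEquiv fun _ => F) _ _ fun _ => rfl).symm

theorem prod_vertex_succ {k : ℕ} (u : (Fin (k + 1) → Bool) → ℝ) :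
    ∏ ω, u ω = ∏ ω : Fin k → Bool, u (Fin.cons false ω) * u (Fin.cons true ω) := by
  rw [← Fintype.prod_equiv (Fin.consEquiv fun _ => Bool) (fun p => u (Fin.cons p.1 p.2)) _
    fun _ => rfl, Fintype.prod_prod_type, Fintype.prod_bool, mul_comm, prod_mul_distrib]

theorem vertexSum_cons {k : ℕ} (b : Bool) (ω : Fin k → Bool) (h : F) (t : Fin k → F) :
    vertexSum (Fin.cons b ω) (Fin.cons h t) = (if b then h else 0) + vertexSum ω t := by
  simp [vertexSum_apply, Fin.sum_univ_succ]

theorem gowersU_eq_cube (k : ℕ) (f : F → ℝ) :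
    gowersU k f = 𝔼 x, 𝔼 t : Fin k → F, ∏ ω, f (x + vertexSum ω t) := by
  induction k generalizing f with
  | zero => simp [gowersU, vertexSum_apply]
  | succ k ih =>
    rw [gowersU]
    simp_rw [ih, expect_fin_succ (k := k), prod_vertex_succ, vertexSum_cons]
    rw [expect_comm]
    refine expect_congr rfl fun x _ => expect_congr rfl fun h _ => expect_congr rfl fun t _ =>
      prod_congr rfl fun ω _ => ?_
    simp only [Bool.false_eq_true, if_false, if_true, zero_add]
    rw [add_assoc, add_comm h]

/-- The product of `f` over all vertices of a cube other than the base point. -/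
noncomputable def punctured {k : ℕ} (f : F → ℝ) (t : Fin k → F) (x : F) : ℝ :=
  ∏ ω ∈ univ.erase (fun _ => false), f (x + vertexSum ω t)

theorem mul_punctured {k : ℕ} (f : F → ℝ) (t : Fin k → F) (x : F) :
    f x * punctured f t x = ∏ ω, f (x + vertexSum ω t) := by
  rw [punctured, ← mul_prod_erase univ _ (mem_univ (fun _ => false))]
  simp [vertexSum_apply]

theorem abs_punctured_le {k : ℕ} {f : F → ℝ} (hf : ∀ x, |f x| ≤ 1) (t : Fin k → F) (x : F) :
    |punctured f t x| ≤ 1 := abs_prod_le_one _ _ fun _ _ => hf _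

/-- The average over `t` of the rank one kernels `punctured f t ⊗ punctured f t`. -/
noncomputable def cubeKernel (k : ℕ) (f : F → ℝ) (z : F × F) : ℝ :=
  𝔼 t : Fin k → F, punctured f t z.1 * punctured f t z.2

theorem abs_cubeKernel_le {k : ℕ} {f : F → ℝ} (hf : ∀ x, |f x| ≤ 1) (z : F × F) :
    |cubeKernel k f z| ≤ 1 := abs_expect_le_one _ fun t => by
  rw [abs_mul]
  exact mul_le_one₀ (abs_punctured_le hf _ _) (abs_nonneg _) (abs_punctured_le hf _ _)

theorem gowersU_succ_eq (k : ℕ) (f : F → ℝ) :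
    gowersU (k + 1) f = 𝔼 z : F × F, f z.1 * f z.2 * cubeKernel k f z := by
  have e : ∀ x y : F, f x * f y * cubeKernel k f (x, y)
      = 𝔼 t : Fin k → F, (∏ ω, f (x + vertexSum ω t)) * ∏ ω, f (y + vertexSum ω t) := by
    intro x y
    rw [cubeKernel, mul_expect]
    refine expect_congr rfl fun t _ => ?_
    rw [← mul_punctured, ← mul_punctured]; ring
  rw [expect_prod_type, gowersU]
  simp only [e, gowersU_eq_cube]
  rw [expect_comm]
  refine expect_congr rfl fun x _ => ?_
  refine Eq.trans ?_ (expect_add_left_eq _ x)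
  refine expect_congr rfl fun h _ => expect_congr rfl fun t _ => ?_
  rw [← prod_mul_distrib]
  exact prod_congr rfl fun ω _ => by rw [add_right_comm]

theorem edgeVertex_ne : edgeVertex n ≠ fun _ => false := fun h => by
  have := congrFun h 0
  simp [edgeVertex] at this

theorem cubeKernel_eq_boxOp (f : F → ℝ) : cubeKernel (n + 2) f = boxOp n f (pairFn f) := by
  funext z
  rw [boxOp_apply, cubeKernel]
  refine expect_congr rfl fun t _ => ?_
  have h : univ.erase (fun _ => false) = insert (edgeVertex n) (otherVertices n) := by
    ext ω
    simp only [otherVertices, mem_erase, mem_univ, mem_insert, mem_filter, true_and]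
    constructor
    · intro h; by_cases h' : ω = edgeVertex n <;> simp_all
    · rintro (h | h)
      · rw [h]; exact ⟨edgeVertex_ne, trivial⟩
      · exact ⟨h.1, trivial⟩
  have h' : edgeVertex n ∉ otherVertices n := by simp [otherVertices]
  rw [punctured, punctured, h, prod_insert h', prod_insert h', boxWeight, prod_mul_distrib, pairFn]
  ring

/-- Negating the first two coordinates. -/
def negEdge (t : Fin (n + 2) → F) : Fin (n + 2) → F := fun i => if edgeVertex n i then -t i else t i

theorem negEdge_negEdge (t : Fin (n + 2) → F) : negEdge (negEdge t) = t := by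
  funext i; simp only [negEdge]; split_ifs <;> simp

theorem vertexSum_sub_edge (ω : Fin (n + 2) → Bool) (t : Fin (n + 2) → F) :
    vertexSum ω t - vertexSum (edgeVertex n) t
      = vertexSum (fun i => xor (ω i) (edgeVertex n i)) (negEdge t) := by
  simp only [vertexSum_apply, ← sum_sub_distrib, negEdge]
  refine sum_congr rfl fun i _ => ?_
  cases ω i <;> cases edgeVertex n i <;> simp

theorem vertexSum_edge_negEdge (t : Fin (n + 2) → F) :
    vertexSum (edgeVertex n) (negEdge t) = - vertexSum (edgeVertex n) t := by
  simp only [vertexSum_apply, ← sum_neg_distrib, negEdge]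
  refine sum_congr rfl fun i _ => ?_
  cases edgeVertex n i <;> simp

theorem boxWeight_sub_edge (f : F → ℝ) (z : F × F) (t : Fin (n + 2) → F) :
    boxWeight f (z.1 - vertexSum (edgeVertex n) t, z.2 - vertexSum (edgeVertex n) t) t
      = boxWeight f z (negEdge t) := by
  have hmem : ∀ ω ∈ otherVertices n, (fun i => xor (ω i) (edgeVertex n i)) ∈ otherVertices n := by
    intro ω hω
    simp only [otherVertices, mem_filter, mem_univ, true_and] at hω ⊢
    refine ⟨fun h => hω.2 ?_, fun h => hω.1 ?_⟩
    · funext i; have := congrFun h i; revert this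
      cases ω i <;> cases edgeVertex n i <;> simp
    · funext i; have := congrFun h i; revert this
      cases ω i <;> cases edgeVertex n i <;> simp
  rw [boxWeight, boxWeight]
  refine prod_nbij' (fun ω i => xor (ω i) (edgeVertex n i)) (fun ω i => xor (ω i) (edgeVertex n i))
    hmem hmem (fun ω _ => by funext i; simp) (fun ω _ => by funext i; simp) fun ω _ => ?_
  rw [← vertexSum_sub_edge]
  simp only [sub_add_eq_add_sub, add_sub_assoc]

theorem boxOp_symm (f : F → ℝ) (u v : F × F → ℝ) :
    𝔼 z, u z * boxOp n f v z = 𝔼 z, boxOp n f u z * v z := by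
  simp only [boxOp_apply, mul_expect, expect_mul]
  rw [expect_comm, expect_comm (s := univ) (t := univ)
    (f := fun z t => boxWeight f z t * u (z.1 + vertexSum (edgeVertex n) t,
      z.2 + vertexSum (edgeVertex n) t) * v z)]
  refine Fintype.expect_equiv ⟨negEdge, negEdge, negEdge_negEdge, negEdge_negEdge⟩ _ _ fun t => ?_
  set s := vertexSum (edgeVertex n) t with hs
  refine Eq.trans ?_ (expect_add_right_eq _ (s, s))
  refine expect_congr rfl fun z _ => ?_
  have h : boxWeight f (z + (s, s)) (negEdge t) = boxWeight f z t := by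
    rw [← boxWeight_sub_edge, ← hs]; simp
  simp only [Equiv.coe_fn_mk, vertexSum_edge_negEdge, h, Prod.fst_add, Prod.snd_add, ← hs,
    add_neg_cancel_right]
  have : z + (s, s) = (z.1 + s, z.2 + s) := rfl
  rw [this]
  ring

theorem expect_boxOp_sq_le {f : F → ℝ} (hf : ∀ x, |f x| ≤ 1) (u : F × F → ℝ) :
    𝔼 z, boxOp n f u z ^ 2 ≤ 𝔼 z, u z ^ 2 := by
  have h1 : ∀ z, boxOp n f u z ^ 2 ≤ 𝔼 t : Fin (n + 2) → F,
      u (z + (vertexSum (edgeVertex n) t, vertexSum (edgeVertex n) t)) ^ 2 := by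
    intro z
    rw [boxOp_apply]
    refine (sq_expect_mul_le _ _).trans ?_
    refine mul_le_of_le_one_left (expect_nonneg fun _ _ => sq_nonneg _) ?_
    exact expect_le univ_nonempty fun t _ =>
      (sq_le_one_iff_abs_le_one _).2 (abs_boxWeight_le hf z t)
  refine (expect_le_expect fun z _ => h1 z).trans_eq ?_
  rw [expect_comm]
  have h2 : ∀ t : Fin (n + 2) → F, 𝔼 z : F × F,
      u (z + (vertexSum (edgeVertex n) t, vertexSum (edgeVertex n) t)) ^ 2 = 𝔼 z, u z ^ 2 :=
    fun t => expect_add_right_eq (fun z => u z ^ 2) _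
  simp_rw [h2]
  exact Fintype.expect_const _

theorem posContr_boxOp_sq {f : F → ℝ} (hf : ∀ x, |f x| ≤ 1) : PosContr (boxOp n f ^ 2) where
  symm u v := by
    rw [sq, Module.End.mul_apply, Module.End.mul_apply, boxOp_symm, boxOp_symm]
  nonneg u := by
    rw [sq, Module.End.mul_apply, boxOp_symm]
    exact expect_nonneg fun z _ => mul_self_nonneg _
  le u := by
    rw [sq, Module.End.mul_apply, boxOp_symm]
    simpa only [sq] using expect_boxOp_sq_le hf u

theorem kernelOp_cubeKernel_inner (k : ℕ) (f : F → ℝ) (u v : F × F → ℝ) :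
    𝔼 z, u z * kernelOp (cubeKernel k f) v z = 𝔼 y, 𝔼 t : Fin k → F,
      (𝔼 x, punctured f t x * u (x, y)) * 𝔼 x, punctured f t x * v (x, y) := by
  rw [expect_prod_type, expect_comm]
  refine expect_congr rfl fun y _ => ?_
  simp only [kernelOp_apply, cubeKernel, mul_expect, expect_mul]
  refine Eq.trans ?_ (expect_comm _ _ _).symm
  refine (expect_comm _ _ _).trans (expect_congr rfl fun x' _ => ?_)
  refine (expect_comm _ _ _).trans (expect_congr rfl fun t _ => expect_congr rfl fun x _ => ?_)
  ring

theorem posContr_kernelOp {k : ℕ} {f : F → ℝ} (hf : ∀ x, |f x| ≤ 1) :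
    PosContr (kernelOp (cubeKernel k f)) where
  symm u v := by
    rw [kernelOp_cubeKernel_inner]
    simp only [mul_comm (kernelOp _ _ _), kernelOp_cubeKernel_inner]
    exact expect_congr rfl fun y _ => expect_congr rfl fun t _ => mul_comm _ _
  nonneg u := by
    rw [kernelOp_cubeKernel_inner]
    exact expect_nonneg fun y _ => expect_nonneg fun t _ => mul_self_nonneg _
  le u := by
    rw [kernelOp_cubeKernel_inner, expect_prod_type, expect_comm (s := univ) (t := univ)
      (f := fun x y => u (x, y) ^ 2)]
    refine expect_le_expect fun y _ => expect_le univ_nonempty fun t _ => ?_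
    rw [← sq]
    refine (sq_expect_mul_le _ _).trans ?_
    refine mul_le_of_le_one_left (expect_nonneg fun _ _ => sq_nonneg _) ?_
    exact expect_le univ_nonempty fun x _ =>
      (sq_le_one_iff_abs_le_one _).2 (abs_punctured_le hf t x)

end

end

section

section
variable {F : Type} [Field F] [Fintype F] {n : ℕ}

theorem l2norm_boxOp_tail_sq_le {f : F → ℝ} (hf : ∀ x, |f x| ≤ 1) (M : ℕ) :
    l2norm (((1 - boxOp n f ^ 2 : Module.End ℝ (F × F → ℝ)) ^ M) (boxOp n f (pairFn f))) ^ 2 ≤ 1 / (2 * M + 1) := by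
  have h := posContr_boxOp_sq (n := n) hf
  set T := boxOp n f with hT
  have hc : Commute T (1 - T ^ 2) := (Commute.one_right T).sub_right ((Commute.refl T).pow_right 2)
  rw [l2norm_sq]
  simp only [sq (((1 - T ^ 2 : Module.End ℝ (F × F → ℝ)) ^ M) (T (pairFn f)) _)]
  rw [← h.one_sub_pow_symm, ← Module.End.mul_apply, ← pow_add, ← two_mul, ← boxOp_symm, ← hT,
    ← Module.End.mul_apply, ← Module.End.mul_apply, (hc.pow_right _).eq, mul_assoc, ← sq,
    ← ((h_comm hc).pow_right _).eq]
  refine (h.expect_le_div _ _).trans ?_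
  gcongr
  exact expect_le univ_nonempty fun z _ => (sq_le_one_iff_abs_le_one _).2 (abs_pairFn_le hf z)
where
  h_comm {T : Module.End ℝ (F × F → ℝ)} (hc : Commute T (1 - T ^ 2)) :
      Commute (T ^ 2) (1 - T ^ 2) := hc.pow_left 2

/-- Integration of the second variable of a kernel against a function. -/
noncomputable def integrateSnd (φ : F → ℝ) : Module.End ℝ (F × F → ℝ) where
  toFun B z := 𝔼 y, B (z.1, y) * φ y
  map_add' G G' := by
    funext z; simp only [Pi.add_apply, add_mul, expect_add_distrib]
  map_smul' c G := by
    funext z; simp only [Pi.smul_apply, smul_eq_mul, RingHom.id_apply, mul_expect, mul_assoc]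

theorem integrateSnd_apply (φ : F → ℝ) (B : F × F → ℝ) (z : F × F) :
    integrateSnd φ B z = 𝔼 y, B (z.1, y) * φ y := rfl

theorem commute_integrateSnd (φ : F → ℝ) (A : F × F → ℝ) :
    Commute (integrateSnd φ) (kernelOp A) := by
  ext1 B
  funext z
  simp only [Module.End.mul_apply, integrateSnd_apply, kernelOp_apply, mul_expect, expect_mul]
  rw [expect_comm]
  exact expect_congr rfl fun y _ => expect_congr rfl fun w _ => mul_assoc _ _ _

theorem l2norm_kernelOp_tail_sq_le {k : ℕ} {f : F → ℝ} (hf : ∀ x, |f x| ≤ 1) (M : ℕ) :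
    l2norm (((1 - kernelOp (cubeKernel k f)) ^ M) (cubeKernel k f)) ^ 2 ≤ 1 / (2 * M + 1) := by
  have h := posContr_kernelOp (k := k) hf
  set K := cubeKernel k f with hK
  set A := kernelOp K with hA
  rw [l2norm_sq]
  simp only [sq (((1 - A) ^ M) K _)]
  rw [← h.one_sub_pow_symm, ← Module.End.mul_apply, ← pow_add, ← two_mul]
  have e : ∀ B : F × F → ℝ, 𝔼 z, K z * B z = 𝔼 t : Fin k → F,
      𝔼 z, punctured f t z.1 * integrateSnd (punctured f t) B z := by
    intro B
    simp only [hK, cubeKernel, expect_mul]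
    rw [expect_comm]
    refine expect_congr rfl fun t _ => ?_
    rw [expect_prod_type, expect_prod_type]
    refine expect_congr rfl fun x _ => ?_
    simp only [integrateSnd_apply, mul_expect]
    rw [Fintype.expect_const]
    exact expect_congr rfl fun y _ => by ring
  rw [e]
  refine expect_le univ_nonempty fun t _ => ?_
  have hc : Commute (integrateSnd (punctured f t)) ((1 - A) ^ (2 * M)) :=
    ((Commute.one_right _).sub_right (commute_integrateSnd _ _)).pow_right _
  have h0 : integrateSnd (punctured f t) K = A fun z => punctured f t z.1 := rfl
  have hc' : Commute A ((1 - A) ^ (2 * M)) :=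
    ((Commute.one_right _).sub_right (Commute.refl _)).pow_right _
  rw [← Module.End.mul_apply, hc.eq, Module.End.mul_apply, h0, ← Module.End.mul_apply, ← hc'.eq]
  refine (h.expect_le_div (fun z => punctured f t z.1) _).trans ?_
  gcongr
  exact expect_le univ_nonempty fun z _ =>
    (sq_le_one_iff_abs_le_one _).2 (abs_punctured_le hf t z.1)

theorem l2norm_kernelOp_le (A B : F × F → ℝ) : l2norm (kernelOp A B) ≤ l2norm A * l2norm B := by
  refine l2norm_le_of_sq_le (mul_nonneg (l2norm_nonneg _) (l2norm_nonneg _)) ?_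
  rw [mul_pow, l2norm_sq, l2norm_sq, expect_prod_type, expect_prod_type (fun z => A z ^ 2),
    expect_prod_type (fun z => B z ^ 2), expect_comm (f := fun x y => B (x, y) ^ 2), expect_mul]
  refine expect_le_expect fun x _ => ?_
  rw [mul_expect]
  exact expect_le_expect fun y _ => sq_expect_mul_le (fun w => A (x, w)) fun w => B (w, y)

theorem kernelOp_sub (A B : F × F → ℝ) : kernelOp (A - B) = kernelOp A - kernelOp B := by
  ext1 C
  funext z
  simp only [LinearMap.sub_apply, Pi.sub_apply, kernelOp_apply, sub_mul, expect_sub_distrib]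

theorem l2norm_kernel_pow_sub_le {K H : F × F → ℝ} (hK : l2norm K ≤ 1) (hH : l2norm H ≤ 2)
    (j : ℕ) : l2norm ((kernelOp K ^ j) K - (kernelOp H ^ j) H) ≤ 2 ^ (j + 1) * l2norm (K - H) := by
  have hHj : ∀ j, l2norm ((kernelOp H ^ j) H) ≤ 2 ^ (j + 1) := by
    intro j
    induction j with
    | zero => simpa using hH
    | succ j ih =>
      rw [pow_succ', Module.End.mul_apply, pow_succ']
      exact (l2norm_kernelOp_le _ _).trans
        (mul_le_mul hH ih (l2norm_nonneg _) zero_le_two)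
  induction j with
  | zero => simp only [pow_zero, Module.End.one_apply, zero_add, pow_one]; linarith [l2norm_nonneg (K - H)]
  | succ j ih =>
    have e : (kernelOp K ^ (j + 1)) K - (kernelOp H ^ (j + 1)) H
        = kernelOp K ((kernelOp K ^ j) K - (kernelOp H ^ j) H)
          + kernelOp (K - H) ((kernelOp H ^ j) H) := by
      rw [kernelOp_sub, LinearMap.sub_apply, map_sub]
      simp only [pow_succ', Module.End.mul_apply]
      abel
    rw [e]
    refine (l2norm_add_le _ _).trans ?_
    have h1 := l2norm_kernelOp_le K ((kernelOp K ^ j) K - (kernelOp H ^ j) H)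
    have h2 := l2norm_kernelOp_le (K - H) ((kernelOp H ^ j) H)
    have h3 := mul_le_mul_of_nonneg_left (hHj j) (l2norm_nonneg (K - H))
    have h4 := mul_le_mul_of_nonneg_right hK
      (l2norm_nonneg ((kernelOp K ^ j) K - (kernelOp H ^ j) H))
    rw [pow_succ 2 (j + 1)]
    linarith

theorem exists_tail_bound (r : ℕ) {ε : ℝ} (hε : 0 < ε) :
    ∃ M : ℕ, ∀ a : ℝ, 0 ≤ a → a ^ 2 ≤ 1 / (2 * M + 1) → 2 ^ r * a ≤ ε := by
  obtain ⟨M, hM⟩ := exists_nat_gt ((2 ^ r / ε) ^ 2)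
  refine ⟨M, fun a ha h => ?_⟩
  by_contra! hc
  have h1 : ε ^ 2 < (2 ^ r * a) ^ 2 := by gcongr
  rw [div_pow, div_lt_iff₀ (by positivity)] at hM
  rw [le_div_iff₀ (by positivity)] at h
  rw [mul_pow] at h1
  have h2 : ε ^ 2 * (2 * M + 1) < (2 ^ r) ^ 2 * (a ^ 2 * (2 * M + 1)) := by
    rw [← mul_assoc]; exact mul_lt_mul_of_pos_right h1 (by positivity)
  nlinarith [sq_nonneg ((2 : ℝ) ^ r), sq_nonneg ε, Nat.cast_nonneg (α := ℝ) M]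

/-- Uniform approximation of `cubeKernel` by polynomials in box operators. -/
theorem exists_cubeKernel_approx (n m J : ℕ) {ε : ℝ} (hε : 0 < ε) :
    ∃ (Q : Polynomial ℝ) (c : ℕ → ℝ) (S : ℕ), (∀ j < J, c j = 0) ∧
      ∀ (F : Type) [Field F] [Fintype F] (f : F → ℝ), (∀ x, |f x| ≤ 1) →
        l2norm (cubeKernel (n + 2) f - ∑ j ∈ range S, c j •
          (kernelOp (boxPoly n f m Q) ^ j) (boxPoly n f m Q)) ≤ ε := by
  obtain ⟨M, hM⟩ := exists_tail_bound J (half_pos hε)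
  set P := cutoffPoly M J with hP
  set C := ∑ j ∈ range (P.natDegree + 1), |P.coeff j| * 2 ^ (j + 1) with hC
  have hC0 : 0 ≤ C := sum_nonneg fun j _ => by positivity
  set δ := min 1 (ε / (2 * (C + 1))) with hδ
  have hδ0 : 0 < δ := by positivity
  obtain ⟨M', hM'⟩ := exists_tail_bound m hδ0
  set P' := cutoffPoly M' m with hP'
  obtain ⟨Q, hQ⟩ : Polynomial.X ^ m ∣ Polynomial.X * (P'.comp (Polynomial.X ^ 2)) := by
    obtain ⟨R, hR⟩ := X_pow_dvd_cutoffPoly M' m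
    rw [hP', hR, Polynomial.mul_comp, Polynomial.X_pow_comp]
    refine Dvd.dvd.mul_left (Dvd.dvd.mul_right ?_ _) _
    exact pow_dvd_pow_of_dvd (dvd_pow_self _ two_ne_zero) m
  refine ⟨Q, P.coeff, P.natDegree + 1, fun j hj => ?_, fun F _ _ f hf => ?_⟩
  · exact Polynomial.X_pow_dvd_iff.1 (X_pow_dvd_cutoffPoly M J) j hj
  set K := cubeKernel (n + 2) f with hK
  set H := boxPoly n f m Q with hH
  have hKH : l2norm (K - H) ≤ δ := by
    have h1 := (posContr_boxOp_sq (n := n) hf).l2norm_sub_cutoff_le (boxOp n f (pairFn f)) M' m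
    have h2 := hM' _ (l2norm_nonneg _) (l2norm_boxOp_tail_sq_le (n := n) hf M')
    have h3 : H = Polynomial.aeval (boxOp n f ^ 2) P' (boxOp n f (pairFn f)) := by
      rw [hH, boxPoly, ← hQ, mul_comm, map_mul, Polynomial.aeval_comp, Module.End.mul_apply]
      simp
    rw [hK, cubeKernel_eq_boxOp, h3]
    exact h1.trans h2
  have hK1 : l2norm K ≤ 1 := l2norm_le_one (abs_cubeKernel_le hf)
  have hH2 : l2norm H ≤ 2 := by
    have := l2norm_sub_le K (K - H)
    rw [sub_sub_cancel] at this
    have : δ ≤ 1 := min_le_left _ _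
    linarith
  have h1 := ((posContr_kernelOp (k := n + 2) hf).l2norm_sub_cutoff_le K M J).trans
    (hM _ (l2norm_nonneg _) (l2norm_kernelOp_tail_sq_le (k := n + 2) hf M))
  rw [Polynomial.aeval_eq_sum_range, ← hP] at h1
  have e : K - ∑ j ∈ range (P.natDegree + 1), P.coeff j • (kernelOp H ^ j) H
      = (K - (∑ j ∈ range (P.natDegree + 1), P.coeff j • kernelOp (cubeKernel (n + 2) f) ^ j) K)
        + ∑ j ∈ range (P.natDegree + 1), P.coeff j • ((kernelOp K ^ j) K - (kernelOp H ^ j) H) := by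
    simp only [smul_sub, sum_sub_distrib, LinearMap.sum_apply, LinearMap.smul_apply, ← hK]
    abel
  rw [e]
  have h2 : l2norm (∑ j ∈ range (P.natDegree + 1),
      P.coeff j • ((kernelOp K ^ j) K - (kernelOp H ^ j) H)) ≤ C * δ := by
    refine (l2norm_sum_le _ _).trans ?_
    rw [hC, sum_mul]
    refine sum_le_sum fun j _ => ?_
    rw [l2norm_smul, mul_assoc]
    refine mul_le_mul_of_nonneg_left ?_ (abs_nonneg _)
    exact (l2norm_kernel_pow_sub_le hK1 hH2 j).trans (by gcongr)
  have h3 : C * δ ≤ ε / 2 := by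
    have : δ ≤ ε / (2 * (C + 1)) := min_le_right _ _
    calc C * δ ≤ (C + 1) * (ε / (2 * (C + 1))) := by gcongr; linarith
      _ = ε / 2 := by field_simp
  linarith [l2norm_add_le (K - (∑ j ∈ range (P.natDegree + 1),
    P.coeff j • kernelOp (cubeKernel (n + 2) f) ^ j) K) (∑ j ∈ range (P.natDegree + 1),
      P.coeff j • ((kernelOp K ^ j) K - (kernelOp H ^ j) H))]

end

end

/-- The balanced indicator of divisibility by `p`. -/
noncomputable def balancedDvd (p n : ℕ) : ℝ := (if p ∣ n then 1 else 0) - 1 / p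

theorem sum_ite_dvd (N p : ℕ) : ∑ n ∈ Ioc 0 N, (if p ∣ n then (1 : ℝ) else 0) = (N / p : ℕ) := by
  rw [sum_boole, Nat.Ioc_filter_dvd_card_eq_div]

theorem sum_balancedDvd_sq_le {p : ℕ} (hp : 2 ≤ p) (N : ℕ) :
    ∑ n ∈ Ioc 0 N, balancedDvd p n * balancedDvd p n ≤ N / p := by
  have h : ∀ n, balancedDvd p n * balancedDvd p n
      = (if p ∣ n then (1 : ℝ) else 0) * (1 - 2 / p) + 1 / p ^ 2 := fun n => by
    unfold balancedDvd; split_ifs <;> ring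
  simp_rw [h]
  rw [sum_add_distrib, ← sum_mul, sum_ite_dvd, sum_const, Nat.card_Ioc, nsmul_eq_mul]
  have hp' : (2 : ℝ) ≤ p := by exact_mod_cast hp
  have h1 : ((N / p : ℕ) : ℝ) ≤ N / p := Nat.cast_div_le
  have h2 : 0 ≤ 1 - 2 / (p : ℝ) := by rw [sub_nonneg, div_le_one (by linarith)]; exact hp'
  have h3 := mul_le_mul_of_nonneg_right h1 h2
  have h4 : (N : ℝ) / p * (1 - 2 / p) + ↑(N - 0) * (1 / p ^ 2) = N / p - N / p ^ 2 := by
    simp only [tsub_zero]; field_simp; ring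
  have h5 : (0 : ℝ) ≤ N / p ^ 2 := by positivity
  linarith

theorem abs_sum_balancedDvd_mul_le {p r : ℕ} (hp : 2 ≤ p) (hr : 2 ≤ r) (hpr : p.Coprime r) (N : ℕ) :
    |∑ n ∈ Ioc 0 N, balancedDvd p n * balancedDvd r n| ≤ 1 := by
  have h : ∀ n, balancedDvd p n * balancedDvd r n
      = (if p * r ∣ n then (1 : ℝ) else 0) - (if p ∣ n then (1 : ℝ) else 0) * (1 / r)
        - (if r ∣ n then (1 : ℝ) else 0) * (1 / p) + 1 / (p * r) := fun n => by
    unfold balancedDvd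
    have : p * r ∣ n ↔ p ∣ n ∧ r ∣ n :=
      ⟨fun h => ⟨dvd_of_mul_right_dvd h, dvd_of_mul_left_dvd h⟩, fun h => hpr.mul_dvd_of_dvd_of_dvd h.1 h.2⟩
    by_cases h1 : p ∣ n <;> by_cases h2 : r ∣ n <;> simp [this, h1, h2] <;> ring
  simp_rw [h]
  rw [sum_add_distrib, sum_sub_distrib, sum_sub_distrib, ← sum_mul, ← sum_mul, sum_ite_dvd,
    sum_ite_dvd, sum_ite_dvd, sum_const, Nat.card_Ioc, nsmul_eq_mul, tsub_zero]
  have hp' : (2 : ℝ) ≤ p := by exact_mod_cast hp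
  have hr' : (2 : ℝ) ≤ r := by exact_mod_cast hr
  have key : ∀ d : ℕ, 2 ≤ d → ((N / d : ℕ) : ℝ) ≤ N / d ∧ (N : ℝ) / d - 1 ≤ (N / d : ℕ) := by
    intro d hd
    refine ⟨Nat.cast_div_le, ?_⟩
    have h1 : N < d * (N / d + 1) := Nat.lt_mul_div_succ N (by omega)
    have h2 : (N : ℝ) ≤ d * ((N / d : ℕ) + 1) := by exact_mod_cast h1.le
    rw [sub_le_iff_le_add, div_le_iff₀ (by positivity)]
    linarith
  obtain ⟨a1, a2⟩ := key p hp
  obtain ⟨b1, b2⟩ := key r hr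
  obtain ⟨c1, c2⟩ := key (p * r) (by nlinarith)
  push_cast at c1 c2
  have ip : 0 < 1 / (p : ℝ) := by positivity
  have ir : 0 < 1 / (r : ℝ) := by positivity
  have ip' : 1 / (p : ℝ) ≤ 1 / 2 := by gcongr
  have ir' : 1 / (r : ℝ) ≤ 1 / 2 := by gcongr
  have e1 : (N : ℝ) / p * (1 / r) = N / (p * r) := by field_simp
  have e2 : (N : ℝ) / r * (1 / p) = N / (p * r) := by field_simp
  have e3 : (N : ℝ) * (1 / (p * r)) = N / (p * r) := by field_simp
  have := mul_le_mul_of_nonneg_right a1 ir.le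
  have := mul_le_mul_of_nonneg_right a2 ir.le
  have := mul_le_mul_of_nonneg_right b1 ip.le
  have := mul_le_mul_of_nonneg_right b2 ip.le
  rw [abs_le]
  constructor <;> linarith

/-- The Turán–Kubilius inequality. -/
theorem turan_kubilius (P : Finset ℕ) (hP : ∀ p ∈ P, p.Prime) (c : ℕ → ℝ) (N : ℕ)
    (hN : ∑ p ∈ P, p ≤ N) :
    ∑ n ∈ Ioc 0 N, (∑ p ∈ P, c p * balancedDvd p n) ^ 2 ≤ 2 * N * ∑ p ∈ P, c p ^ 2 / p := by
  have hpos : ∀ p ∈ P, (0 : ℝ) < p := fun p hp => by exact_mod_cast (hP p hp).pos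
  have e : ∑ n ∈ Ioc 0 N, (∑ p ∈ P, c p * balancedDvd p n) ^ 2
      = ∑ p ∈ P, ∑ r ∈ P, c p * c r * ∑ n ∈ Ioc 0 N, balancedDvd p n * balancedDvd r n := by
    simp_rw [sq, sum_mul_sum, mul_sum]
    rw [sum_comm]
    refine sum_congr rfl fun p _ => ?_
    rw [sum_comm]
    exact sum_congr rfl fun r _ => sum_congr rfl fun n _ => by ring
  rw [e]
  have h1 : ∀ p ∈ P, ∀ r ∈ P, c p * c r * ∑ n ∈ Ioc 0 N, balancedDvd p n * balancedDvd r n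
      ≤ (if p = r then c p ^ 2 * (N / p) else 0) + |c p| * |c r| := by
    intro p hp r hr
    split_ifs with h
    · subst h
      have := mul_le_mul_of_nonneg_left (sum_balancedDvd_sq_le (hP p hp).two_le N)
        (mul_self_nonneg (c p))
      nlinarith [mul_nonneg (abs_nonneg (c p)) (abs_nonneg (c p))]
    · rw [zero_add]
      refine (le_abs_self _).trans ?_
      rw [abs_mul, abs_mul]
      exact mul_le_of_le_one_right (by positivity) (abs_sum_balancedDvd_mul_le (hP p hp).two_le
        (hP r hr).two_le ((Nat.coprime_primes (hP p hp) (hP r hr)).2 h) N)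
  refine (sum_le_sum fun p hp => sum_le_sum fun r hr => h1 p hp r hr).trans ?_
  simp_rw [sum_add_distrib]
  have h2 : ∑ p ∈ P, ∑ r ∈ P, (if p = r then c p ^ 2 * ((N : ℝ) / p) else 0)
      = N * ∑ p ∈ P, c p ^ 2 / p := by
    rw [mul_sum]
    refine sum_congr rfl fun p hp => ?_
    rw [sum_ite_eq, if_pos hp]; ring
  have h3 : ∑ p ∈ P, ∑ r ∈ P, |c p| * |c r| ≤ N * ∑ p ∈ P, c p ^ 2 / p := by
    rw [← sum_mul_sum, ← sq]
    have h4 := sq_sum_div_le_sum_sq_div P (fun p => |c p|) hpos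
    have h5 : (0 : ℝ) ≤ ∑ p ∈ P, (p : ℝ) := sum_nonneg fun p hp => (hpos p hp).le
    have h6 : (∑ p ∈ P, (p : ℝ)) ≤ N := by
      rw [← Nat.cast_sum]; exact Nat.cast_le.2 hN
    simp only [sq_abs] at h4
    have h7 : 0 ≤ ∑ p ∈ P, c p ^ 2 / p := sum_nonneg fun p hp => by have := hpos p hp; positivity
    rcases P.eq_empty_or_nonempty with rfl | hne
    · simp
    · have h8 : 0 < ∑ p ∈ P, (p : ℝ) := sum_pos hpos hne
      rw [div_le_iff₀ h8] at h4
      nlinarith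
  rw [h2]; linarith

/-- The dual form of the Turán–Kubilius inequality. -/
theorem turan_kubilius_dual (P : Finset ℕ) (hP : ∀ p ∈ P, p.Prime) (a : ℕ → ℝ)
    (ha : ∀ n, |a n| ≤ 1) (N : ℕ) (hN : ∑ p ∈ P, p ≤ N) :
    ∑ p ∈ P, p * (∑ n ∈ Ioc 0 N, a n * balancedDvd p n) ^ 2 ≤ 2 * N ^ 2 := by
  set b : ℕ → ℝ := fun p => ∑ n ∈ Ioc 0 N, a n * balancedDvd p n with hb
  set B := ∑ p ∈ P, p * b p ^ 2 with hB
  have h1 : B = ∑ n ∈ Ioc 0 N, a n * ∑ p ∈ P, p * b p * balancedDvd p n := by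
    simp_rw [mul_sum]
    rw [sum_comm]
    refine sum_congr rfl fun p _ => ?_
    rw [sq, ← mul_assoc]
    conv_lhs => rw [hb]; simp only []
    rw [mul_sum]
    exact sum_congr rfl fun n _ => by ring
  have h2 := sum_mul_sq_le_sq_mul_sq (Ioc 0 N) a fun n => ∑ p ∈ P, p * b p * balancedDvd p n
  rw [← h1] at h2
  have h3 := turan_kubilius P hP (fun p => p * b p) N hN
  have h4 : ∑ p ∈ P, (p * b p) ^ 2 / p = B := sum_congr rfl fun p hp => by
    have : (p : ℝ) ≠ 0 := by exact_mod_cast (hP p hp).ne_zero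
    field_simp
  rw [h4] at h3
  have h5 : ∑ n ∈ Ioc 0 N, a n ^ 2 ≤ N := by
    refine (sum_le_sum fun n _ => (sq_le_one_iff_abs_le_one _).2 (ha n)).trans ?_
    simp
  have hB0 : 0 ≤ B := sum_nonneg fun p _ => by positivity
  have h6 : B ^ 2 ≤ N * (2 * N * B) :=
    h2.trans (mul_le_mul h5 h3 (sum_nonneg fun _ _ => sq_nonneg _) (Nat.cast_nonneg _))
  rcases hB0.eq_or_lt with h | h
  · rw [← h]; positivity
  · have : B * B ≤ (2 * N ^ 2) * B := by nlinarith
    exact le_of_mul_le_mul_right this h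

theorem sum_abs_balancedDvd_le (P : Finset ℕ) (hP : ∀ p ∈ P, p.Prime) (a : ℕ → ℝ)
    (ha : ∀ n, |a n| ≤ 1) (N : ℕ) (hN : ∑ p ∈ P, p ≤ N) :
    (∑ p ∈ P, |∑ n ∈ Ioc 0 N, a n * balancedDvd p n|) ^ 2 ≤ (∑ p ∈ P, 1 / (p : ℝ)) * (2 * N ^ 2) := by
  have h := sum_mul_sq_le_sq_mul_sq P (fun p : ℕ => √(1 / (p : ℝ)))
    fun p => √p * |∑ n ∈ Ioc 0 N, a n * balancedDvd p n|
  have e1 : ∀ p ∈ P, √(1 / (p : ℝ)) * (√p * |∑ n ∈ Ioc 0 N, a n * balancedDvd p n|)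
      = |∑ n ∈ Ioc 0 N, a n * balancedDvd p n| := fun p hp => by
    have : (0 : ℝ) < p := by exact_mod_cast (hP p hp).pos
    rw [← mul_assoc, ← Real.sqrt_mul (by positivity), one_div, inv_mul_cancel₀ this.ne',
      Real.sqrt_one, one_mul]
  have e2 : ∀ p ∈ P, √(1 / (p : ℝ)) ^ 2 = 1 / p := fun p _ => Real.sq_sqrt (by positivity)
  have e3 : ∀ p ∈ P, (√(p : ℝ) * |∑ n ∈ Ioc 0 N, a n * balancedDvd p n|) ^ 2
      = p * (∑ n ∈ Ioc 0 N, a n * balancedDvd p n) ^ 2 := fun p _ => by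
    rw [mul_pow, Real.sq_sqrt (by positivity), sq_abs]
  rw [sum_congr rfl e1, sum_congr rfl e2, sum_congr rfl e3] at h
  exact h.trans (mul_le_mul_of_nonneg_left (turan_kubilius_dual P hP a ha N hN)
    (sum_nonneg fun _ _ => by positivity))

section

section
variable {q : ℕ} [Fact q.Prime]

theorem sum_zmod (h : ℕ → ℝ) : ∑ x : ZMod q, h x.val = ∑ n ∈ range q, h n := by
  refine sum_nbij' ZMod.val (fun n => (n : ZMod q)) (fun x _ => ?_) (fun _ _ => mem_univ _)
    (fun x _ => ?_) (fun n hn => ?_) fun _ _ => rfl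
  · exact mem_range.2 (ZMod.val_lt x)
  · exact ZMod.natCast_zmod_val x
  · exact ZMod.val_cast_of_lt (mem_range.1 hn)

theorem expect_zmod (h : ℕ → ℝ) : 𝔼 x : ZMod q, h x.val = (∑ n ∈ range q, h n) / q := by
  rw [Fintype.expect_eq_sum_div_card, sum_zmod, ZMod.card]

theorem sum_range_ite_lt {a b : ℕ} (h : a ≤ b) :
    ∑ n ∈ range b, (if n < a then (1 : ℝ) else 0) = a := by
  rw [sum_boole]
  congr 1
  have : {n ∈ range b | n < a} = range a := by ext; simp; omega
  rw [this, card_range]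

/-- The indicator function of `{0, …, W - 1}`. -/
def boxFn (q W : ℕ) (x : ZMod q) : ℝ := if x.val < W then 1 else 0

/-- The tent function of width `W` on `ZMod q`. -/
noncomputable def tent (q W : ℕ) [Fact q.Prime] (x : ZMod q) : ℝ :=
  q / W * 𝔼 j : ZMod q, boxFn q W j * boxFn q W (j + x)

theorem box_nonneg (W : ℕ) (x : ZMod q) : 0 ≤ boxFn q W x := by unfold boxFn; split_ifs <;> simp

theorem box_le_one (W : ℕ) (x : ZMod q) : boxFn q W x ≤ 1 := by unfold boxFn; split_ifs <;> simp

theorem abs_box_le (W : ℕ) (x : ZMod q) : |boxFn q W x| ≤ 1 := by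
  rw [abs_of_nonneg (box_nonneg W x)]; exact box_le_one W x

theorem expect_box {W : ℕ} (hW : W ≤ q) : 𝔼 x, boxFn q W x = W / q := by
  unfold boxFn
  rw [expect_zmod fun n => if n < W then (1 : ℝ) else 0, sum_range_ite_lt hW]

theorem tent_nonneg (W : ℕ) (x : ZMod q) : 0 ≤ tent q W x :=
  mul_nonneg (by positivity) (expect_nonneg fun j _ => mul_nonneg (box_nonneg _ _) (box_nonneg _ _))

theorem tent_le_one {W : ℕ} (h : W ≤ q) (x : ZMod q) : tent q W x ≤ 1 := by
  rcases W.eq_zero_or_pos with rfl | hW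
  · simp [tent]
  have hq : (0 : ℝ) < q := by exact_mod_cast (Fact.out : q.Prime).pos
  have hW' : (0 : ℝ) < W := by exact_mod_cast hW
  have h1 : 𝔼 j, boxFn q W j * boxFn q W (j + x) ≤ W / q := by
    rw [← expect_box h]
    exact expect_le_expect fun j _ => mul_le_of_le_one_right (box_nonneg _ _) (box_le_one _ _)
  calc tent q W x ≤ q / W * (W / q) := mul_le_mul_of_nonneg_left h1 (by positivity)
    _ = 1 := by field_simp

theorem abs_tent_le {W : ℕ} (h : W ≤ q) (x : ZMod q) : |tent q W x| ≤ 1 := by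
  rw [abs_of_nonneg (tent_nonneg W x)]; exact tent_le_one h x

theorem expect_tent {W : ℕ} (h : W ≤ q) : 𝔼 x, tent q W x = W / q := by
  rcases W.eq_zero_or_pos with rfl | hW
  · simp [tent]
  have hq : (0 : ℝ) < q := by exact_mod_cast (Fact.out : q.Prime).pos
  have hW' : (0 : ℝ) < W := by exact_mod_cast hW
  unfold tent
  rw [← mul_expect, expect_comm]
  simp_rw [← mul_expect, expect_add_left_eq (boxFn q W)]
  rw [← expect_mul, expect_box h]
  field_simp

theorem tent_natCast {W u : ℕ} (h : u + W ≤ q) : tent q W (u : ZMod q) = (W - u : ℕ) / W := by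
  have hq : (0 : ℝ) < q := by exact_mod_cast (Fact.out : q.Prime).pos
  have e : ∀ j : ZMod q, boxFn q W j * boxFn q W (j + u) = if j.val < W - u then (1 : ℝ) else 0 := by
    intro j
    unfold boxFn
    by_cases h1 : j.val < W
    · have h2 : (j + (u : ZMod q)).val = j.val + u := by
        rw [ZMod.val_add, ZMod.val_natCast, Nat.add_mod_mod, Nat.mod_eq_of_lt (by omega)]
      rw [h2, if_pos h1, one_mul]
      exact if_congr (by omega) rfl rfl
    · rw [if_neg h1, zero_mul, if_neg (by omega)]
  unfold tent
  simp_rw [e]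
  rw [expect_zmod fun n => if n < W - u then (1 : ℝ) else 0, sum_range_ite_lt (by omega)]
  field_simp

/-- The truncation of `f` to `{1, …, N}`, smoothed by a tent and viewed on `ZMod q`. -/
noncomputable def localFn (q N : ℕ) [Fact q.Prime] (f : ℕ → ℝ) (x : ZMod q) : ℝ :=
  if x.val ∈ Ioc 0 N then f x.val * tent q N x else 0

theorem abs_localFn_le {N : ℕ} (hN : N ≤ q) {f : ℕ → ℝ} (hf : ∀ n, |f n| ≤ 1) (x : ZMod q) :
    |localFn q N f x| ≤ 1 := by
  unfold localFn
  split_ifs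
  · rw [abs_mul]; exact mul_le_one₀ (hf _) (abs_nonneg _) (abs_tent_le hN x)
  · simp

theorem expect_localFn_mul {N : ℕ} (hN : N < q) (f : ℕ → ℝ) (D : ZMod q → ℝ) :
    𝔼 x, localFn q N f x * D x
      = (∑ n ∈ Ioc 0 N, f n * (tent q N (n : ZMod q) * D (n : ZMod q))) / q := by
  have e : ∀ x : ZMod q, localFn q N f x * D x
      = (fun n : ℕ => if n ∈ Ioc 0 N then f n * (tent q N (n : ZMod q) * D (n : ZMod q)) else 0)
        x.val := by
    intro x
    simp only [localFn, ZMod.natCast_zmod_val]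
    split_ifs <;> ring
  rw [expect_congr rfl fun x _ => e x]
  refine (expect_zmod (q := q) fun n => if n ∈ Ioc 0 N then
    f n * (tent q N (n : ZMod q) * D (n : ZMod q)) else 0).trans ?_
  rw [← sum_filter]
  congr 2
  ext n; simp only [mem_filter, mem_range, mem_Ioc]; omega

end

end

section

theorem exists_sum_prime_inv_ge (C : ℝ) :
    ∃ J₀ : ℕ, ∀ J ≥ J₀, C ≤ ∑ p ∈ (range (2 ^ J)).filter Nat.Prime, 1 / (p : ℝ) := by
  have h := not_summable_iff_tendsto_nat_atTop_of_nonneg (f := Set.indicator {p | Nat.Prime p}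
    fun n : ℕ => 1 / (n : ℝ)) (fun n => Set.indicator_nonneg (fun _ _ => by positivity) _)
  have h2 := h.1 not_summable_one_div_on_primes
  have h3 := h2.comp (tendsto_pow_atTop_atTop_of_one_lt one_lt_two)
  obtain ⟨J, hJ⟩ := (h3.eventually_ge_atTop C).exists_forall_of_atTop
  refine ⟨J, fun j hj => (hJ j hj).trans_eq ?_⟩
  rw [Function.comp_apply, sum_filter]
  exact sum_congr rfl fun n _ => by simp [Set.indicator_apply]

section
variable {q : ℕ} [Fact q.Prime]

/-- The weighted correlation of two dilates of a kernel in its first variable. -/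
noncomputable def dilateGram (q N W : ℕ) [Fact q.Prime] (K : ZMod q × ZMod q → ℝ) (p p' : ℕ) : ℝ :=
  𝔼 z : ZMod q × ZMod q, tent q W z.1 * (tent q N (p * z.1) * tent q N (p' * z.1)) *
    (K (p * z.1, z.2) * K (p' * z.1, z.2))

theorem dilateGram_comm (N W : ℕ) (K : ZMod q × ZMod q → ℝ) (p p' : ℕ) :
    dilateGram q N W K p p' = dilateGram q N W K p' p :=
  expect_congr rfl fun z _ => by ring

theorem abs_dilateGram_le {N W : ℕ} (hN : N ≤ q) (hW : W ≤ q) {K : ZMod q × ZMod q → ℝ}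
    (hK : ∀ z, |K z| ≤ 1) (p p' : ℕ) : |dilateGram q N W K p p'| ≤ W / q := by
  rw [← expect_tent hW]
  refine (abs_expect_le _ _).trans ?_
  rw [expect_prod_type]
  refine expect_le_expect fun x _ => expect_le univ_nonempty fun y _ => ?_
  rw [mul_assoc, abs_mul, abs_of_nonneg (tent_nonneg W x)]
  refine mul_le_of_le_one_right (tent_nonneg W x) ?_
  rw [abs_mul, abs_mul, abs_mul]
  exact mul_le_one₀ (mul_le_one₀ (abs_tent_le hN _) (abs_nonneg _) (abs_tent_le hN _))
    (by positivity) (mul_le_one₀ (hK _) (abs_nonneg _) (hK _))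

theorem sum_dvd_eq {N j p : ℕ} (hq : 10 * N ≤ q) {f : ℕ → ℝ}
    (hmult : ∀ m n : ℕ, f (m * n) = f m * f n) (D : ZMod q → ℝ) (hp : 2 ^ j ≤ p)
    (hp' : p < 2 ^ (j + 1)) :
    ∑ n ∈ Ioc 0 N, (if p ∣ n then f n * (tent q N (n : ZMod q) * D (n : ZMod q)) else 0)
      = ∑ u ∈ Ioc 0 (N / 2 ^ j), f u * (f p * (tent q N (p * u : ZMod q) * D (p * u))) := by
  have hp0 : 0 < p := lt_of_lt_of_le (by positivity) hp
  have hle : N / p ≤ N / 2 ^ j := Nat.div_le_div_left hp (by positivity)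
  have h1 : ∑ n ∈ Ioc 0 N, (if p ∣ n then f n * (tent q N (n : ZMod q) * D (n : ZMod q)) else 0)
      = ∑ u ∈ Ioc 0 (N / p), f u * (f p * (tent q N (p * u : ZMod q) * D (p * u))) := by
    rw [← sum_filter]
    refine (sum_nbij' (fun u => p * u) (fun n => n / p) (fun u hu => ?_) (fun n hn => ?_)
      (fun u _ => ?_) (fun n hn => ?_) fun u _ => ?_).symm
    · simp only [mem_filter, mem_Ioc] at hu ⊢
      exact ⟨⟨Nat.mul_pos hp0 hu.1, (Nat.mul_le_mul_left p hu.2).trans (Nat.mul_div_le N p)⟩,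
        dvd_mul_right _ _⟩
    · simp only [mem_filter, mem_Ioc] at hn ⊢
      exact ⟨Nat.div_pos (Nat.le_of_dvd hn.1.1 hn.2) hp0, Nat.div_le_div_right hn.1.2⟩
    · exact Nat.mul_div_cancel_left u hp0
    · exact Nat.mul_div_cancel' (mem_filter.1 hn).2
    · rw [hmult]; push_cast; ring
  rw [h1]
  refine sum_subset (Ioc_subset_Ioc_right hle) fun u hu hu' => ?_
  simp only [mem_Ioc, not_and, not_le] at hu hu'
  have h2 : N < p * u := (Nat.div_lt_iff_lt_mul hp0).1 (hu' hu.1) |>.trans_eq (mul_comm _ _)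
  have h3 : p * u ≤ 2 * N := by
    calc p * u ≤ 2 ^ (j + 1) * (N / 2 ^ j) := Nat.mul_le_mul hp'.le hu.2
      _ = 2 * (2 ^ j * (N / 2 ^ j)) := by ring
      _ ≤ 2 * N := Nat.mul_le_mul_left 2 (Nat.mul_div_le _ _)
  have h4 : tent q N (p * u : ZMod q) = 0 := by
    rw [← Nat.cast_mul, tent_natCast (by omega), Nat.sub_eq_zero_of_le h2.le]; simp
  rw [h4]; ring

theorem block_bound {N j : ℕ} (hN : 2 ^ j ≤ N) (hq : 10 * N ≤ q) (hq' : q ≤ 20 * N) {f : ℕ → ℝ}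
    (hmult : ∀ m n : ℕ, f (m * n) = f m * f n) (hbound : ∀ n, |f n| ≤ 1)
    {φ : ZMod q → ℝ} (hφ : ∀ x, |φ x| ≤ 1) {K : ZMod q × ZMod q → ℝ} (hK : ∀ z, |K z| ≤ 1)
    {ε : ℝ} (hε : 0 ≤ ε) (P : Finset ℕ) (hP : ∀ p ∈ P, 2 ^ j ≤ p ∧ p < 2 ^ (j + 1))
    (hG : ∀ p ∈ P, ∀ p' ∈ P, p < p' → |dilateGram q N (2 * (N / 2 ^ j) + 2) K p p'| ≤ ε) :
    (∑ p ∈ P, ∑ n ∈ Ioc 0 N, if p ∣ n then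
      f n * (tent q N (n : ZMod q) * 𝔼 y, φ y * K ((n : ZMod q), y)) else 0) ^ 2
      ≤ N ^ 2 * (8 / 2 ^ j + 40 * 2 ^ j * ε) := by
  set U := N / 2 ^ j with hU
  set W := 2 * U + 2 with hW
  have hUN : U ≤ N := Nat.div_le_self _ _
  have hN1 : 1 ≤ N := Nat.one_le_two_pow.trans hN
  have hq0 : (0 : ℝ) < q := by exact_mod_cast (Fact.out : q.Prime).pos
  have hU' : (U : ℝ) ≤ N / 2 ^ j := by
    have := @Nat.cast_div_le ℝ _ _ _ N (2 ^ j); push_cast at this; exact this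
  have hone : (1 : ℝ) ≤ N / 2 ^ j := by
    rw [le_div_iff₀ (by positivity), one_mul]; exact_mod_cast hN
  have hW' : (W : ℝ) ≤ 4 * (N / 2 ^ j) := by rw [hW]; push_cast; linarith
  have hWq : W ≤ q := by omega
  have hcard : (#P : ℝ) ≤ 2 ^ j := by
    have h1 : P ⊆ Ico (2 ^ j) (2 ^ (j + 1)) := fun p hp => mem_Ico.2 (hP p hp)
    have h2 := card_le_card h1
    rw [Nat.card_Ico, pow_succ] at h2
    exact_mod_cast h2.trans (by omega)
  set G : ZMod q → ZMod q → ℝ := fun u y => ∑ p ∈ P, f p * (tent q N (p * u) * K (p * u, y)) with hGd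
  have e1 : (∑ p ∈ P, ∑ n ∈ Ioc 0 N, if p ∣ n then
      f n * (tent q N (n : ZMod q) * 𝔼 y, φ y * K ((n : ZMod q), y)) else 0)
      = ∑ u ∈ Ioc 0 U, f u * 𝔼 y, φ y * G u y := by
    rw [sum_congr rfl fun p hp => sum_dvd_eq hq hmult (fun x => 𝔼 y, φ y * K (x, y))
      (hP p hp).1 (hP p hp).2, sum_comm]
    refine sum_congr rfl fun u _ => ?_
    rw [← mul_sum]
    congr 1
    simp only [hGd, mul_sum, mul_expect]
    rw [expect_sum_comm]
    exact sum_congr rfl fun p _ => expect_congr rfl fun y _ => by ring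
  have e2 : (∑ u ∈ Ioc 0 U, f u * 𝔼 y, φ y * G u y) ^ 2
      ≤ U * ∑ u ∈ Ioc 0 U, 𝔼 y, G u y ^ 2 := by
    refine (sum_mul_sq_le_sq_mul_sq _ _ _).trans ?_
    have h1 : ∑ u ∈ Ioc 0 U, f u ^ 2 ≤ U := by
      refine (sum_le_sum fun n _ => (sq_le_one_iff_abs_le_one _).2 (hbound n)).trans ?_
      simp
    refine mul_le_mul h1 (sum_le_sum fun u _ => ?_) (sum_nonneg fun _ _ => sq_nonneg _)
      (Nat.cast_nonneg _)
    refine (sq_expect_mul_le _ _).trans ?_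
    refine mul_le_of_le_one_left (expect_nonneg fun _ _ => sq_nonneg _) ?_
    exact expect_le univ_nonempty fun y _ => (sq_le_one_iff_abs_le_one _).2 (hφ y)
  have e3 : ∑ u ∈ Ioc 0 U, 𝔼 y, G u y ^ 2
      ≤ 2 * q * 𝔼 u, tent q W u * 𝔼 y, G u y ^ 2 := by
    have h0 : ∀ x : ZMod q, 0 ≤ tent q W x * 𝔼 y, G x y ^ 2 := fun x =>
      mul_nonneg (tent_nonneg W x) (expect_nonneg fun _ _ => sq_nonneg _)
    have h1 : ∑ n ∈ range q, tent q W (n : ZMod q) * 𝔼 y, G n y ^ 2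
        = q * 𝔼 u, tent q W u * 𝔼 y, G u y ^ 2 := by
      have := expect_zmod (q := q) fun n => tent q W (n : ZMod q) * 𝔼 y, G n y ^ 2
      simp only [ZMod.natCast_zmod_val] at this
      rw [this, mul_div_cancel₀ _ hq0.ne']
    rw [mul_assoc, ← h1, mul_sum]
    refine (sum_le_sum fun u hu => ?_).trans (sum_le_sum_of_subset_of_nonneg (s := Ioc 0 U)
      (fun u hu => ?_) fun n _ _ => by have := h0 n; positivity)
    · have hu := (mem_Ioc.1 hu).2
      have ht : (1 : ℝ) ≤ 2 * tent q W (u : ZMod q) := by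
        rw [tent_natCast (by omega), mul_div_assoc', le_div_iff₀ (by positivity)]
        have : W ≤ 2 * (W - u) := by omega
        rw [one_mul]; exact_mod_cast this
      rw [← mul_assoc]
      exact le_mul_of_one_le_left (expect_nonneg fun _ _ => sq_nonneg _) ht
    · have := (mem_Ioc.1 hu).2
      exact mem_range.2 (by omega)
  have e4 : 𝔼 u, tent q W u * 𝔼 y, G u y ^ 2
      = ∑ p ∈ P, ∑ p' ∈ P, f p * f p' * dilateGram q N W K p p' := by
    have h1 : ∀ u y, G u y ^ 2 = ∑ p ∈ P, ∑ p' ∈ P, f p * f p' *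
        ((tent q N (p * u) * tent q N (p' * u)) * (K (p * u, y) * K (p' * u, y))) := fun u y => by
      rw [sq, hGd, sum_mul_sum]
      exact sum_congr rfl fun p _ => sum_congr rfl fun p' _ => by ring
    simp only [h1, dilateGram, expect_prod_type, mul_expect, mul_sum]
    have h2 : ∀ {α : Type} [Fintype α] (F : α → ℕ → ℕ → ℝ),
        𝔼 u, ∑ p ∈ P, ∑ p' ∈ P, F u p p' = ∑ p ∈ P, ∑ p' ∈ P, 𝔼 u, F u p p' := fun F => by
      rw [expect_sum_comm]
      exact sum_congr rfl fun p _ => expect_sum_comm _ _ _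
    rw [expect_congr rfl fun u _ => h2 _, h2]
    exact sum_congr rfl fun p _ => sum_congr rfl fun p' _ => expect_congr rfl fun u _ =>
      expect_congr rfl fun y _ => by ring
  have e5 : ∑ p ∈ P, ∑ p' ∈ P, f p * f p' * dilateGram q N W K p p'
      ≤ 2 ^ j * (W / q) + 2 ^ j * 2 ^ j * ε := by
    have h1 : ∀ p ∈ P, ∀ p' ∈ P, f p * f p' * dilateGram q N W K p p'
        ≤ (if p = p' then (W / q : ℝ) else 0) + (if p = p' then 0 else ε) := by
      intro p hp p' hp'
      have h2 : f p * f p' * dilateGram q N W K p p' ≤ |dilateGram q N W K p p'| := by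
        refine (le_abs_self _).trans ?_
        rw [abs_mul, abs_mul]
        exact mul_le_of_le_one_left (abs_nonneg _) (mul_le_one₀ (hbound _) (abs_nonneg _) (hbound _))
      refine h2.trans ?_
      rcases lt_trichotomy p p' with h | h | h
      · simpa [h.ne] using hG p hp p' hp' h
      · simpa [h] using abs_dilateGram_le (by omega) hWq hK p p'
      · rw [dilateGram_comm]; simpa [h.ne'] using hG p' hp' p hp h
    have hWq' : (0 : ℝ) ≤ W / q := by positivity
    calc _ ≤ ∑ p ∈ P, ∑ p' ∈ P, ((if p = p' then (W / q : ℝ) else 0) + (if p = p' then 0 else ε)) :=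
          sum_le_sum fun p hp => sum_le_sum fun p' hp' => h1 p hp p' hp'
      _ ≤ ∑ p ∈ P, ((W / q : ℝ) + #P * ε) := by
          refine sum_le_sum fun p hp => ?_
          rw [sum_add_distrib, sum_ite_eq, if_pos hp, ← nsmul_eq_mul, ← sum_const]
          gcongr with p' hp'
          split_ifs <;> simp [hε]
      _ = #P * (W / q : ℝ) + #P * #P * ε := by rw [sum_const, nsmul_eq_mul]; ring
      _ ≤ _ := by gcongr
  have hq2 : (q : ℝ) ≤ 20 * N := by exact_mod_cast hq'
  rw [e1]
  calc _ ≤ (U : ℝ) * (2 * q * (2 ^ j * (W / q) + 2 ^ j * 2 ^ j * ε)) := by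
        refine e2.trans (mul_le_mul_of_nonneg_left (e3.trans ?_) (Nat.cast_nonneg _))
        rw [e4]; gcongr
    _ = (U : ℝ) * (2 * 2 ^ j * W + 2 * q * (2 ^ j * 2 ^ j * ε)) := by field_simp
    _ ≤ (N / 2 ^ j : ℝ) * (2 * 2 ^ j * (4 * (N / 2 ^ j)) + 2 * (20 * N) * (2 ^ j * 2 ^ j * ε)) := by
        gcongr
    _ = _ := by field_simp; ring

theorem katai_bound {f : ℕ → ℝ} (hmult : ∀ m n : ℕ, f (m * n) = f m * f n)
    (hbound : ∀ n, |f n| ≤ 1) {δ : ℝ} (hδ : 0 < δ) :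
    ∃ J N₀ : ℕ, ∃ ε : ℝ, 0 < ε ∧ ∀ N ≥ N₀, ∀ (q : ℕ) [Fact q.Prime], 10 * N ≤ q → q ≤ 20 * N →
      ∀ K : ZMod q × ZMod q → ℝ, (∀ z, |K z| ≤ 1) →
      (∀ j < J, ∀ p p' : ℕ, p.Prime → p'.Prime → 2 ^ j ≤ p → p < p' → p' < 2 ^ (j + 1) →
        |dilateGram q N (2 * (N / 2 ^ j) + 2) K p p'| ≤ ε) →
      |𝔼 z : ZMod q × ZMod q, localFn q N f z.1 * localFn q N f z.2 * K z| ≤ δ := by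
  obtain ⟨J, hJ⟩ := exists_sum_prime_inv_ge (max (12 / δ) (2 / δ ^ 2))
  replace hJ := hJ J le_rfl
  set P := (range (2 ^ J)).filter Nat.Prime with hP
  set S := ∑ p ∈ P, 1 / (p : ℝ) with hS
  have hS1 : 12 / δ ≤ S := (le_max_left _ _).trans hJ
  have hS2 : 2 / δ ^ 2 ≤ S := (le_max_right _ _).trans hJ
  have hS0 : 0 < S := lt_of_lt_of_le (by positivity) hS1
  refine ⟨J, max (∑ p ∈ P, p) (2 ^ J), 1 / (40 * 4 ^ J), by positivity, ?_⟩
  intro N hN q _ hq hq' K hK hG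
  have hN1 : ∑ p ∈ P, p ≤ N := (le_max_left _ _).trans hN
  have hN2 : 2 ^ J ≤ N := (le_max_right _ _).trans hN
  have hN0 : 1 ≤ N := Nat.one_le_two_pow.trans hN2
  have hN0' : (0 : ℝ) < N := by exact_mod_cast hN0
  have hq0 : (0 : ℝ) < q := by exact_mod_cast (Fact.out : q.Prime).pos
  set φ := localFn q N f with hφd
  have hφ : ∀ x, |φ x| ≤ 1 := fun x => abs_localFn_le (by omega) hbound x
  set a : ℕ → ℝ := fun n => f n * (tent q N (n : ZMod q) * 𝔼 y, φ y * K ((n : ZMod q), y)) with ha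
  have ha1 : ∀ n, |a n| ≤ 1 := fun n => by
    rw [ha, abs_mul, abs_mul]
    refine mul_le_one₀ (hbound n) (by positivity) (mul_le_one₀ (abs_tent_le (by omega) _)
      (abs_nonneg _) (abs_expect_le_one (fun y => φ y * K ((n : ZMod q), y)) fun y => ?_))
    rw [abs_mul]
    exact mul_le_one₀ (hφ _) (abs_nonneg _) (hK _)
  have hE : 𝔼 z : ZMod q × ZMod q, φ z.1 * φ z.2 * K z = (∑ n ∈ Ioc 0 N, a n) / q := by
    rw [expect_prod_type, ← expect_localFn_mul (by omega) f fun x => 𝔼 y, φ y * K (x, y)]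
    refine expect_congr rfl fun x _ => ?_
    rw [mul_expect]
    exact expect_congr rfl fun y _ => by ring
  have hb := sum_abs_balancedDvd_le P (fun p hp => (mem_filter.1 hp).2) a ha1 N hN1
  set B := ∑ p ∈ P, |∑ n ∈ Ioc 0 N, a n * balancedDvd p n| with hB
  have hB0 : 0 ≤ B := sum_nonneg fun _ _ => abs_nonneg _
  have hblock : |∑ p ∈ P, ∑ n ∈ Ioc 0 N, if p ∣ n then a n else 0| ≤ 12 * N := by
    have hmaps : ∀ p ∈ P, Nat.log 2 p ∈ range J := fun p hp => by
      have := mem_filter.1 hp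
      exact mem_range.2 (Nat.log_lt_of_lt_pow this.2.ne_zero (mem_range.1 this.1))
    rw [← sum_fiberwise_of_maps_to hmaps]
    refine (abs_sum_le_sum_abs _ _).trans ?_
    have h1 : ∀ j ∈ range J, |∑ p ∈ P with Nat.log 2 p = j, ∑ n ∈ Ioc 0 N, if p ∣ n then a n else 0|
        ≤ 3 * N * (3 / 4) ^ j := fun j hj => by
      have hj' := mem_range.1 hj
      have hpw : ∀ p ∈ {p ∈ P | Nat.log 2 p = j}, 2 ^ j ≤ p ∧ p < 2 ^ (j + 1) := fun p hp => by
        obtain ⟨hp1, hp2⟩ := mem_filter.1 hp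
        have hp3 := (mem_filter.1 hp1).2
        rw [← hp2]
        exact ⟨Nat.pow_log_le_self 2 hp3.ne_zero, Nat.lt_pow_succ_log_self one_lt_two p⟩
      have h2 := block_bound (q := q) ((Nat.pow_le_pow_right two_pos hj'.le).trans hN2) hq hq' hmult
        hbound hφ hK (ε := 1 / (40 * 4 ^ J)) (by positivity) {p ∈ P | Nat.log 2 p = j} hpw
        fun p hp p' hp' hlt => hG j hj' p p' (mem_filter.1 (mem_filter.1 hp).1).2
          (mem_filter.1 (mem_filter.1 hp').1).2 (hpw p hp).1 hlt (hpw p' hp').2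
      refine abs_le_of_sq_le_sq (h2.trans ?_) (by positivity)
      have h3 : (40 : ℝ) * 2 ^ j * (1 / (40 * 4 ^ J)) ≤ 1 / 2 ^ j := by
        have h4 : (2 : ℝ) ^ j * 2 ^ j ≤ 4 ^ J := by
          rw [← mul_pow]; norm_num
          exact pow_le_pow_right₀ (by norm_num) hj'.le
        rw [mul_one_div, div_le_div_iff₀ (by positivity) (by positivity)]
        nlinarith
      have h5 : (1 : ℝ) / 2 ^ j ≤ (9 / 16) ^ j := by
        rw [one_div, ← inv_pow]; gcongr; norm_num
      have h6 : ((3 : ℝ) / 4) ^ j * (3 / 4) ^ j = (9 / 16) ^ j := by rw [← mul_pow]; norm_num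
      calc (N : ℝ) ^ 2 * (8 / 2 ^ j + 40 * 2 ^ j * (1 / (40 * 4 ^ J)))
          ≤ (N : ℝ) ^ 2 * (8 * (1 / 2 ^ j) + 1 / 2 ^ j) := by
            gcongr; exact (mul_one_div _ _).ge
        _ ≤ (N : ℝ) ^ 2 * (8 * (9 / 16) ^ j + (9 / 16) ^ j) := by gcongr
        _ = _ := by rw [← h6]; ring
    refine (sum_le_sum h1).trans ?_
    rw [← mul_sum]
    have h7 : ∑ j ∈ range J, ((3 : ℝ) / 4) ^ j ≤ 4 := by
      have := geom_sum_eq (show (3 / 4 : ℝ) ≠ 1 by norm_num) J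
      rw [this]
      have : (0 : ℝ) ≤ (3 / 4) ^ J := by positivity
      rw [div_le_iff_of_neg (by norm_num)]; linarith
    nlinarith
  have hsum : S * ∑ n ∈ Ioc 0 N, a n = (∑ p ∈ P, ∑ n ∈ Ioc 0 N, if p ∣ n then a n else 0)
      - ∑ p ∈ P, ∑ n ∈ Ioc 0 N, a n * balancedDvd p n := by
    rw [hS, sum_mul, ← sum_sub_distrib]
    refine sum_congr rfl fun p _ => ?_
    rw [mul_sum, ← sum_sub_distrib]
    refine sum_congr rfl fun n _ => ?_
    unfold balancedDvd
    split_ifs <;> ring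
  have hmain : S * |∑ n ∈ Ioc 0 N, a n| ≤ 12 * N + B := by
    have h9 : S * |∑ n ∈ Ioc 0 N, a n| = |S * ∑ n ∈ Ioc 0 N, a n| := by
      rw [abs_mul, abs_of_pos hS0]
    rw [h9, hsum]
    refine (abs_sub _ _).trans (add_le_add hblock (abs_sum_le_sum_abs _ _))
  have hB' : B ≤ S * δ * N := by
    refine abs_le_of_sq_le_sq' (hb.trans ?_) (by positivity) |>.2
    have : 2 ≤ S * δ ^ 2 := by rwa [div_le_iff₀ (by positivity)] at hS2
    have h8 : (S * δ * N) ^ 2 = S * (S * δ ^ 2 * N ^ 2) := by ring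
    rw [h8]; gcongr
  have h12 : 12 ≤ S * δ := by rwa [div_le_iff₀ hδ] at hS1
  have hA : |∑ n ∈ Ioc 0 N, a n| ≤ 2 * δ * N := by
    refine le_of_mul_le_mul_left ?_ hS0
    nlinarith
  rw [hE, abs_div, abs_of_pos hq0, div_le_iff₀ hq0]
  have : (10 * N : ℝ) ≤ q := by exact_mod_cast hq
  nlinarith

end

end

section

section
variable {q : ℕ} [Fact q.Prime]

theorem structured_tent {ι V : Type} [Fintype ι] [DecidableEq ι] [AddCommGroup V]
    [Module (ZMod q) V] (M : ι → V) {i₀ i₁ : ι} (hi : i₀ ≠ i₁) (W : ℕ) (A : V →ₗ[ZMod q] ZMod q) :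
    Structured (ZMod q) M (q / W) (fun X => tent q W (A X)) := by
  have h0 : Structured (ZMod q) (fun i => (M i, if i = i₁ then -A (M i) else 0)) 1
      (fun X : V × ZMod q => boxFn q W X.2) :=
    .of_invariant i₀ (fun X => abs_box_le _ _) fun s X => by simp [hi]
  have h1 : Structured (ZMod q) (fun i => (M i, if i = i₁ then -A (M i) else 0)) 1
      (fun X : V × ZMod q => boxFn q W (X.2 + A X.1)) :=
    .of_invariant i₁ (fun X => abs_box_le _ _) fun s X => by
      congr 1; simp; ring
  refine ((((h0.mul h1).expect).smul (q / W : ℝ)).congr fun X => rfl).mono (le_of_eq ?_)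
  rw [abs_of_nonneg (by positivity), one_mul, mul_one]

theorem structured_zero {F ι V : Type} [Field F] [Fintype ι] [DecidableEq ι] [AddCommGroup V]
    [Module F V] (M : ι → V) (i : ι) : Structured F M 0 (fun _ => 0) :=
  (((Structured.of_invariant (M := M) (Ψ := fun _ => 1) i (by simp) (by simp)).smul 0).congr
    (fun X => by simp)).mono (by simp)

theorem l2norm_comp_dilate {p : ZMod q} (hp : p ≠ 0) (D : ZMod q × ZMod q → ℝ) :
    l2norm (fun z : ZMod q × ZMod q => D (p * z.1, z.2)) = l2norm D := by
  unfold l2norm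
  congr 1
  exact Fintype.expect_equiv ((Equiv.mulLeft₀ p hp).prodCongr (Equiv.refl _)) _ _ fun _ => rfl

theorem natCast_zmod_ne_zero {r : ℕ} (h1 : 1 ≤ r) (h2 : r < q) : (r : ZMod q) ≠ 0 := fun h =>
  absurd (Nat.le_of_dvd h1 ((ZMod.natCast_eq_zero_iff r q).1 h)) (by omega)

theorem abs_dilateGram_le_of_approx {N W p p' : ℕ} (hN : N ≤ q) (hW : W ≤ q)
    (hp0 : (p : ZMod q) ≠ 0) {K Ψ : ZMod q × ZMod q → ℝ} (hK : ∀ z, |K z| ≤ 1) {ε : ℝ}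
    (h : l2norm (K - Ψ) ≤ ε) :
    |dilateGram q N W K p p'| ≤ ε + |𝔼 z : ZMod q × ZMod q,
      tent q W z.1 * (tent q N (p * z.1) * tent q N (p' * z.1)) *
        Ψ (p * z.1, z.2) * K (p' * z.1, z.2)| := by
  set w : ZMod q × ZMod q → ℝ := fun z =>
    tent q W z.1 * (tent q N (p * z.1) * tent q N (p' * z.1)) with hw
  have hw1 : ∀ z, |w z| ≤ 1 := fun z => by
    rw [hw, abs_mul, abs_mul]
    exact mul_le_one₀ (abs_tent_le hW _) (by positivity)
      (mul_le_one₀ (abs_tent_le hN _) (abs_nonneg _) (abs_tent_le hN _))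
  have hsplit : dilateGram q N W K p p' = 𝔼 z : ZMod q × ZMod q, (w z * K (p' * z.1, z.2)) *
      (K - Ψ) (p * z.1, z.2) + 𝔼 z : ZMod q × ZMod q, w z * Ψ (p * z.1, z.2) * K (p' * z.1, z.2) := by
    rw [← expect_add_distrib]
    refine expect_congr rfl fun z _ => ?_
    rw [Pi.sub_apply]
    simp only [hw]
    ring
  have h1 : |𝔼 z : ZMod q × ZMod q, (w z * K (p' * z.1, z.2)) * (K - Ψ) (p * z.1, z.2)| ≤ ε := by
    refine (abs_expect_mul_le_l2norm (fun z : ZMod q × ZMod q => w z * K (p' * z.1, z.2))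
      fun z => (K - Ψ) (p * z.1, z.2)).trans ?_
    rw [l2norm_comp_dilate hp0 (K - Ψ)]
    refine (mul_le_of_le_one_left (l2norm_nonneg _) (l2norm_le_one fun z => ?_)).trans h
    rw [abs_mul]; exact mul_le_one₀ (hw1 z) (abs_nonneg _) (hK _)
  rw [hsplit]
  exact (abs_add_le _ _).trans (add_le_add h1 le_rfl)

/-- The vertex of the cube supported on the coordinate `0`. -/
def zeroVertex (n : ℕ) : Fin (n + 2) → Bool := fun i => decide (i = 0)

theorem vertexSum_zeroVertex {n : ℕ} (t : Fin (n + 2) → ZMod q) :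
    vertexSum (zeroVertex n) t = t 0 := by
  rw [vertexSum_apply, Fin.sum_univ_succ]
  simp [zeroVertex, Fin.succ_ne_zero]

theorem vertexSum_smul_single {n : ℕ} (ω : Fin (n + 2) → Bool) (i : Fin (n + 2)) (a : ZMod q) :
    vertexSum ω (Pi.single i a) = if ω i then a else 0 := by
  rw [vertexSum_apply]
  simp only [Pi.single_apply]
  rw [sum_eq_single i] <;> simp +contextual

theorem exists_ne_zero_of_mem {n : ℕ} {ω : Fin (n + 2) → Bool} (h0 : ω ≠ fun _ => false)
    (h1 : ω ≠ zeroVertex n) : ∃ i, i ≠ 0 ∧ ω i = true := by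
  by_contra! h
  have h' : ∀ i, i ≠ 0 → ω i = false := fun i hi => by simpa using h i hi
  cases h2 : ω 0
  · exact h0 (funext fun i => if hi : i = 0 then hi ▸ h2 else h' i hi)
  · exact h1 (funext fun i => if hi : i = 0 then by subst hi; simp [h2, zeroVertex] else by
      simp [h' i hi, zeroVertex, hi])

theorem abs_expect_mul_cubeKernel_le {n p p' : ℕ} (hpp : p < p') (hq : p' ^ (n + 2) < q)
    (hp0' : (p' : ZMod q) ≠ 0) {f : ZMod q → ℝ} (hf : ∀ x, |f x| ≤ 1) {ε : ℝ} (hε : 0 ≤ ε)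
    (hU : gowersU (n + 2) f ≤ ε ^ 2 ^ (n + 2)) {M : Fin (n + 2) → ZMod q × ZMod q}
    (hM : M = fun i => if i = 0 then ((p' : ZMod q) ^ (n + 1), (p : ZMod q) ^ (n + 2))
      else (1, (p' : ZMod q))) {C : ℝ} {Φ : ZMod q × ZMod q → ℝ}
    (hΦ : Structured (ZMod q) M C Φ) :
    |𝔼 z : ZMod q × ZMod q, Φ z * cubeKernel (n + 2) f (p' * z.1, z.2)| ≤ C * ε := by
  set M₂ : Fin (n + 2) → (ZMod q × ZMod q) × (Fin (n + 2) → ZMod q) := fun i =>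
    (M i, Pi.single i (-((p' : ZMod q) * (M i).1))) with hM₂
  set E : Finset (Fin (n + 2) → Bool) := (univ.erase fun _ => false).erase (zeroVertex n) with hE
  have hzero : zeroVertex n ∈ (univ.erase fun _ => false) := by
    simp only [mem_erase, mem_univ, and_true]
    intro h; simpa [zeroVertex] using congrFun h 0
  have hvx : ∀ (i : Fin (n + 2)) (ω : Fin (n + 2) → Bool), ω i = true → ∀ (s : ZMod q) (X : (ZMod q × ZMod q) × (Fin (n + 2) → ZMod q)),
      (p' : ZMod q) * (X + s • M₂ i).1.1 + vertexSum ω (X + s • M₂ i).2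
        = p' * X.1.1 + vertexSum ω X.2 := fun i ω hi s X => by
    simp only [hM₂, Prod.fst_add, Prod.snd_add, Prod.smul_fst, Prod.smul_snd, map_add, map_smul,
      vertexSum_smul_single, hi, if_true, smul_eq_mul]
    ring
  have hvy : ∀ (i : Fin (n + 2)) (ω : Fin (n + 2) → Bool), i ≠ 0 → ω i = true →
      ∀ (s : ZMod q) (X : (ZMod q × ZMod q) × (Fin (n + 2) → ZMod q)), (X + s • M₂ i).1.2 + vertexSum ω (X + s • M₂ i).2
        = X.1.2 + vertexSum ω X.2 := fun i ω h0 hi s X => by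
    simp only [hM₂, Prod.fst_add, Prod.snd_add, Prod.smul_fst, Prod.smul_snd, map_add, map_smul,
      vertexSum_smul_single, hi, if_true, smul_eq_mul, hM, h0, if_false]
    ring
  have hx : Structured (ZMod q) M₂ 1 (fun X : (ZMod q × ZMod q) × (Fin (n + 2) → ZMod q) => ∏ ω ∈ univ.erase fun _ => false,
      f (p' * X.1.1 + vertexSum ω X.2)) := by
    refine Structured.prod _ _ (fun ω hω => ?_) inferInstance
    obtain ⟨i, hi⟩ : ∃ i, ω i = true := by
      by_contra! h
      exact (mem_erase.1 hω).1 (funext fun i => by simpa using h i)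
    exact .of_invariant i (fun X => hf _) fun s X => by rw [hvx i ω hi]
  have hy : Structured (ZMod q) M₂ 1 (fun X : (ZMod q × ZMod q) × (Fin (n + 2) → ZMod q) => ∏ ω ∈ E, f (X.1.2 + vertexSum ω X.2)) := by
    refine Structured.prod _ _ (fun ω hω => ?_) inferInstance
    obtain ⟨i, hi0, hi⟩ := exists_ne_zero_of_mem (mem_erase.1 (mem_erase.1 hω).2).1
      (mem_erase.1 hω).1
    exact .of_invariant i (fun X => hf _) fun s X => by rw [hvy i ω hi0 hi]
  have hfst : ∀ {C Φ}, Structured (ZMod q) M C Φ → Structured (ZMod q) M₂ C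
      (fun X : (ZMod q × ZMod q) × (Fin (n + 2) → ZMod q) => Φ X.1) := fun h => h.comp (LinearMap.fst _ _ _) M₂ (fun _ => 1) fun i => by
    simp [hM₂]
  have hall := ((hfst hΦ).mul (hx.mul hy)).abs_expect_mul_le (k := n + 1)
    ((LinearMap.snd (ZMod q) (ZMod q) (ZMod q)).comp (LinearMap.fst (ZMod q) _ _) +
      (LinearMap.proj 0).comp (LinearMap.snd (ZMod q) _ (Fin (n + 2) → ZMod q)))
    (fun i => ?_) f hε hU
  · rw [one_mul, mul_one] at hall
    refine le_trans (le_of_eq (congrArg abs ?_)) hall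
    refine Eq.trans ?_ (expect_prod_type _).symm
    refine expect_congr rfl fun z _ => ?_
    rw [cubeKernel, mul_expect]
    refine expect_congr rfl fun t _ => ?_
    simp only [punctured]
    rw [← mul_prod_erase _ (fun ω => f (z.2 + vertexSum ω t)) hzero, vertexSum_zeroVertex]
    simp
    ring
  · by_cases hi : i = 0
    · subst hi
      simp only [hM₂, hM, LinearMap.add_apply, LinearMap.comp_apply, LinearMap.fst_apply,
        LinearMap.snd_apply, LinearMap.proj_apply, if_true, Pi.single_eq_same]
      rw [← pow_succ', ← sub_eq_add_neg, sub_ne_zero]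
      have hlt : p ^ (n + 2) < p' ^ (n + 2) := Nat.pow_lt_pow_left hpp (by omega)
      intro h
      have h2 : ((p ^ (n + 2) : ℕ) : ZMod q) = ((p' ^ (n + 2) : ℕ) : ZMod q) := by
        push_cast; exact h
      have h3 := congrArg ZMod.val h2
      rw [ZMod.val_cast_of_lt (by omega), ZMod.val_cast_of_lt hq] at h3
      omega
    · simp [hM₂, hM, hi, Ne.symm hi, hp0']

theorem abs_dilateGram_cubeKernel_le {n N W p p' m J S : ℕ} (hp : 1 ≤ p) (hpp : p < p')
    (hm : p' ≤ m) (hJ : (n + 1) * p' ≤ J) (hq : p' ^ (n + 2) < q) (hN : N ≤ q) (hW : W ≤ q)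
    {f : ZMod q → ℝ} (hf : ∀ x, |f x| ≤ 1) (Q : Polynomial ℝ) (c : ℕ → ℝ)
    (hc : ∀ j < J, c j = 0) {ε₁ ε₂ : ℝ} (hε₂ : 0 ≤ ε₂)
    (happrox : l2norm (cubeKernel (n + 2) f - ∑ j ∈ range S, c j •
      (kernelOp (boxPoly n f m Q) ^ j) (boxPoly n f m Q)) ≤ ε₁)
    (hU : gowersU (n + 2) f ≤ ε₂ ^ 2 ^ (n + 2)) :
    |dilateGram q N W (cubeKernel (n + 2) f) p p'| ≤ ε₁ +
      (q / W) * ((q / N) * (q / N)) * (∑ j ∈ range S, |c j| * coeffSum Q ^ (j + 1)) * ε₂ := by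
  have hp'q : p' < q := lt_of_le_of_lt (Nat.le_self_pow (by omega) p') hq
  have hp0 : (p : ZMod q) ≠ 0 := natCast_zmod_ne_zero hp (by omega)
  have hp0' : (p' : ZMod q) ≠ 0 := natCast_zmod_ne_zero (by omega) hp'q
  set K := cubeKernel (n + 2) f with hK
  have hK1 : ∀ z, |K z| ≤ 1 := abs_cubeKernel_le hf
  set Ψ := ∑ j ∈ range S, c j • (kernelOp (boxPoly n f m Q) ^ j) (boxPoly n f m Q) with hΨ
  set w : ZMod q × ZMod q → ℝ := fun z =>
    tent q W z.1 * (tent q N (p * z.1) * tent q N (p' * z.1)) with hw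
  set M : Fin (n + 2) → ZMod q × ZMod q := fun i =>
    if i = 0 then ((p' : ZMod q) ^ (n + 1), (p : ZMod q) ^ (n + 2)) else (1, (p' : ZMod q)) with hM
  have h01 : (0 : Fin (n + 2)) ≠ 1 := by simp
  have htents : Structured (ZMod q) M ((q / W) * ((q / N) * (q / N))) w :=
    ((structured_tent M h01 W (LinearMap.fst (ZMod q) (ZMod q) (ZMod q))).mul
      ((structured_tent M h01 N ((p : ZMod q) • LinearMap.fst (ZMod q) (ZMod q) (ZMod q))).mul
        (structured_tent M h01 N ((p' : ZMod q) • LinearMap.fst (ZMod q) (ZMod q) (ZMod q))))).congr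
      fun z => by simp [hw]
  have hΨs : Structured (ZMod q) M (∑ j ∈ range S, |c j| * coeffSum Q ^ (j + 1))
      (fun z => Ψ (p * z.1, z.2)) := by
    rcases Nat.eq_zero_or_pos S with rfl | hS
    · exact (structured_zero M 0).congr (by simp [hΨ])
    refine (Structured.sum (range S) (fun j z => c j * ((kernelOp (boxPoly n f m Q) ^ j)
      (boxPoly n f m Q)) (p * z.1, z.2)) _ (fun j _ => ?_) (by simpa using hS.ne')).congr
      fun z => by simp [hΨ, Finset.sum_apply]
    rcases lt_or_ge j J with hj | hj
    · simp only [hc j hj]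
      exact ((structured_zero M 0).congr (by simp)).mono (by simp)
    refine Structured.smul _ ?_
    set M' : Fin (n + 2) → ZMod q × ZMod q := fun i => ((p : ZMod q) * (M i).1, (M i).2) with hM'
    have h1 := structured_kernel_pow hf hp hpp.le hm Q
      (fun r hr hr' => natCast_zmod_ne_zero hr (by omega)) j (hJ.trans hj) M' p
      (by simp [hM', hM, pow_succ, mul_comm]) (fun i hi => by simp [hM', hM, hi])
    exact h1.comp (((p : ZMod q) • LinearMap.fst (ZMod q) (ZMod q) (ZMod q)).prod
      (LinearMap.snd _ _ _)) M (fun _ => 1) fun i => by simp [hM']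
  have hmain := abs_expect_mul_cubeKernel_le hpp hq hp0' hf hε₂ hU hM (htents.mul hΨs)
  exact (abs_dilateGram_le_of_approx hN hW hp0 hK1 happrox).trans (add_le_add_right hmain _)

end

/-- The Gowers norms of the localizations of `f` tend to zero. -/
def LocallyUniform (k : ℕ) (f : ℕ → ℝ) : Prop :=
  ∀ ε > 0, ∃ N₀ : ℕ, ∀ N ≥ N₀, ∀ (q : ℕ) [Fact q.Prime], 10 * N ≤ q → q ≤ 20 * N →
    gowersU k (localFn q N f) ≤ ε

theorem div_block_width_le {q N j J : ℕ} (hq : q ≤ 20 * N) (hj : j < J) :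
    (q : ℝ) / (2 * (N / 2 ^ j) + 2 : ℕ) ≤ 20 * 2 ^ J := by
  have h1 : N < 2 ^ j * (N / 2 ^ j + 1) := Nat.lt_mul_div_succ N (by positivity)
  have h2 : 2 ^ j ≤ 2 ^ J := Nat.pow_le_pow_right two_pos hj.le
  rw [div_le_iff₀ (by positivity)]
  have h3 : N ≤ 2 ^ J * (2 * (N / 2 ^ j) + 2) :=
    h1.le.trans (Nat.mul_le_mul h2 (by omega))
  have h4 : (N : ℝ) ≤ 2 ^ J * (2 * (N / 2 ^ j) + 2 : ℕ) := by exact_mod_cast h3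
  have h5 : (q : ℝ) ≤ 20 * N := by exact_mod_cast hq
  linarith

theorem LocallyUniform.succ {f : ℕ → ℝ} (hmult : ∀ m n : ℕ, f (m * n) = f m * f n)
    (hbound : ∀ n, |f n| ≤ 1) {n : ℕ} (h : LocallyUniform (n + 2) f) :
    LocallyUniform (n + 3) f := by
  intro δ hδ
  obtain ⟨J, N₁, ε, hε, hkatai⟩ := katai_bound hmult hbound hδ
  obtain ⟨Q, c, S, hc, happ⟩ := exists_cubeKernel_approx n (2 ^ J) ((n + 1) * 2 ^ J) (half_pos hε)
  set D := 20 * 2 ^ J * (20 * 20) * (∑ j ∈ range S, |c j| * coeffSum Q ^ (j + 1)) with hD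
  have hcs : 0 ≤ ∑ j ∈ range S, |c j| * coeffSum Q ^ (j + 1) :=
    sum_nonneg fun j _ => mul_nonneg (abs_nonneg _) (pow_nonneg (sum_nonneg fun _ _ => abs_nonneg _) _)
  have hD0 : 0 ≤ D := by positivity
  set ε₂ := ε / (2 * (D + 1)) with hε₂
  have h_eps : 0 < ε₂ := by positivity
  obtain ⟨N₂, hN₂⟩ := h (ε₂ ^ 2 ^ (n + 2)) (by positivity)
  refine ⟨max (max N₁ N₂) ((2 ^ J) ^ (n + 2)), fun N hN' q _ hq hq' => ?_⟩
  have hNa : N₁ ≤ N := (le_max_left _ _).trans ((le_max_left _ _).trans hN')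
  have hNb : N₂ ≤ N := (le_max_right _ _).trans ((le_max_left _ _).trans hN')
  have hNc : (2 ^ J) ^ (n + 2) ≤ N := (le_max_right _ _).trans hN'
  have hN1 : 1 ≤ N := (Nat.one_le_pow _ _ (by positivity)).trans hNc
  have hq0 : 0 < q := (Fact.out : q.Prime).pos
  have hJN : 2 ^ J ≤ N := (Nat.le_self_pow (by omega) _).trans hNc
  have hφ : ∀ x, |localFn q N f x| ≤ 1 := fun x => abs_localFn_le (by omega) hbound x
  rw [gowersU_succ_eq]
  refine (le_abs_self _).trans (hkatai N hNa q hq hq' _ (abs_cubeKernel_le hφ) ?_)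
  intro j hj p p' hp hp' hjp hpp hp'j
  have hle : p' ≤ 2 ^ J := hp'j.le.trans (Nat.pow_le_pow_right two_pos hj)
  have hWq : 2 * (N / 2 ^ j) + 2 ≤ q := by have := Nat.div_le_self N (2 ^ j); omega
  refine (abs_dilateGram_cubeKernel_le hp.one_le hpp hle (Nat.mul_le_mul_left _ hle)
    ?_ (by omega) hWq hφ Q c hc h_eps.le (happ _ _ hφ) (hN₂ N hNb q hq hq')).trans ?_
  · calc p' ^ (n + 2) ≤ (2 ^ J) ^ (n + 2) := Nat.pow_le_pow_left hle _
      _ ≤ N := hNc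
      _ < q := by omega
  have hqN : (q : ℝ) / N ≤ 20 := by
    rw [div_le_iff₀ (by exact_mod_cast hN1)]; exact_mod_cast hq'
  have hqW := div_block_width_le hq' hj
  calc _ ≤ ε / 2 + 20 * 2 ^ J * (20 * 20) *
        (∑ j ∈ range S, |c j| * coeffSum Q ^ (j + 1)) * ε₂ := by gcongr
    _ = ε / 2 + D * ε₂ := rfl
    _ ≤ ε / 2 + (D + 1) * ε₂ := by gcongr; linarith
    _ = ε := by rw [hε₂]; field_simp; norm_num

end

section

/-- The sum of `f` over the part of a residue class in `(0, N]`. -/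
def residueSum (f : ℕ → ℝ) (d r N : ℕ) : ℝ := ∑ n ∈ Ioc 0 N, if n ≡ r [MOD d] then f n else 0

/-- `f` has mean value zero along every residue class. -/
def Aperiodic (f : ℕ → ℝ) : Prop :=
  ∀ d > 0, ∀ r, Tendsto (fun N : ℕ => residueSum f d r N / N) atTop (nhds 0)

theorem abs_residueSum_le {f : ℕ → ℝ} (hf : ∀ n, |f n| ≤ 1) (d r N : ℕ) :
    |residueSum f d r N| ≤ N := by
  refine (abs_sum_le_sum_abs _ _).trans ((sum_le_sum fun n _ => ?_).trans_eq (b := ∑ n ∈ Ioc 0 N, (1 : ℝ)) (by simp))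
  split_ifs
  · exact hf n
  · simp

theorem Aperiodic.uniform {f : ℕ → ℝ} (h : Aperiodic f) (hf : ∀ n, |f n| ≤ 1) {d : ℕ} (hd : 0 < d)
    {ε : ℝ} (hε : 0 < ε) :
    ∃ N₀, ∀ N ≥ N₀, ∀ M ≤ N, ∀ r, |residueSum f d r M| ≤ ε * N := by
  have h1 : ∀ r, ∃ N₀, ∀ N ≥ N₀, |residueSum f d r N| ≤ ε * N := fun r => by
    obtain ⟨N₀, hN₀⟩ := (Metric.tendsto_atTop.1 (h d hd r)) ε hε
    refine ⟨max N₀ 1, fun N hN => ?_⟩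
    have h2 := hN₀ N ((le_max_left _ _).trans hN)
    have hN0 : (0 : ℝ) < N := by exact_mod_cast (le_max_right N₀ 1).trans hN
    rw [Real.dist_eq, sub_zero, abs_div, abs_of_pos hN0, div_lt_iff₀ hN0] at h2
    exact h2.le
  choose A hA using h1
  obtain ⟨N₁, hN₁⟩ := exists_nat_ge ((∑ r ∈ range d, A r : ℕ) / ε : ℝ)
  refine ⟨N₁, fun N hN M hM r => ?_⟩
  have hr : residueSum f d r M = residueSum f d (r % d) M := by
    unfold residueSum
    refine sum_congr rfl fun n _ => ?_
    exact if_congr (by simp [Nat.ModEq]) rfl rfl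
  rw [hr]
  have hrd : r % d ∈ range d := mem_range.2 (Nat.mod_lt _ hd)
  rcases le_total (A (r % d)) M with hle | hle
  · exact (hA _ M hle).trans (by gcongr)
  · refine (abs_residueSum_le hf _ _ _).trans ?_
    have h3 : (M : ℝ) ≤ (∑ r ∈ range d, A r : ℕ) := by
      exact_mod_cast hle.trans (single_le_sum (f := A) (fun _ _ => Nat.zero_le _) hrd)
    have h4 : (N₁ : ℝ) ≤ N := by exact_mod_cast hN
    rw [div_le_iff₀ hε] at hN₁
    nlinarith

theorem sum_Ioc_residue_eq {f : ℕ → ℝ} {d r a b N : ℕ} (hab : a ≤ b) (hb : b ≤ N) :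
    ∑ n ∈ Ioc 0 N, (if a < n ∧ n ≤ b ∧ n ≡ r [MOD d] then f n else 0)
      = residueSum f d r b - residueSum f d r a := by
  have e : ∀ c ≤ N, residueSum f d r c
      = ∑ n ∈ Ioc 0 N, if n ≤ c ∧ n ≡ r [MOD d] then f n else 0 := fun c hc => by
    unfold residueSum
    rw [← sum_subset (Ioc_subset_Ioc_right hc)]
    · refine sum_congr rfl fun n hn => ?_
      simp [(mem_Ioc.1 hn).2]
    · intro n hn hn'
      simp only [mem_Ioc, not_and, not_le] at hn hn'
      rw [if_neg]; have := hn' hn.1; omega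
  rw [e b hb, e a (hab.trans hb), ← sum_sub_distrib]
  refine sum_congr rfl fun n _ => ?_
  by_cases h1 : n ≡ r [MOD d]
  · by_cases h2 : a < n
    · simp [h1, h2, not_le.2 h2]
    · have h3 : n ≤ b := (not_lt.1 h2).trans hab
      simp [h1, h3, not_lt.1 h2]
  · simp [h1]

section
variable {q : ℕ} [Fact q.Prime]

theorem val_add_natCast_lt {x : ZMod q} {W b e : ℕ} (hbe : b ≤ e) (he : e + W ≤ q)
    (hx : x.val < W) (hxe : (x + e).val < W) : (x + b).val < W ∧ x.val + b < W := by
  have hq := (Fact.out : q.Prime).pos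
  have h1 : ∀ c : ℕ, (x + c).val = (x.val + c) % q := fun c => by
    rw [ZMod.val_add, ZMod.val_natCast, Nat.add_mod_mod]
  have h2 : x.val + e < q := by omega
  rw [h1, Nat.mod_eq_of_lt h2] at hxe
  rw [h1, Nat.mod_eq_of_lt (by omega)]
  omega

theorem exists_interval_of_boxes {N W d p p' : ℕ} (hd : 0 < d) (hW : 2 * W ≤ q) (hdW : d * W + N < q)
    (hpW : p * W + N ≤ q) (hpW' : p' * W + N ≤ q) (hN : 2 * N ≤ q) (j₁ j₂ j₃ j₄ c : ZMod q) :
    ∃ a b r : ℕ, a ≤ b ∧ b ≤ N ∧ ∀ n ∈ Ioc 0 N,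
      (((j₁ + (n - c) / d).val < W ∧ (j₂ + p * ((n - c) / d)).val < N ∧
        (j₃ + p' * ((n - c) / d)).val < N ∧ (j₄ + n).val < N) ↔ (a < n ∧ n ≤ b ∧ n ≡ r [MOD d])) := by
  classical
  set P : ℕ → Prop := fun n => (j₁ + (n - c) / d).val < W ∧ (j₂ + p * ((n - c) / d)).val < N ∧
        (j₃ + p' * ((n - c) / d)).val < N ∧ (j₄ + n).val < N with hP
  rcases ((Ioc 0 N).filter P).eq_empty_or_nonempty with he | hne
  · refine ⟨0, 0, 0, le_rfl, Nat.zero_le _, fun n hn => ⟨fun h => ?_, fun h => ?_⟩⟩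
    · exact absurd (mem_filter.2 ⟨hn, h⟩) (by rw [he]; simp)
    · omega
  have hdq : (d : ZMod q) ≠ 0 := natCast_zmod_ne_zero hd (by
    rcases W.eq_zero_or_pos with rfl | hW
    · obtain ⟨n, hn⟩ := hne
      exact absurd (mem_filter.1 hn).2.1 (by simp)
    · have := Nat.le_mul_of_pos_right d hW; omega)
  have hstep : ∀ n ∈ Ioc 0 N, ∀ n' ∈ Ioc 0 N, n ≤ n' → P n → P n' →
      ∃ δ : ℕ, n' = n + d * δ ∧ δ < W := by
    intro n hn n' hn' hle h h'
    have h1 := h.1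
    have h2 := h'.1
    set x := j₁ + (n - c) / d with hx
    set y := j₁ + (n' - c) / d with hy
    have h3 : (d : ZMod q) * (y - x) = n' - n := by
      rw [hx, hy]; field_simp; ring
    have h4 : (((d : ℤ) * ((y.val : ℤ) - x.val) - (n' - n) : ℤ) : ZMod q) = 0 := by
      push_cast
      rw [ZMod.natCast_zmod_val, ZMod.natCast_zmod_val, h3, sub_self]
    have h5 : (d : ℤ) * ((y.val : ℤ) - x.val) - (n' - n) = 0 := by
      refine Int.eq_zero_of_abs_lt_dvd ((ZMod.intCast_zmod_eq_zero_iff_dvd _ q).1 h4) ?_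
      have h6 : |(y.val : ℤ) - x.val| ≤ W := by rw [abs_le]; omega
      have h7 : |(n' : ℤ) - n| ≤ N := by
        have := (mem_Ioc.1 hn').2; have := (mem_Ioc.1 hn).1; rw [abs_le]; omega
      calc _ ≤ |(d : ℤ) * ((y.val : ℤ) - x.val)| + |(n' : ℤ) - n| := abs_sub _ _
        _ ≤ d * W + N := by rw [abs_mul, Nat.abs_cast]; gcongr
        _ < q := by exact_mod_cast hdW
    have h8 : x.val ≤ y.val := by
      by_contra! hlt
      have : (d : ℤ) * ((y.val : ℤ) - x.val) < 0 :=
        mul_neg_of_pos_of_neg (by exact_mod_cast hd) (by omega)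
      omega
    refine ⟨y.val - x.val, ?_, by omega⟩
    zify [h8]
    linarith
  set S := (Ioc 0 N).filter P with hS
  have hmin := mem_filter.1 (S.min'_mem hne)
  have hmax := mem_filter.1 (S.max'_mem hne)
  set n₀ := S.min' hne with hn₀
  set n₁ := S.max' hne with hn₁
  have hn₀' := mem_Ioc.1 hmin.1
  have hn₁' := mem_Ioc.1 hmax.1
  have hle : n₀ ≤ n₁ := S.min'_le_max' hne
  refine ⟨n₀ - 1, n₁, n₀, by omega, hn₁'.2, fun n hn => ⟨fun h => ?_, fun h => ?_⟩⟩
  · have hnS : n ∈ S := mem_filter.2 ⟨hn, h⟩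
    have h1 : n₀ ≤ n := S.min'_le n hnS
    obtain ⟨δ, hδ, -⟩ := hstep n₀ hmin.1 n hn h1 hmin.2 h
    refine ⟨by omega, S.le_max' n hnS, ?_⟩
    rw [hδ]
    simp [Nat.ModEq]
  · obtain ⟨h1, h2, h3⟩ := h
    have h1' : n₀ ≤ n := by omega
    obtain ⟨δ, hδ, hδW⟩ := hstep n₀ hmin.1 n₁ hmax.1 hle hmin.2 hmax.2
    obtain ⟨β, hβ⟩ : ∃ β, n = n₀ + d * β := by
      obtain ⟨β, hβ⟩ := (Nat.modEq_iff_dvd' h1').1 h3.symm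
      exact ⟨β, by omega⟩
    have hβδ : β ≤ δ := by
      have : d * β ≤ d * δ := by omega
      exact Nat.le_of_mul_le_mul_left this hd
    have hv : ∀ γ : ℕ, ((n₀ + d * γ : ℕ) - c : ZMod q) / d = (n₀ - c) / d + γ := fun γ => by
      push_cast; field_simp; ring
    have hmin2 := hmin.2
    have hmax2 := hmax.2
    simp only [hP] at hmin2 hmax2 ⊢
    rw [hδ, hv] at hmax2
    rw [hβ, hv]
    have hδ' : δ ≤ W := hδW.le
    have hpd : ∀ r : ℕ, r * W + N ≤ q → r * β ≤ r * δ ∧ r * δ + N ≤ q := fun r hr =>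
      ⟨Nat.mul_le_mul_left r hβδ, (Nat.add_le_add_right (Nat.mul_le_mul_left r hδ') N).trans hr⟩
    refine ⟨?_, ?_, ?_, ?_⟩
    · rw [← add_assoc]
      refine (val_add_natCast_lt hβδ (by omega) hmin2.1 ?_).1
      rw [add_assoc]; exact hmax2.1
    · rw [mul_add, ← add_assoc, ← Nat.cast_mul]
      refine (val_add_natCast_lt (hpd p hpW).1 (hpd p hpW).2 hmin2.2.1 ?_).1
      rw [add_assoc, Nat.cast_mul, ← mul_add]; exact hmax2.2.1
    · rw [mul_add, ← add_assoc, ← Nat.cast_mul]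
      refine (val_add_natCast_lt (hpd p' hpW').1 (hpd p' hpW').2 hmin2.2.2.1 ?_).1
      rw [add_assoc, Nat.cast_mul, ← mul_add]; exact hmax2.2.2.1
    · have h9 := hmax2.2.2.2
      rw [Nat.cast_add, ← add_assoc] at h9 ⊢
      exact (val_add_natCast_lt (Nat.mul_le_mul_left d hβδ) (by omega) hmin2.2.2.2 h9).1

theorem abs_sum_mul_tent_le {ι : Type*} (s : Finset ι) (W : ℕ) (g : ι → ℝ) (x : ι → ZMod q) {B : ℝ}
    (h : ∀ j, |∑ n ∈ s, g n * boxFn q W (j + x n)| ≤ B) :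
    |∑ n ∈ s, g n * tent q W (x n)| ≤ q / W * B := by
  have e : ∑ n ∈ s, g n * tent q W (x n)
      = q / W * 𝔼 j, boxFn q W j * ∑ n ∈ s, g n * boxFn q W (j + x n) := by
    simp only [tent, mul_sum, mul_expect]
    rw [← expect_sum_comm]
    exact expect_congr rfl fun j _ => sum_congr rfl fun n _ => by ring
  rw [e, abs_mul, abs_of_nonneg (by positivity : (0 : ℝ) ≤ q / W)]
  refine mul_le_mul_of_nonneg_left ((abs_expect_le _ _).trans
    (expect_le univ_nonempty fun j _ => ?_)) (by positivity)
  rw [abs_mul]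
  exact (mul_le_of_le_one_left (abs_nonneg _) (abs_box_le _ _)).trans (h j)

theorem abs_weighted_progression_le {N W d p p' : ℕ} (hd : 0 < d) (hW : 2 * W ≤ q)
    (hdW : d * W + N < q) (hpW : p * W + N ≤ q) (hpW' : p' * W + N ≤ q) (hN : 2 * N ≤ q)
    {f : ℕ → ℝ} {ε : ℝ} (hf : ∀ M ≤ N, ∀ r, |residueSum f d r M| ≤ ε) (c : ZMod q) :
    |∑ n ∈ Ioc 0 N, f n * (tent q N (n : ZMod q) * (tent q W ((n - c) / d : ZMod q) *
      (tent q N (p * ((n - c) / d) : ZMod q) * tent q N (p' * ((n - c) / d) : ZMod q))))|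
      ≤ q / W * (q / N * (q / N * (q / N * (2 * ε)))) := by
  have key : ∀ j₁ j₂ j₃ j₄ : ZMod q, |∑ n ∈ Ioc 0 N, f n * boxFn q W (j₁ + (n - c) / d) *
      boxFn q N (j₂ + p * ((n - c) / d)) * boxFn q N (j₃ + p' * ((n - c) / d)) *
      boxFn q N (j₄ + n)| ≤ 2 * ε := by
    intro j₁ j₂ j₃ j₄
    obtain ⟨a, b, r, hab, hb, hP⟩ := exists_interval_of_boxes hd hW hdW hpW hpW' hN j₁ j₂ j₃ j₄ c
    have e : ∑ n ∈ Ioc 0 N, f n * boxFn q W (j₁ + (n - c) / d) *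
        boxFn q N (j₂ + p * ((n - c) / d)) * boxFn q N (j₃ + p' * ((n - c) / d)) *
        boxFn q N (j₄ + n) = residueSum f d r b - residueSum f d r a := by
      rw [← sum_Ioc_residue_eq hab hb]
      refine sum_congr rfl fun n hn => ?_
      rw [← if_congr (hP n hn) rfl rfl]
      unfold boxFn
      by_cases h1 : (j₁ + ((n : ZMod q) - c) / d).val < W <;>
      by_cases h2 : (j₂ + p * (((n : ZMod q) - c) / d)).val < N <;>
      by_cases h3 : (j₃ + p' * (((n : ZMod q) - c) / d)).val < N <;>
      by_cases h4 : (j₄ + (n : ZMod q)).val < N <;> simp [h1, h2, h3, h4]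
    rw [e]
    refine (abs_sub _ _).trans ?_
    have := hf b hb r
    have := hf a (hab.trans hb) r
    linarith
  have h1 := abs_sum_mul_tent_le (q := q) (Ioc 0 N) W (fun n : ℕ => f n * (tent q N (n : ZMod q) *
    (tent q N (p * (((n : ZMod q) - c) / d) : ZMod q) * tent q N (p' * (((n : ZMod q) - c) / d) : ZMod q))))
    (fun n : ℕ => ((n : ZMod q) - c) / d) (B := q / N * (q / N * (q / N * (2 * ε)))) fun j₁ => ?_
  · exact (congrArg abs (sum_congr rfl fun n _ => by ring)).trans_le h1
  have h2 := abs_sum_mul_tent_le (q := q) (Ioc 0 N) N (fun n : ℕ => f n * boxFn q W (j₁ + ((n : ZMod q) - c) / d) *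
    (tent q N (n : ZMod q) * tent q N (p' * (((n : ZMod q) - c) / d) : ZMod q)))
    (fun n : ℕ => p * (((n : ZMod q) - c) / d)) (B := q / N * (q / N * (2 * ε))) fun j₂ => ?_
  · exact (congrArg abs (sum_congr rfl fun n _ => by ring)).trans_le h2
  have h3 := abs_sum_mul_tent_le (q := q) (Ioc 0 N) N (fun n : ℕ => f n * boxFn q W (j₁ + ((n : ZMod q) - c) / d) *
    boxFn q N (j₂ + p * (((n : ZMod q) - c) / d)) * tent q N (n : ZMod q))
    (fun n : ℕ => p' * (((n : ZMod q) - c) / d)) (B := q / N * (2 * ε)) fun j₃ => ?_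
  · exact (congrArg abs (sum_congr rfl fun n _ => by ring)).trans_le h3
  have h4 := abs_sum_mul_tent_le (q := q) (Ioc 0 N) N (fun n : ℕ => f n * boxFn q W (j₁ + ((n : ZMod q) - c) / d) *
    boxFn q N (j₂ + p * (((n : ZMod q) - c) / d)) * boxFn q N (j₃ + p' * (((n : ZMod q) - c) / d)))
    (fun n : ℕ => (n : ZMod q)) (B := 2 * ε) fun j₄ => key j₁ j₂ j₃ j₄
  exact (congrArg abs (sum_congr rfl fun n _ => by ring)).trans_le h4

theorem abs_expect_le_bound {X : Type*} [Fintype X] [Nonempty X] {u : X → ℝ} {B : ℝ}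
    (h : ∀ x, |u x| ≤ B) : |𝔼 x, u x| ≤ B :=
  (abs_expect_le _ _).trans (expect_le univ_nonempty fun x _ => h x)

theorem cubeKernel_one (φ : ZMod q → ℝ) (z : ZMod q × ZMod q) :
    cubeKernel 1 φ z = 𝔼 t, φ (z.1 + t) * φ (z.2 + t) := by
  have h1 : (univ : Finset (Fin 1 → Bool)).erase (fun _ => false) = {fun _ => true} := by decide
  rw [cubeKernel]
  refine Fintype.expect_equiv (Equiv.funUnique (Fin 1) (ZMod q)) _ _ fun t => ?_
  simp [punctured, h1, vertexSum_apply]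

theorem dilateGram_cubeKernel_one (N W p p' : ℕ) (φ : ZMod q → ℝ) :
    dilateGram q N W (cubeKernel 1 φ) p p' = 𝔼 y, 𝔼 s, 𝔼 r, (φ (s - y) * φ s * φ r) *
      𝔼 u, φ ((p' - p) * u + (r - y)) *
        (tent q W u * (tent q N (p * u) * tent q N (p' * u))) := by
  have hsub : ∀ (u : ZMod q), 𝔼 y, cubeKernel 1 φ (p * u, y) * cubeKernel 1 φ (p' * u, y)
      = 𝔼 y, 𝔼 s, 𝔼 r, (φ (s - y) * φ s * φ r) * φ ((p' - p) * u + (r - y)) := by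
    intro u
    refine Eq.trans ?_ (Fintype.expect_equiv (Equiv.subRight (p * u)) (fun y => 𝔼 s, 𝔼 r,
      (φ (p * u + (s - y)) * φ s) * (φ (p' * u + (r - y)) * φ r)) _ fun y => ?_)
    · refine expect_congr rfl fun y _ => ?_
      rw [cubeKernel_one, cubeKernel_one, expect_mul_expect]
      refine Fintype.expect_equiv (Equiv.addLeft y) _ _ fun t => ?_
      refine Fintype.expect_equiv (Equiv.addLeft y) _ _ fun t' => ?_
      simp
    · refine expect_congr rfl fun s _ => expect_congr rfl fun r _ => ?_
      simp only [Equiv.subRight_apply]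
      rw [show s - (y - p * u) = p * u + (s - y) by ring,
        show (p' - p) * u + (r - (y - p * u)) = p' * u + (r - y) by ring]
      ring
  calc _ = 𝔼 u, (tent q W u * (tent q N (p * u) * tent q N (p' * u))) *
        𝔼 y, cubeKernel 1 φ (p * u, y) * cubeKernel 1 φ (p' * u, y) := by
        rw [dilateGram, expect_prod_type]
        exact expect_congr rfl fun u _ => by rw [mul_expect]
    _ = _ := by
        simp only [hsub, mul_expect]
        rw [expect_comm]
        refine expect_congr rfl fun y _ => ?_
        rw [expect_comm]
        refine expect_congr rfl fun s _ => ?_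
        rw [expect_comm]
        exact expect_congr rfl fun r _ => expect_congr rfl fun u _ => by ring


theorem abs_dilateGram_cubeKernel_one_le {N j p p' : ℕ} (hj : 2 ^ j ≤ N) (hq : 10 * N ≤ q)
    (hp : p < p') (hpj : 2 ^ j ≤ p) (hpj' : p' < 2 ^ (j + 1)) {f : ℕ → ℝ} (hf : ∀ n, |f n| ≤ 1)
    {ε : ℝ} (h : ∀ M ≤ N, ∀ r, |residueSum f (p' - p) r M| ≤ ε) :
    |dilateGram q N (2 * (N / 2 ^ j) + 2) (cubeKernel 1 (localFn q N f)) p p'|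
      ≤ q / (2 * (N / 2 ^ j) + 2 : ℕ) * (q / N * (q / N * (q / N * (2 * ε)))) / q := by
  set W := 2 * (N / 2 ^ j) + 2 with hW
  have hj1 : 1 ≤ 2 ^ j := Nat.one_le_two_pow
  have hpow : 2 ^ (j + 1) = 2 * 2 ^ j := by rw [pow_succ]; ring
  have hd : 0 < p' - p := by omega
  have h1 : 2 ^ j * W ≤ 4 * N := by
    have := Nat.mul_div_le N (2 ^ j)
    rw [hW]; nlinarith
  have hdW : (p' - p) * W ≤ 4 * N := (Nat.mul_le_mul_right W (by omega)).trans h1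
  have hpW : p' * W ≤ 8 * N := (Nat.mul_le_mul_right W hpj'.le).trans (by rw [hpow]; nlinarith)
  have hpW' : p * W ≤ 8 * N := (Nat.mul_le_mul_right W hp.le).trans hpW
  have hWq : 2 * W ≤ q := by nlinarith
  have hNq : N < q := by omega
  have hd0 : ((p' : ZMod q) - p) ≠ 0 := by
    have := natCast_zmod_ne_zero (q := q) hd (by
      have := Nat.le_mul_of_pos_right (p' - p) (show 0 < W by omega); omega)
    rwa [Nat.cast_sub hp.le] at this
  rw [dilateGram_cubeKernel_one]
  have hφ : ∀ x, |localFn q N f x| ≤ 1 := abs_localFn_le (by omega) hf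
  have hinner : ∀ c : ZMod q, |𝔼 u, localFn q N f ((p' - p) * u + c) *
        (tent q W u * (tent q N (p * u) * tent q N (p' * u)))|
      ≤ q / W * (q / N * (q / N * (q / N * (2 * ε)))) / q := by
    intro c
    have e : 𝔼 u, localFn q N f ((p' - p) * u + c) *
        (tent q W u * (tent q N (p * u) * tent q N (p' * u)))
        = 𝔼 x, localFn q N f x * (tent q W ((x - c) / (p' - p)) *
          (tent q N (p * ((x - c) / (p' - p))) * tent q N (p' * ((x - c) / (p' - p))))) := by
      refine Fintype.expect_equiv ((Equiv.mulLeft₀ _ hd0).trans (Equiv.addRight c)) _ _ fun u => ?_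
      have : ((p' - p) * u) / ((p' : ZMod q) - p) = u := mul_div_cancel_left₀ _ hd0
      simp [this]
    rw [e, expect_localFn_mul hNq, abs_div, Nat.abs_cast]
    have := abs_weighted_progression_le (p := p) (p' := p') hd hWq (by omega) (by omega) (by omega)
      (by omega) h c
    rw [Nat.cast_sub hp.le] at this
    gcongr
  refine abs_expect_le_bound fun y => abs_expect_le_bound fun s => abs_expect_le_bound fun r => ?_
  rw [abs_mul]
  refine (mul_le_of_le_one_left (abs_nonneg _) ?_).trans (hinner _)
  rw [abs_mul, abs_mul]
  exact mul_le_one₀ (mul_le_one₀ (hφ _) (abs_nonneg _) (hφ _)) (abs_nonneg _) (hφ _)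

end

theorem Aperiodic.locallyUniform_two {f : ℕ → ℝ} (hmult : ∀ m n : ℕ, f (m * n) = f m * f n)
    (hbound : ∀ n, |f n| ≤ 1) (h : Aperiodic f) : LocallyUniform 2 f := by
  intro δ hδ
  obtain ⟨J, N₀, ε, hε, hK⟩ := katai_bound hmult hbound hδ
  set κ : ℝ := ε / (20 ^ 4 * 2 * 2 ^ J) with hκ
  have hκ0 : 0 < κ := by positivity
  choose! A hA using fun d (hd : 0 < d) => h.uniform hbound hd hκ0
  refine ⟨max (max N₀ (2 ^ J)) (∑ d ∈ range (2 ^ J), A d), fun N hN q _ hq hq' => ?_⟩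
  simp only [ge_iff_le, max_le_iff] at hN
  obtain ⟨⟨hN0, hNJ⟩, hNA⟩ := hN
  have hN1 : 1 ≤ N := Nat.one_le_two_pow.trans hNJ
  rw [gowersU_succ_eq]
  refine (le_abs_self _).trans (hK N hN0 q hq hq' _ ?_ ?_)
  · exact abs_cubeKernel_le (abs_localFn_le (by omega) hbound)
  · intro j hj p p' hp hp' hpj hpp hpj'
    have h2J : 2 ^ (j + 1) ≤ 2 ^ J := Nat.pow_le_pow_right (by norm_num) hj
    have h2j : 2 ^ j ≤ N := (Nat.pow_le_pow_right (by norm_num) hj.le).trans hNJ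
    have hdJ : p' - p ∈ range (2 ^ J) := mem_range.2 (by omega)
    have hAN : A (p' - p) ≤ N :=
      (single_le_sum (f := A) (fun _ _ => Nat.zero_le _) hdJ).trans hNA
    refine (abs_dilateGram_cubeKernel_one_le h2j hq hpp hpj hpj' hbound
      (hA (p' - p) (by omega) N hAN)).trans ?_
    have hN' : (0 : ℝ) < N := by exact_mod_cast hN1
    have hqN : (q : ℝ) / N ≤ 20 := by
      rw [div_le_iff₀ hN']; exact_mod_cast hq'
    have hNq : (N : ℝ) / q ≤ 1 := div_le_one_of_le₀ (by exact_mod_cast (by omega : N ≤ q)) (by positivity)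
    have hW := div_block_width_le hq' hj
    calc _ = (q : ℝ) / (2 * (N / 2 ^ j) + 2 : ℕ) * (q / N * (q / N * (q / N * (2 * κ)))) * (N / q) := by
          ring
      _ ≤ 20 * 2 ^ J * (20 * (20 * (20 * (2 * κ)))) * 1 := by gcongr
      _ = ε := by rw [hκ]; field_simp

theorem Aperiodic.locallyUniform {f : ℕ → ℝ} (hmult : ∀ m n : ℕ, f (m * n) = f m * f n)
    (hbound : ∀ n, |f n| ≤ 1) (h : Aperiodic f) (n : ℕ) : LocallyUniform (n + 2) f := by
  induction n with
  | zero => exact h.locallyUniform_two hmult hbound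
  | succ n ih => exact ih.succ hmult hbound

end

section

section
variable {K : ℕ} [NeZero K]

theorem sum_norm_sq_dft (s : ZMod K → ℂ) :
    ∑ ξ, ‖ZMod.dft s ξ‖ ^ 2 = K * ∑ k, ‖s k‖ ^ 2 := by
  have h1 : ∀ ξ, ((‖ZMod.dft s ξ‖ ^ 2 : ℝ) : ℂ) = ∑ j, ∑ k, s j * (starRingEnd ℂ) (s k) *
      ZMod.stdAddChar (ξ * (k - j)) := by
    intro ξ
    rw [← Complex.normSq_eq_norm_sq, ← Complex.mul_conj, ZMod.dft_apply, map_sum, sum_mul_sum]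
    refine sum_congr rfl fun j _ => sum_congr rfl fun k _ => ?_
    rw [smul_eq_mul, smul_eq_mul, map_mul, ← AddChar.map_neg_eq_conj,
      show ξ * (k - j) = -(j * ξ) + - -(k * ξ) by ring, AddChar.map_add_eq_mul]
    ring
  have h2 : ((∑ ξ, ‖ZMod.dft s ξ‖ ^ 2 : ℝ) : ℂ) = ((K * ∑ k, ‖s k‖ ^ 2 : ℝ) : ℂ) := by
    rw [Complex.ofReal_sum]
    simp_rw [h1]
    rw [sum_comm]
    push_cast
    rw [mul_sum]
    refine sum_congr rfl fun j _ => ?_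
    rw [sum_comm]
    simp_rw [← mul_sum, AddChar.sum_mulShift _ (ZMod.isPrimitive_stdAddChar K), sub_eq_zero]
    simp only [Nat.cast_ite, Nat.cast_zero, mul_ite, mul_zero, sum_ite_eq', mem_univ, if_true,
      ZMod.card]
    rw [Complex.mul_conj, Complex.normSq_eq_norm_sq]
    push_cast; ring
  exact_mod_cast h2

theorem dft_comp_sub (s : ZMod K → ℂ) (h ξ : ZMod K) :
    ZMod.dft (fun k => s (k - h)) ξ = ZMod.stdAddChar (-(h * ξ)) * ZMod.dft s ξ := by
  rw [ZMod.dft_apply, ZMod.dft_apply, mul_sum]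
  refine Fintype.sum_equiv (Equiv.subRight h) _ _ fun k => ?_
  simp only [Equiv.subRight_apply, smul_eq_mul]
  rw [← mul_assoc, ← AddChar.map_add_eq_mul]
  congr 2; ring

theorem sum_norm_sq_sub_shift (s : ZMod K → ℂ) (ζ : ℂ) (h : ZMod K) :
    ∑ ξ, ‖1 - ζ * ZMod.stdAddChar (-(h * ξ))‖ ^ 2 * ‖ZMod.dft s ξ‖ ^ 2
      = K * ∑ k, ‖s k - ζ * s (k - h)‖ ^ 2 := by
  rw [← sum_norm_sq_dft fun k => s k - ζ * s (k - h)]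
  refine sum_congr rfl fun ξ _ => ?_
  have : ZMod.dft (fun k => s k - ζ * s (k - h)) ξ
      = (1 - ζ * ZMod.stdAddChar (-(h * ξ))) * ZMod.dft s ξ := by
    rw [sub_mul, one_mul, mul_assoc, ← dft_comp_sub]
    simp only [ZMod.dft_apply, smul_eq_mul, mul_sub, sum_sub_distrib, mul_sum]
    congr 1
    exact sum_congr rfl fun k _ => by ring
  rw [this, norm_mul, mul_pow]

/-- The argument of the additive character of frequency `ξ`, scaled by `1 / K`. -/
noncomputable def freq (ξ : ZMod K) : ℝ := 2 * Real.pi * ξ.valMinAbs / K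

theorem stdAddChar_neg_natCast_mul (h : ℕ) (ξ : ZMod K) :
    ZMod.stdAddChar (-((h : ZMod K) * ξ)) = Complex.exp (-(h * freq ξ : ℝ) * Complex.I) := by
  have h1 : -((h : ZMod K) * ξ) = ((-(h * ξ.valMinAbs) : ℤ) : ZMod K) := by
    push_cast; simp
  rw [h1, ZMod.stdAddChar_coe]
  congr 1
  unfold freq
  push_cast; ring

theorem card_le_sum_norm_sq_of_large_freq {H : ℕ} {ξ : ZMod K} (hξ : (K : ℝ) ≤ H * |(ξ.valMinAbs : ℝ)|) :
    (H : ℝ) ≤ ∑ h ∈ range H, ‖1 - Complex.exp (-(h * freq ξ : ℝ) * Complex.I)‖ ^ 2 := by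
  have hK : (0 : ℝ) < K := by exact_mod_cast Nat.pos_of_ne_zero (NeZero.ne K)
  set z := Complex.exp (-(freq ξ : ℝ) * Complex.I) with hz
  have hz1 : ∀ x : ℝ, ‖Complex.exp (-(x : ℝ) * Complex.I)‖ = 1 := fun x => by
    rw [← Complex.ofReal_neg, Complex.norm_exp_ofReal_mul_I]
  have hpow : ∀ h : ℕ, Complex.exp (-(h * freq ξ : ℝ) * Complex.I) = z ^ h := fun h => by
    rw [hz, ← Complex.exp_nat_mul]; congr 1; push_cast; ring
  have e : ∀ h ∈ range H, ‖1 - Complex.exp (-(h * freq ξ : ℝ) * Complex.I)‖ ^ 2 = 2 - 2 * (z ^ h).re := by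
    intro h _
    rw [← hpow]
    have h1 := hz1 (h * freq ξ)
    set w := Complex.exp (-(h * freq ξ : ℝ) * Complex.I)
    have h2 : w.re * w.re + w.im * w.im = 1 := by
      rw [← Complex.normSq_apply, Complex.normSq_eq_norm_sq, h1]; norm_num
    rw [← Complex.normSq_eq_norm_sq, Complex.normSq_apply]
    simp only [Complex.sub_re, Complex.one_re, Complex.sub_im, Complex.one_im]
    nlinarith
  rw [sum_congr rfl e, sum_sub_distrib, ← mul_sum, ← Complex.re_sum]
  have hξ0 : 0 < |(ξ.valMinAbs : ℝ)| := by
    by_contra hc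
    have : |(ξ.valMinAbs : ℝ)| = 0 := le_antisymm (not_lt.1 hc) (abs_nonneg _)
    rw [this] at hξ; linarith
  have hsmall : |(ξ.valMinAbs : ℝ)| ≤ K / 2 := by
    have h1 : (ξ.valMinAbs.natAbs : ℝ) ≤ (K / 2 : ℕ) := by exact_mod_cast ZMod.natAbs_valMinAbs_le ξ
    have h2 : ((K / 2 : ℕ) : ℝ) ≤ K / 2 := by exact_mod_cast Nat.cast_div_le (α := ℝ) (m := K) (n := 2)
    rw [Nat.cast_natAbs, Int.cast_abs] at h1
    linarith
  have hsub : 4 * |(ξ.valMinAbs : ℝ)| / K ≤ ‖z - 1‖ := by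
    have h1 : z = Complex.exp (Complex.I * ((-freq ξ : ℝ) : ℂ)) := by
      rw [hz]; congr 1; push_cast; ring
    rw [h1, Complex.norm_exp_I_mul_ofReal_sub_one, Real.norm_eq_abs, abs_mul, abs_two]
    have h2 : |-freq ξ / 2| ≤ Real.pi / 2 := by
      unfold freq
      rw [abs_div, abs_neg, abs_div, abs_mul, abs_mul, abs_two, abs_of_pos Real.pi_pos, abs_of_pos hK]
      rw [div_div, div_le_div_iff₀ (by positivity) (by norm_num)]
      nlinarith [Real.pi_pos]
    have h3 := Real.mul_abs_le_abs_sin h2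
    have h4 : 2 / Real.pi * |-freq ξ / 2| = 2 * |(ξ.valMinAbs : ℝ)| / K := by
      unfold freq
      rw [abs_div, abs_neg, abs_div, abs_mul, abs_mul, abs_two, abs_of_pos Real.pi_pos, abs_of_pos hK]
      field_simp
    rw [h4] at h3
    calc _ = 2 * (2 * |(ξ.valMinAbs : ℝ)| / K) := by ring
      _ ≤ _ := by gcongr
  have hne : z ≠ 1 := fun hc => by
    rw [hc, sub_self, norm_zero] at hsub
    have : 0 < 4 * |(ξ.valMinAbs : ℝ)| / K := by positivity
    linarith
  have hgeom : ‖∑ h ∈ range H, z ^ h‖ ≤ H / 2 := by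
    rw [geom_sum_eq hne, norm_div]
    have h1 : ‖z ^ H - 1‖ ≤ 2 := by
      refine (norm_sub_le _ _).trans ?_
      rw [norm_pow, hz, hz1]; norm_num
    rw [div_le_iff₀ (norm_pos_iff.2 (sub_ne_zero.2 hne))]
    have h2 : (2 : ℝ) ≤ H / 2 * (4 * |(ξ.valMinAbs : ℝ)| / K) := by
      rw [← mul_div_assoc, le_div_iff₀ hK]; linarith
    exact h1.trans (h2.trans (by gcongr))
  have := (Complex.re_le_norm _).trans hgeom
  rw [sum_const, card_range, nsmul_eq_mul]
  linarith

/-- A function on a cycle which is nearly invariant under small shifts and under many twisted shifts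
is small in mean square, provided that the twists do not match any low frequency. -/
theorem sum_norm_sq_le_of_spectral {ι : Type*} (P : Finset ι) {w : ι → ℝ} (hw : ∀ p ∈ P, 0 ≤ w p)
    (ζ : ι → ℂ) (m : ι → ℕ) {B D τ : ℝ} (hD : 0 < D) {H : ℕ} (hH : 0 < H) (s : ZMod K → ℂ)
    (hlow : ∑ p ∈ P, w p * ∑ k, ‖s k - ζ p * s (k - m p)‖ ^ 2 ≤ B)
    (hhigh : ∑ h ∈ range H, ∑ k, ‖s k - s (k - h)‖ ^ 2 ≤ H * τ)
    (hfreq : ∀ ξ : ZMod K, H * |(ξ.valMinAbs : ℝ)| ≤ K →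
      D ≤ ∑ p ∈ P, w p * ‖1 - ζ p * Complex.exp (-(m p * freq ξ : ℝ) * Complex.I)‖ ^ 2) :
    ∑ k, ‖s k‖ ^ 2 ≤ B / D + τ := by
  have hK : (0 : ℝ) < K := by exact_mod_cast Nat.pos_of_ne_zero (NeZero.ne K)
  have hH' : (0 : ℝ) < H := by exact_mod_cast hH
  set a : ZMod K → ℝ := fun ξ =>
    ∑ p ∈ P, w p * ‖1 - ζ p * Complex.exp (-(m p * freq ξ : ℝ) * Complex.I)‖ ^ 2 with ha
  set b : ZMod K → ℝ := fun ξ =>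
    ∑ h ∈ range H, ‖1 - Complex.exp (-(h * freq ξ : ℝ) * Complex.I)‖ ^ 2 with hb
  have h1 : ∑ ξ, a ξ * ‖ZMod.dft s ξ‖ ^ 2 ≤ K * B := by
    have e : ∑ ξ, a ξ * ‖ZMod.dft s ξ‖ ^ 2
        = K * ∑ p ∈ P, w p * ∑ k, ‖s k - ζ p * s (k - m p)‖ ^ 2 := by
      simp only [ha, sum_mul]
      rw [sum_comm, mul_sum]
      refine sum_congr rfl fun p _ => ?_
      rw [mul_left_comm, ← sum_norm_sq_sub_shift, mul_sum]
      exact sum_congr rfl fun ξ _ => by rw [stdAddChar_neg_natCast_mul, mul_assoc]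
    rw [e]; gcongr
  have h2 : ∑ ξ, b ξ * ‖ZMod.dft s ξ‖ ^ 2 ≤ K * (H * τ) := by
    have e : ∑ ξ, b ξ * ‖ZMod.dft s ξ‖ ^ 2
        = K * ∑ h ∈ range H, ∑ k, ‖s k - s (k - h)‖ ^ 2 := by
      simp only [hb, sum_mul]
      rw [sum_comm, mul_sum]
      refine sum_congr rfl fun h _ => ?_
      have := sum_norm_sq_sub_shift s 1 (h : ZMod K)
      simp only [one_mul] at this
      rw [← this]
      exact sum_congr rfl fun ξ _ => by rw [stdAddChar_neg_natCast_mul]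
    rw [e]; gcongr
  have h3 : ∀ ξ, ‖ZMod.dft s ξ‖ ^ 2
      ≤ a ξ * ‖ZMod.dft s ξ‖ ^ 2 / D + b ξ * ‖ZMod.dft s ξ‖ ^ 2 / H := by
    intro ξ
    have ha0 : 0 ≤ a ξ := sum_nonneg fun p hp => mul_nonneg (hw p hp) (by positivity)
    have hb0 : 0 ≤ b ξ := sum_nonneg fun p _ => by positivity
    rcases le_total (H * |(ξ.valMinAbs : ℝ)|) K with h | h
    · have h4 : ‖ZMod.dft s ξ‖ ^ 2 ≤ a ξ * ‖ZMod.dft s ξ‖ ^ 2 / D := by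
        rw [le_div_iff₀ hD, mul_comm]
        exact mul_le_mul_of_nonneg_right (hfreq ξ h) (by positivity)
      have : 0 ≤ b ξ * ‖ZMod.dft s ξ‖ ^ 2 / H := by positivity
      linarith
    · have h4 : ‖ZMod.dft s ξ‖ ^ 2 ≤ b ξ * ‖ZMod.dft s ξ‖ ^ 2 / H := by
        rw [le_div_iff₀ hH', mul_comm]
        exact mul_le_mul_of_nonneg_right (card_le_sum_norm_sq_of_large_freq h) (by positivity)
      have : 0 ≤ a ξ * ‖ZMod.dft s ξ‖ ^ 2 / D := by positivity
      linarith
  have h5 : K * ∑ k, ‖s k‖ ^ 2 ≤ K * (B / D + τ) := by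
    rw [← sum_norm_sq_dft]
    calc _ ≤ ∑ ξ, (a ξ * ‖ZMod.dft s ξ‖ ^ 2 / D + b ξ * ‖ZMod.dft s ξ‖ ^ 2 / H) :=
          sum_le_sum fun ξ _ => h3 ξ
      _ = (∑ ξ, a ξ * ‖ZMod.dft s ξ‖ ^ 2) / D + (∑ ξ, b ξ * ‖ZMod.dft s ξ‖ ^ 2) / H := by
          rw [sum_add_distrib, sum_div, sum_div]
      _ ≤ K * B / D + K * (H * τ) / H := by gcongr
      _ = _ := by field_simp
  exact le_of_mul_le_mul_left h5 hK

end

end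

/-- The mean value of `g` on `{1, …, N}`. -/
noncomputable def meanUpTo (g : ℕ → ℂ) (N : ℕ) : ℂ := (∑ n ∈ Ioc 0 N, g n) / N

theorem norm_sum_Ioc_le {g : ℕ → ℂ} (hg : ∀ n, ‖g n‖ ≤ 1) (a b : ℕ) (h : a ≤ b) :
    ‖∑ n ∈ Ioc a b, g n‖ ≤ b - a := by
  refine (norm_sum_le _ _).trans ((sum_le_sum fun n _ => hg n).trans_eq ?_)
  rw [sum_const, Nat.card_Ioc, nsmul_eq_mul, mul_one, Nat.cast_sub h]

theorem norm_meanUpTo_le {g : ℕ → ℂ} (hg : ∀ n, ‖g n‖ ≤ 1) (N : ℕ) : ‖meanUpTo g N‖ ≤ 1 := by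
  rw [meanUpTo, norm_div, Complex.norm_natCast]
  refine div_le_one_of_le₀ ?_ (Nat.cast_nonneg _)
  simpa using norm_sum_Ioc_le hg 0 N (Nat.zero_le _)

theorem norm_meanUpTo_sub_le {g : ℕ → ℂ} (hg : ∀ n, ‖g n‖ ≤ 1) {m n : ℕ} (hm : 1 ≤ m) (h : m ≤ n) :
    ‖meanUpTo g n - meanUpTo g m‖ ≤ 2 * (n - m) / n := by
  have hm' : (0 : ℝ) < m := by exact_mod_cast hm
  have hn' : (0 : ℝ) < n := hm'.trans_le (by exact_mod_cast h)
  have hmC : (m : ℂ) ≠ 0 := by exact_mod_cast hm'.ne'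
  have hnC : (n : ℂ) ≠ 0 := by exact_mod_cast hn'.ne'
  have e : meanUpTo g n - meanUpTo g m
      = (∑ k ∈ Ioc m n, g k) / n - meanUpTo g m * ((n - m : ℝ) / n : ℝ) := by
    unfold meanUpTo
    rw [← sum_Ioc_consecutive g (Nat.zero_le m) h]
    push_cast
    field_simp
    ring
  rw [e]
  have h1 : (0 : ℝ) ≤ (n - m) / n := div_nonneg (sub_nonneg.2 (by exact_mod_cast h)) hn'.le
  calc _ ≤ ‖(∑ k ∈ Ioc m n, g k) / n‖ + ‖meanUpTo g m * ((n - m : ℝ) / n : ℝ)‖ := norm_sub_le _ _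
    _ ≤ (n - m) / n + 1 * ((n - m) / n) := by
        rw [norm_div, Complex.norm_natCast, norm_mul, Complex.norm_real, Real.norm_of_nonneg h1]
        gcongr
        · exact norm_sum_Ioc_le hg m n h
        · exact norm_meanUpTo_le hg m
    _ = _ := by ring

theorem sum_dvd_completely_multiplicative {g : ℕ → ℂ} (hmult : ∀ m n, g (m * n) = g m * g n)
    {p : ℕ} (hp : 0 < p) (N : ℕ) :
    ∑ n ∈ Ioc 0 N, (if p ∣ n then g n else 0) = g p * ∑ n ∈ Ioc 0 (N / p), g n := by
  rw [← sum_filter, mul_sum]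
  symm
  refine sum_bij' (fun n _ => p * n) (fun n _ => n / p) (fun n hn => ?_) (fun n hn => ?_)
    (fun n hn => Nat.mul_div_cancel_left n hp) (fun n hn => Nat.mul_div_cancel' (mem_filter.1 hn).2)
    (fun n _ => (hmult p n).symm)
  · rw [mem_Ioc] at hn
    rw [mem_filter, mem_Ioc]
    exact ⟨⟨Nat.mul_pos hp hn.1, by rw [mul_comm]; exact (Nat.le_div_iff_mul_le hp).1 hn.2⟩,
      dvd_mul_right p n⟩
  · obtain ⟨h1, h2⟩ := mem_filter.1 hn
    rw [mem_Ioc] at h1 ⊢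
    exact ⟨Nat.div_pos (Nat.le_of_dvd h1.1 h2) hp, Nat.div_le_div_right h1.2⟩

theorem turan_kubilius_dual_mean {g : ℕ → ℂ} (hmult : ∀ m n, g (m * n) = g m * g n)
    (hg : ∀ n, ‖g n‖ ≤ 1) (P : Finset ℕ) (hP : ∀ p ∈ P, p.Prime) {N : ℕ} (hN0 : 0 < N)
    (hN : ∑ p ∈ P, p ≤ N) :
    ∑ p ∈ P, (1 / p : ℝ) * ‖meanUpTo g N - g p * (p / N * ∑ n ∈ Ioc 0 (N / p), g n)‖ ^ 2 ≤ 4 := by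
  have hN' : (0 : ℝ) < N := by exact_mod_cast hN0
  have hre := turan_kubilius_dual P hP (fun n => (g n).re)
    (fun n => (Complex.abs_re_le_norm _).trans (hg n)) N hN
  have him := turan_kubilius_dual P hP (fun n => (g n).im)
    (fun n => (Complex.abs_im_le_norm _).trans (hg n)) N hN
  have e : ∀ p ∈ P, (1 / p : ℝ) * ‖meanUpTo g N - g p * (p / N * ∑ n ∈ Ioc 0 (N / p), g n)‖ ^ 2
      = 1 / N ^ 2 * (p * (∑ n ∈ Ioc 0 N, (g n).re * balancedDvd p n) ^ 2
        + p * (∑ n ∈ Ioc 0 N, (g n).im * balancedDvd p n) ^ 2) := by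
    intro p hp
    have hp0 : (0 : ℝ) < p := by exact_mod_cast (hP p hp).pos
    set z : ℂ := ∑ n ∈ Ioc 0 N, g n * (balancedDvd p n : ℂ) with hz
    have hz1 : z = g p * (∑ n ∈ Ioc 0 (N / p), g n) - (∑ n ∈ Ioc 0 N, g n) / p := by
      rw [← sum_dvd_completely_multiplicative hmult (hP p hp).pos, sum_div, ← sum_sub_distrib, hz]
      refine sum_congr rfl fun n _ => ?_
      unfold balancedDvd
      split_ifs <;> push_cast <;> ring
    have hz2 : meanUpTo g N - g p * (p / N * ∑ n ∈ Ioc 0 (N / p), g n) = -((p / N : ℝ) : ℂ) * z := by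
      have : (p : ℂ) ≠ 0 := by exact_mod_cast hp0.ne'
      rw [hz1, meanUpTo]; push_cast; field_simp; ring
    have hzre : z.re = ∑ n ∈ Ioc 0 N, (g n).re * balancedDvd p n := by
      rw [hz, Complex.re_sum]
      exact sum_congr rfl fun n _ => by rw [Complex.re_mul_ofReal]
    have hzim : z.im = ∑ n ∈ Ioc 0 N, (g n).im * balancedDvd p n := by
      rw [hz, Complex.im_sum]
      exact sum_congr rfl fun n _ => by rw [Complex.im_mul_ofReal]
    rw [hz2, norm_mul, norm_neg, Complex.norm_real, Real.norm_of_nonneg (by positivity), mul_pow,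
      ← Complex.normSq_eq_norm_sq, Complex.normSq_apply, ← hzre, ← hzim]
    field_simp
  rw [sum_congr rfl e, ← mul_sum, sum_add_distrib, one_div_mul_eq_div, div_le_iff₀ (by positivity)]
  linarith

/-- Sampling points in geometric progression. -/
noncomputable def geomSample (η : ℝ) (k : ℕ) : ℕ := ⌊Real.exp (η * k)⌋₊

theorem geomSample_le (η : ℝ) (k : ℕ) : (geomSample η k : ℝ) ≤ Real.exp (η * k) :=
  Nat.floor_le (Real.exp_pos _).le

theorem lt_geomSample_add_one (η : ℝ) (k : ℕ) : Real.exp (η * k) < geomSample η k + 1 :=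
  Nat.lt_floor_add_one _

theorem geomSample_mono {η : ℝ} (hη : 0 ≤ η) : Monotone (geomSample η) := fun a b h =>
  Nat.floor_le_floor (Real.exp_le_exp.2 (by gcongr))

theorem geomSample_pos {η : ℝ} (hη : 0 ≤ η) (k : ℕ) : 1 ≤ geomSample η k := by
  rw [geomSample, Nat.one_le_floor_iff]
  exact Real.one_le_exp (by positivity)

theorem norm_meanUpTo_geomSample_sub_le {g : ℕ → ℂ} (hg : ∀ n, ‖g n‖ ≤ 1) {η θ : ℝ} (hη : 0 ≤ η)
    {j h : ℕ} (hj : h ≤ j) (hh : η * h ≤ θ) (hbig : 1 ≤ θ * Real.exp (η * j)) :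
    ‖meanUpTo g (geomSample η j) - meanUpTo g (geomSample η (j - h))‖ ≤ 6 * θ := by
  have h1 := norm_meanUpTo_sub_le hg (geomSample_pos hη (j - h))
    (geomSample_mono hη (Nat.sub_le j h))
  refine h1.trans ?_
  have hpos : (0 : ℝ) < geomSample η j := by exact_mod_cast geomSample_pos hη j
  have hθ : 0 ≤ θ := le_trans (by positivity) hh
  have h2 := geomSample_le η j
  have h3 := lt_geomSample_add_one η (j - h)
  have h4 : Real.exp (η * j) * (1 - θ) ≤ Real.exp (η * (j - h : ℕ)) := by
    rw [Nat.cast_sub hj, mul_sub η, sub_eq_add_neg (η * (j : ℝ)), Real.exp_add]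
    have := Real.add_one_le_exp (-(η * h))
    have h5 : 1 - θ ≤ Real.exp (-(η * h)) := by linarith
    gcongr
  have h6 := lt_geomSample_add_one η j
  have h7 : (1 : ℝ) ≤ geomSample η j := by exact_mod_cast geomSample_pos hη j
  rw [div_le_iff₀ hpos]
  have h8 : Real.exp (η * j) ≤ 2 * geomSample η j - 0 := by linarith
  nlinarith

theorem norm_meanUpTo_sub_dilate_le {g : ℕ → ℂ} (hg : ∀ n, ‖g n‖ ≤ 1) {η : ℝ} (hη : 0 < η)
    (hη1 : η ≤ 1) {p : ℕ} (hp : 0 < p) {j h : ℕ} (hj : h ≤ j) (hh : η * h ≤ Real.log p)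
    (hh' : Real.log p ≤ η * h + η) (hbig : 4 * p ≤ η * Real.exp (η * j)) :
    ‖meanUpTo g (geomSample η (j - h)) -
      p / geomSample η j * ∑ n ∈ Ioc 0 (geomSample η j / p), g n‖ ≤ 12 * η := by
  have hp' : (0 : ℝ) < p := by exact_mod_cast hp
  have hE := Real.exp_pos (η * j)
  set N := geomSample η j with hN
  set n := geomSample η (j - h) with hn
  set m := N / p with hm
  set y := Real.exp (η * j) / p with hy
  have hyE : Real.exp (η * j) = y * p := by rw [hy]; field_simp
  have hy4 : 4 ≤ η * y := by
    rw [hyE] at hbig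
    by_contra hc
    nlinarith
  have hy4' : 4 ≤ y := by nlinarith
  have hNle : (N : ℝ) ≤ y * p := hyE ▸ geomSample_le η j
  have hNlt : y * p < N + 1 := hyE ▸ lt_geomSample_add_one η j
  have hN0 : (0 : ℝ) < N := by exact_mod_cast geomSample_pos hη.le j
  have hp1 : (1 : ℝ) ≤ p := by exact_mod_cast hp
  have hmp : (m : ℝ) * p ≤ N := by exact_mod_cast Nat.div_mul_le_self N p
  have hmp' : (N : ℝ) < (m + 1) * p := by
    have := Nat.lt_div_mul_add (a := N) hp
    rw [← hm] at this
    have : (N : ℝ) < m * p + p := by exact_mod_cast this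
    linarith
  have hmy : (m : ℝ) ≤ y := by
    by_contra hc
    nlinarith
  have hmy' : y - 2 < m := by
    by_contra hc
    nlinarith
  have hm1 : 1 ≤ m := by
    have : (0 : ℝ) < m := by linarith
    exact_mod_cast this
  have hexp : Real.exp (η * (j - h : ℕ)) = Real.exp (η * j) * Real.exp (-(η * h)) := by
    rw [Nat.cast_sub hj, mul_sub, sub_eq_add_neg (η * (j : ℝ)), Real.exp_add]
  have hlo : y ≤ Real.exp (η * (j - h : ℕ)) := by
    rw [hexp, hy, div_eq_mul_inv]
    gcongr
    rw [← Real.exp_log hp', ← Real.exp_neg]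
    exact Real.exp_le_exp.2 (by linarith)
  have hhi : Real.exp (η * (j - h : ℕ)) ≤ y * (1 + 2 * η) := by
    have h1 : Real.exp (-(η * h)) ≤ (p : ℝ)⁻¹ * Real.exp η := by
      rw [← Real.exp_log hp', ← Real.exp_neg, ← Real.exp_add]
      exact Real.exp_le_exp.2 (by linarith)
    have h2 : Real.exp η ≤ 1 + 2 * η := by
      have := Real.abs_exp_sub_one_le (x := η) (by rw [abs_of_pos hη]; exact hη1)
      rw [abs_of_pos hη] at this
      linarith [(abs_le.1 this).2]
    rw [hexp, hy, div_mul_eq_mul_div, mul_div_assoc]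
    gcongr
    calc _ ≤ (p : ℝ)⁻¹ * Real.exp η := h1
      _ ≤ (p : ℝ)⁻¹ * (1 + 2 * η) := by gcongr
      _ = _ := by ring
  have hnle := geomSample_le η (j - h)
  have hnlt := lt_geomSample_add_one η (j - h)
  rw [← hn] at hnle hnlt
  have hmn : m ≤ n := by
    have : (m : ℝ) ≤ Real.exp (η * (j - h : ℕ)) := hmy.trans hlo
    exact Nat.le_floor this
  have hn0 : (0 : ℝ) < n := by
    have : (1 : ℝ) ≤ m := by exact_mod_cast hm1
    have : (m : ℝ) ≤ n := by exact_mod_cast hmn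
    linarith
  have h1 : ‖meanUpTo g n - meanUpTo g m‖ ≤ 10 * η := by
    refine (norm_meanUpTo_sub_le hg hm1 hmn).trans ?_
    rw [div_le_iff₀ hn0]
    have : (n : ℝ) - m ≤ 2 * η * y + 2 := by nlinarith
    have : y ≤ 4 / 3 * n := by nlinarith
    nlinarith
  have h2 : ‖meanUpTo g m - p / N * ∑ k ∈ Ioc 0 m, g k‖ ≤ 2 * η := by
    have hm0 : (m : ℂ) ≠ 0 := by exact_mod_cast (show m ≠ 0 by omega)
    have hNC : (N : ℂ) ≠ 0 := by exact_mod_cast hN0.ne'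
    have e : meanUpTo g m - p / N * ∑ k ∈ Ioc 0 m, g k
        = meanUpTo g m * ((1 - m * p / N : ℝ) : ℂ) := by
      unfold meanUpTo; push_cast; field_simp
    have h3 : 0 ≤ 1 - (m : ℝ) * p / N := sub_nonneg.2 (div_le_one_of_le₀ hmp hN0.le)
    rw [e, norm_mul, Complex.norm_real, Real.norm_of_nonneg h3]
    refine (mul_le_of_le_one_left h3 (norm_meanUpTo_le hg m)).trans ?_
    rw [sub_le_iff_le_add, ← sub_le_iff_le_add', le_div_iff₀ hN0]
    nlinarith
  calc _ = ‖(meanUpTo g n - meanUpTo g m) + (meanUpTo g m - p / N * ∑ k ∈ Ioc 0 m, g k)‖ := by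
        congr 1; ring
    _ ≤ _ := (norm_add_le _ _).trans (by linarith)

/-- `g` does not pretend to be `n ↦ n ^ (i t)` for any real `t`. -/
def NonPretentious (g : ℕ → ℂ) : Prop :=
  ∀ t D : ℝ, ∃ P : Finset ℕ, (∀ p ∈ P, p.Prime) ∧
    D ≤ ∑ p ∈ P, (1 / p : ℝ) * ‖1 - g p * Complex.exp (-(t * Real.log p : ℝ) * Complex.I)‖ ^ 2

theorem NonPretentious.exists_uniform {g : ℕ → ℂ} (h : NonPretentious g) (T D : ℝ) :
    ∃ P : Finset ℕ, (∀ p ∈ P, p.Prime) ∧ ∀ t : ℝ, |t| ≤ T →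
      D ≤ ∑ p ∈ P, (1 / p : ℝ) * ‖1 - g p * Complex.exp (-(t * Real.log p : ℝ) * Complex.I)‖ ^ 2 := by
  classical
  set F : Finset ℕ → ℝ → ℝ := fun P t =>
    ∑ p ∈ P, (1 / p : ℝ) * ‖1 - g p * Complex.exp (-(t * Real.log p : ℝ) * Complex.I)‖ ^ 2 with hF
  have hcont : ∀ P, Continuous (F P) := fun P => by
    simp only [hF]; fun_prop
  have hmono : ∀ {P Q : Finset ℕ}, P ⊆ Q → ∀ t, F P t ≤ F Q t := fun hPQ t =>
    sum_le_sum_of_subset_of_nonneg hPQ fun _ _ _ => by positivity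
  set U : {P : Finset ℕ // ∀ p ∈ P, p.Prime} → Set ℝ := fun P => {t | D < F P.1 t} with hU
  have : Nonempty {P : Finset ℕ // ∀ p ∈ P, p.Prime} := ⟨⟨∅, by simp⟩⟩
  obtain ⟨P, hP⟩ := (isCompact_Icc (a := -T) (b := T)).elim_directed_cover U
    (fun P => isOpen_lt continuous_const (hcont P.1))
    (fun t _ => by
      obtain ⟨P, hP, hD⟩ := h t (D + 1)
      exact Set.mem_iUnion.2 ⟨⟨P, hP⟩, by simp only [hU, Set.mem_ofPred_eq]; exact (lt_add_one D).trans_le hD⟩)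
    (fun P Q => ⟨⟨P.1 ∪ Q.1, fun p hp => (mem_union.1 hp).elim (P.2 p) (Q.2 p)⟩,
      fun t ht => lt_of_lt_of_le ht (hmono subset_union_left t),
      fun t ht => lt_of_lt_of_le ht (hmono subset_union_right t)⟩)
  exact ⟨P.1, P.2, fun t ht => (hP (abs_le.1 ht)).le⟩

theorem sum_norm_sq_sub_shift_le {K : ℕ} [NeZero K] {s : ZMod K → ℂ} (hs : ∀ k, ‖s k‖ ≤ 1) {ζ : ℂ}
    (hζ : ‖ζ‖ ≤ 1) {h : ℕ} {c : ZMod K → ℝ} (hc0 : ∀ k, 0 ≤ c k)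
    (hc : ∀ k : ZMod K, h ≤ k.val → ‖s k - ζ * s (k - h)‖ ^ 2 ≤ c k) :
    ∑ k, ‖s k - ζ * s (k - h)‖ ^ 2 ≤ ∑ k, c k + 4 * h := by
  have h1 : ∀ k : ZMod K, ‖s k - ζ * s (k - h)‖ ^ 2 ≤ c k + 4 * (if k.val < h then 1 else 0) := by
    intro k
    split_ifs with hk
    · have : ‖s k - ζ * s (k - h)‖ ≤ 2 := by
        refine (norm_sub_le _ _).trans ?_
        rw [norm_mul]
        have := hs k
        have := mul_le_one₀ hζ (norm_nonneg _) (hs (k - h))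
        linarith
      have := hc0 k
      nlinarith [norm_nonneg (s k - ζ * s (k - h))]
    · rw [mul_zero, add_zero]; exact hc k (not_lt.1 hk)
  refine (sum_le_sum fun k _ => h1 k).trans ?_
  rw [sum_add_distrib, ← mul_sum]
  gcongr
  rw [sum_boole]
  have : #{k : ZMod K | k.val < h} ≤ #(range h) :=
    card_le_card_of_injOn ZMod.val (fun k hk => by simpa using hk) (ZMod.val_injective K).injOn
  rw [card_range] at this
  exact_mod_cast this

theorem zmod_val_sub_natCast {K : ℕ} [NeZero K] {k : ZMod K} {h : ℕ} (hk : h ≤ k.val) :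
    (k - (h : ZMod K)).val = k.val - h := by
  have : k - (h : ZMod K) = ((k.val - h : ℕ) : ZMod K) := by
    rw [Nat.cast_sub hk, ZMod.natCast_zmod_val]
  rw [this, ZMod.val_natCast, Nat.mod_eq_of_lt ((Nat.sub_le _ _).trans_lt (ZMod.val_lt k))]

theorem sum_zmod_of_neZero {K : ℕ} [NeZero K] (h : ℕ → ℝ) : ∑ x : ZMod K, h x.val = ∑ n ∈ range K, h n := by
  refine sum_nbij' ZMod.val (fun n => (n : ZMod K)) (fun x _ => ?_) (fun _ _ => mem_univ _)
    (fun x _ => ?_) (fun n hn => ?_) fun _ _ => rfl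
  · exact mem_range.2 (ZMod.val_lt x)
  · exact ZMod.natCast_zmod_val x
  · exact ZMod.val_cast_of_lt (mem_range.1 hn)

theorem sq_le_two_mul_sq_add {a b c : ℝ} (ha : 0 ≤ a) (h : a ≤ b + c) :
    a ^ 2 ≤ 2 * b ^ 2 + 2 * c ^ 2 := by
  nlinarith [sq_nonneg (b - c)]

set_option maxHeartbeats 1600000 in
theorem exists_geomSample_mean_sq_le {g : ℕ → ℂ} (hmult : ∀ m n, g (m * n) = g m * g n)
    (hg : ∀ n, ‖g n‖ ≤ 1) (hnp : NonPretentious g) {ε : ℝ} (hε : 0 < ε) (hε1 : ε ≤ 1) :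
    ∃ η : ℝ, 0 < η ∧ η ≤ ε ∧ ∃ k₀ K₀ : ℕ, ∀ K ≥ K₀,
      ∑ k ∈ range K, ‖meanUpTo g (geomSample η (k₀ + k))‖ ^ 2 ≤ ε * K := by
  set θ : ℝ := ε / 10 with hθ
  have hθ0 : 0 < θ := by positivity
  have hθ1 : θ ≤ 1 / 10 := by rw [hθ]; linarith
  set D : ℝ := 40 / ε with hD
  have hD0 : 0 < D := by positivity
  set T : ℝ := 2 * Real.pi / θ with hT
  obtain ⟨P, hP, hPD⟩ := hnp.exists_uniform T (2 * (D + 1))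
  set σ : ℝ := ∑ p ∈ P, (1 / p : ℝ) with hσ
  have hσ0 : 0 ≤ σ := sum_nonneg fun _ _ => by positivity
  have hT0 : 0 ≤ T := by have := Real.pi_pos; positivity
  obtain ⟨H, hH⟩ := exists_nat_gt (θ * (T + 20) * (σ + 1))
  have hHpos : (0 : ℝ) < H := lt_of_le_of_lt (by positivity) hH
  have hH0 : 0 < H := by exact_mod_cast hHpos
  have hH1 : (1 : ℝ) ≤ H := by exact_mod_cast hH0
  set η : ℝ := θ / H with hη
  have hη0 : 0 < η := by positivity
  have hηH : η * H = θ := by rw [hη]; field_simp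
  have hηθ : η ≤ θ := div_le_self hθ0.le hH1
  have hη1 : η ≤ 1 := by linarith
  have hηT : η * (T + 20) * (σ + 1) ≤ 1 := by
    have : η * (T + 20) * (σ + 1) = θ * (T + 20) * (σ + 1) / H := by rw [hη]; ring
    rw [this, div_le_one hHpos]; exact hH.le
  have hηTσ : (η * T) ^ 2 * σ ≤ 1 := by
    have h1 : η * T * σ ≤ 1 := le_trans (by gcongr <;> linarith) hηT
    have h3 : 0 ≤ η * T := by positivity
    have h4 := mul_nonneg h3 hσ0
    have h2 : η * T ≤ 1 := by
      have := mul_nonneg hη0.le hσ0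
      have e : η * (T + 20) * (σ + 1) = η * T * σ + η * T + 20 * (η * σ) + 20 * η := by ring
      linarith
    calc (η * T) ^ 2 * σ = (η * T) * (η * T * σ) := by ring
      _ ≤ 1 * 1 := mul_le_mul h2 h1 h4 zero_le_one
      _ = 1 := one_mul 1
  have hησ : 2 * (12 * η) ^ 2 * σ ≤ 1 := by
    have h1 : η * 20 * (σ + 1) ≤ 1 := le_trans (by gcongr; linarith) hηT
    have h4 := mul_nonneg hη0.le hσ0
    have h2 : η * 20 * σ ≤ 1 := by linarith
    have h3 : η * 20 ≤ 1 := by linarith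
    calc 2 * (12 * η) ^ 2 * σ ≤ (η * 20) * (η * 20 * σ) := by
          have := mul_nonneg hη0.le h4
          linarith
      _ ≤ 1 * 1 := mul_le_mul h3 h2 (by positivity) zero_le_one
      _ = 1 := one_mul 1
  set m : ℕ → ℕ := fun p => ⌊Real.log p / η⌋₊ with hm
  have hm1 : ∀ p ∈ P, η * m p ≤ Real.log p := fun p hp => by
    have h1 : 0 ≤ Real.log p / η := div_nonneg (Real.log_natCast_nonneg p) hη0.le
    have := Nat.floor_le h1
    rw [le_div_iff₀ hη0] at this
    linarith
  have hm2 : ∀ p ∈ P, Real.log p ≤ η * m p + η := fun p hp => by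
    have := (Nat.lt_floor_add_one (Real.log p / η)).le
    rw [div_le_iff₀ hη0] at this
    linarith
  obtain ⟨k₀, hk₀⟩ := exists_nat_gt ((4 * ∑ p ∈ P, (p : ℝ) + 4) / η / η)
  have hexp : ∀ j ≥ k₀, 4 * ∑ p ∈ P, (p : ℝ) + 4 ≤ η * Real.exp (η * j) := by
    intro j hj
    have h1 : (k₀ : ℝ) ≤ j := by exact_mod_cast hj
    have h2 := Real.add_one_le_exp (η * j)
    rw [div_lt_iff₀ hη0, div_lt_iff₀ hη0] at hk₀
    have h3 := mul_le_mul_of_nonneg_left h2 hη0.le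
    have h4 := mul_le_mul_of_nonneg_left h1 (mul_nonneg hη0.le hη0.le)
    linarith
  have hsum0 : 0 ≤ ∑ p ∈ P, (p : ℝ) := sum_nonneg fun _ _ => by positivity
  obtain ⟨K₀, hK₀⟩ := exists_nat_gt (4 * ∑ p ∈ P, (1 / p : ℝ) * m p + 4 * H / θ ^ 2)
  refine ⟨η, hη0, by linarith, k₀, K₀ + 1, fun K hK => ?_⟩
  have : NeZero K := ⟨by omega⟩
  have hKK : (K₀ : ℝ) ≤ K := by exact_mod_cast (by omega : K₀ ≤ K)
  have hsm0 : 0 ≤ ∑ p ∈ P, (1 / p : ℝ) * m p := sum_nonneg fun _ _ => by positivity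
  have hHθ : 0 ≤ 4 * (H : ℝ) / θ ^ 2 := by positivity
  set s : ZMod K → ℂ := fun k => meanUpTo g (geomSample η (k₀ + k.val)) with hs
  have hs1 : ∀ k, ‖s k‖ ≤ 1 := fun k => norm_meanUpTo_le hg _
  have hlow : ∑ p ∈ P, (1 / p : ℝ) * ∑ k, ‖s k - g p * s (k - m p)‖ ^ 2 ≤ 10 * K := by
    set b : ℕ → ZMod K → ℝ := fun p k => 2 * ‖meanUpTo g (geomSample η (k₀ + k.val)) -
      g p * (p / geomSample η (k₀ + k.val) *
        ∑ n ∈ Ioc 0 (geomSample η (k₀ + k.val) / p), g n)‖ ^ 2 + 2 * (12 * η) ^ 2 with hb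
    have h1 : ∀ p ∈ P, ∑ k, ‖s k - g p * s (k - m p)‖ ^ 2 ≤ ∑ k, b p k + 4 * m p := by
      intro p hp
      refine sum_norm_sq_sub_shift_le hs1 (hg p) (fun k => by positivity) fun k hk => ?_
      simp only [hs, hb]
      rw [zmod_val_sub_natCast hk, ← Nat.add_sub_assoc hk]
      have hpP : (p : ℝ) ≤ ∑ p ∈ P, (p : ℝ) :=
        single_le_sum (f := fun p : ℕ => (p : ℝ)) (fun _ _ => Nat.cast_nonneg _) hp
      have h2 := norm_meanUpTo_sub_dilate_le hg hη0 hη1 (hP p hp).pos (j := k₀ + k.val)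
        (h := m p) (by omega) (hm1 p hp) (hm2 p hp) (by
          have := hexp (k₀ + k.val) (by omega); linarith)
      set x := meanUpTo g (geomSample η (k₀ + k.val))
      set y := meanUpTo g (geomSample η (k₀ + k.val - m p))
      set z := (p : ℂ) / geomSample η (k₀ + k.val) *
        ∑ n ∈ Ioc 0 (geomSample η (k₀ + k.val) / p), g n
      have h3 : ‖x - g p * y‖ ≤ ‖x - g p * z‖ + 12 * η := by
        calc _ = ‖(x - g p * z) - g p * (y - z)‖ := by congr 1; ring
          _ ≤ ‖x - g p * z‖ + ‖g p * (y - z)‖ := norm_sub_le _ _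
          _ ≤ _ := by
            rw [norm_mul]
            have := mul_le_mul (hg p) h2 (norm_nonneg _) zero_le_one
            linarith
      exact sq_le_two_mul_sq_add (norm_nonneg _) h3
    have h2 : ∀ k, ∑ p ∈ P, (1 / p : ℝ) * b p k ≤ 9 := by
      intro k
      simp only [hb, mul_add, sum_add_distrib]
      rw [← sum_mul]
      have hbig := lt_geomSample_add_one η (k₀ + k.val)
      have hbig' := hexp (k₀ + k.val) (by omega)
      have hN : ∑ p ∈ P, p ≤ geomSample η (k₀ + k.val) := by
        have : ((∑ p ∈ P, p : ℕ) : ℝ) ≤ geomSample η (k₀ + k.val) := by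
          push_cast
          have := mul_le_of_le_one_left (Real.exp_pos (η * ((k₀ + k.val : ℕ) : ℝ))).le hη1
          linarith
        exact_mod_cast this
      have := turan_kubilius_dual_mean hmult hg P hP (geomSample_pos hη0.le (k₀ + k.val)) hN
      have e : ∀ p ∈ P, (1 / p : ℝ) * (2 * ‖meanUpTo g (geomSample η (k₀ + k.val)) -
        g p * (p / geomSample η (k₀ + k.val) *
        ∑ n ∈ Ioc 0 (geomSample η (k₀ + k.val) / p), g n)‖ ^ 2)
        = 2 * ((1 / p : ℝ) * ‖meanUpTo g (geomSample η (k₀ + k.val)) -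
        g p * (p / geomSample η (k₀ + k.val) *
        ∑ n ∈ Ioc 0 (geomSample η (k₀ + k.val) / p), g n)‖ ^ 2) := fun p _ => by ring
      rw [sum_congr rfl e, ← mul_sum]
      linarith
    calc _ ≤ ∑ p ∈ P, (1 / p : ℝ) * (∑ k, b p k + 4 * m p) :=
          sum_le_sum fun p hp => mul_le_mul_of_nonneg_left (h1 p hp) (by positivity)
      _ = ∑ k, ∑ p ∈ P, (1 / p : ℝ) * b p k + 4 * ∑ p ∈ P, (1 / p : ℝ) * m p := by
          simp only [mul_add, sum_add_distrib, mul_sum]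
          rw [sum_comm]
          congr 1
          exact sum_congr rfl fun p _ => by ring
      _ ≤ ∑ _k : ZMod K, (9 : ℝ) + K := by
          gcongr with k
          · exact h2 k
          · linarith
      _ = 10 * K := by simp [ZMod.card]; ring
  have hhigh : ∑ h ∈ range H, ∑ k, ‖s k - s (k - h)‖ ^ 2 ≤ H * (37 * θ ^ 2 * K) := by
    have h1 : ∀ h ∈ range H, ∑ k, ‖s k - s (k - h)‖ ^ 2 ≤ 37 * θ ^ 2 * K := by
      intro h hh
      have hhH : (h : ℝ) ≤ H := by exact_mod_cast (mem_range.1 hh).le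
      have h2 := sum_norm_sq_sub_shift_le hs1 (ζ := 1) (h := h) (by simp)
        (c := fun _ => (6 * θ) ^ 2) (fun _ => by positivity) (fun k hk => by
          rw [one_mul]
          simp only [hs]
          rw [zmod_val_sub_natCast hk, ← Nat.add_sub_assoc hk]
          have h3 := norm_meanUpTo_geomSample_sub_le hg hη0.le (θ := θ) (j := k₀ + k.val) (h := h)
            (by omega) (by rw [← hηH]; gcongr) (by
              have := hexp (k₀ + k.val) (by omega)
              have := mul_le_mul_of_nonneg_right hηθ (Real.exp_pos (η * ((k₀ + k.val : ℕ) : ℝ))).le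
              linarith)
          gcongr)
      simp only [one_mul, sum_const, card_univ, ZMod.card, nsmul_eq_mul] at h2
      refine h2.trans ?_
      have h5 : (K : ℝ) * (6 * θ) ^ 2 = 36 * (θ ^ 2 * K) := by ring
      have h4 : 4 * (H : ℝ) ≤ θ ^ 2 * K := by
        have : 4 * (H : ℝ) / θ ^ 2 ≤ K := by linarith
        rw [div_le_iff₀ (by positivity)] at this
        linarith
      linarith
    refine (sum_le_sum h1).trans ?_
    rw [sum_const, card_range, nsmul_eq_mul]
  have hfreq : ∀ ξ : ZMod K, H * |(ξ.valMinAbs : ℝ)| ≤ K →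
      D ≤ ∑ p ∈ P, (1 / p : ℝ) * ‖1 - g p * Complex.exp (-(m p * freq ξ : ℝ) * Complex.I)‖ ^ 2 := by
    intro ξ hξ
    have hK0 : (0 : ℝ) < K := by exact_mod_cast Nat.pos_of_ne_zero (NeZero.ne K)
    set t : ℝ := freq ξ / η with ht
    have htη : freq ξ = η * t := by rw [ht]; field_simp
    have htT : |t| ≤ T := by
      rw [ht, freq, abs_div, abs_div, abs_mul, abs_mul, abs_two, abs_of_pos Real.pi_pos,
        abs_of_pos hK0, abs_of_pos hη0, hT, div_div, div_le_div_iff₀ (by positivity) hθ0, ← hηH]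
      have := Real.pi_pos
      have := mul_le_mul_of_nonneg_left hξ (by positivity : 0 ≤ 2 * Real.pi * η)
      linarith
    have h1 := hPD t htT
    have h2 : ∀ p ∈ P, (1 / p : ℝ) * ‖1 - g p * Complex.exp (-(t * Real.log p : ℝ) * Complex.I)‖ ^ 2
        ≤ 2 * ((1 / p : ℝ) * ‖1 - g p * Complex.exp (-(m p * freq ξ : ℝ) * Complex.I)‖ ^ 2)
          + 2 * ((η * T) ^ 2 * (1 / p : ℝ)) := by
      intro p hp
      set u := Complex.exp (-(t * Real.log p : ℝ) * Complex.I)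
      set v := Complex.exp (-(m p * freq ξ : ℝ) * Complex.I)
      have huv : ‖v - u‖ ≤ η * T := by
        have e : v = u * Complex.exp (Complex.I * ((t * (Real.log p - η * m p) : ℝ) : ℂ)) := by
          simp only [u, v]
          rw [← Complex.exp_add, htη]
          congr 1; push_cast; ring
        have hu : ‖u‖ = 1 := by
          simp only [u]
          rw [← Complex.ofReal_neg, Complex.norm_exp_ofReal_mul_I]
        have e2 : v - u = u * (Complex.exp (Complex.I * ((t * (Real.log p - η * m p) : ℝ) : ℂ)) - 1) := by
          rw [e]; ring
        rw [e2, norm_mul, hu, one_mul]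
        refine (Real.norm_exp_I_mul_ofReal_sub_one_le).trans ?_
        rw [Real.norm_eq_abs, abs_mul]
        have h5 := hm1 p hp
        have h6 := hm2 p hp
        exact (mul_le_mul htT (abs_le.2 ⟨by linarith, by linarith⟩) (abs_nonneg _) hT0).trans_eq
          (mul_comm _ _)
      have h3 : ‖1 - g p * u‖ ≤ ‖1 - g p * v‖ + η * T := by
        calc _ = ‖(1 - g p * v) + g p * (v - u)‖ := by congr 1; ring
          _ ≤ ‖1 - g p * v‖ + ‖g p * (v - u)‖ := norm_add_le _ _
          _ ≤ _ := by
            rw [norm_mul]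
            have := mul_le_mul (hg p) huv (norm_nonneg _) zero_le_one
            linarith
      have h4 : ‖1 - g p * u‖ ^ 2 ≤ 2 * ‖1 - g p * v‖ ^ 2 + 2 * (η * T) ^ 2 := by
        exact sq_le_two_mul_sq_add (norm_nonneg _) h3
      calc _ ≤ (1 / p : ℝ) * (2 * ‖1 - g p * v‖ ^ 2 + 2 * (η * T) ^ 2) := by gcongr
        _ = _ := by ring
    have h3 := h1.trans (sum_le_sum h2)
    rw [sum_add_distrib, ← mul_sum, ← mul_sum, ← mul_sum] at h3
    linarith
  have key := sum_norm_sq_le_of_spectral P (w := fun p => (1 / p : ℝ)) (fun _ _ => by positivity)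
    g m hD0 hH0 s hlow hhigh hfreq
  have e : ∑ k ∈ range K, ‖meanUpTo g (geomSample η (k₀ + k))‖ ^ 2 = ∑ k, ‖s k‖ ^ 2 :=
    (sum_zmod_of_neZero fun k => ‖meanUpTo g (geomSample η (k₀ + k))‖ ^ 2).symm
  rw [e]
  refine key.trans ?_
  have h1 : 10 * (K : ℝ) / D = ε / 4 * K := by rw [hD, div_div_eq_mul_div]; ring
  have h2 : 37 * θ ^ 2 ≤ ε / 2 := by
    have e : 37 * θ ^ 2 = 37 / 100 * (ε * ε) := by rw [hθ]; ring
    have := mul_le_mul_of_nonneg_left hε1 hε.le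
    linarith
  have := mul_le_mul_of_nonneg_right h2 (Nat.cast_nonneg K : (0 : ℝ) ≤ K)
  have := mul_nonneg hε.le (Nat.cast_nonneg K : (0 : ℝ) ≤ K)
  rw [h1]
  linarith

theorem geomSample_succ_sub_le {η : ℝ} (hη : 0 < η) (hη1 : η ≤ 1) {j : ℕ}
    (hj : 4 ≤ η * Real.exp (η * j)) :
    (geomSample η (j + 1) : ℝ) - geomSample η j ≤ 3 * η * geomSample η j := by
  have h1 : (geomSample η (j + 1) : ℝ) ≤ Real.exp (η * (j + 1 : ℕ)) := geomSample_le η (j + 1)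
  have h2 := lt_geomSample_add_one η j
  set E := Real.exp (η * j) with hE
  have hE0 : 0 < E := Real.exp_pos _
  have h3 : Real.exp (η * (j + 1 : ℕ)) = E * Real.exp η := by
    rw [hE, ← Real.exp_add]; congr 1; push_cast; ring
  have h4 : Real.exp η ≤ 1 + 2 * η := by
    have := Real.abs_exp_sub_one_le (x := η) (by rw [abs_of_pos hη]; exact hη1)
    rw [abs_of_pos hη] at this
    linarith [(abs_le.1 this).2]
  have h5 : E * Real.exp η ≤ E * (1 + 2 * η) := by gcongr
  have h6 : η * E ≤ E := mul_le_of_le_one_left hE0.le hη1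
  rw [h3] at h1
  nlinarith

theorem sum_norm_meanUpTo_block_le {g : ℕ → ℂ} (hg : ∀ n, ‖g n‖ ≤ 1) {η : ℝ} (hη : 0 < η)
    (hη1 : η ≤ 1) {j : ℕ} (hj : 4 ≤ η * Real.exp (η * j)) :
    ∑ m ∈ Ioc (geomSample η j) (geomSample η (j + 1)), ‖meanUpTo g m‖ / m
      ≤ 3 * η * (‖meanUpTo g (geomSample η j)‖ + 6 * η) := by
  have hx := geomSample_succ_sub_le hη hη1 hj
  have hpos : 0 < geomSample η j := geomSample_pos hη.le j
  have hmono : geomSample η j ≤ geomSample η (j + 1) := geomSample_mono hη.le (Nat.le_succ j)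
  set x := geomSample η j
  set y := geomSample η (j + 1)
  have hx0 : (0 : ℝ) < x := by exact_mod_cast hpos
  have hterm : ∀ m ∈ Ioc x y, ‖meanUpTo g m‖ / m ≤ (‖meanUpTo g x‖ + 6 * η) / x := by
    intro m hm
    rw [mem_Ioc] at hm
    have hxm : (x : ℝ) ≤ m := by exact_mod_cast hm.1.le
    have hmy : (m : ℝ) ≤ y := by exact_mod_cast hm.2
    have h1 := norm_meanUpTo_sub_le hg (m := x) (n := m) hpos hm.1.le
    have h2 : 2 * ((m : ℝ) - x) / m ≤ 6 * η := by
      rw [div_le_iff₀ (hx0.trans_le hxm)]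
      have : 3 * η * x ≤ 3 * η * m := by gcongr
      linarith
    have h3 := norm_sub_norm_le (meanUpTo g m) (meanUpTo g x)
    gcongr
    linarith
  refine (sum_le_sum hterm).trans ?_
  rw [sum_const, Nat.card_Ioc, nsmul_eq_mul, Nat.cast_sub hmono, mul_div_assoc', div_le_iff₀ hx0]
  have : 0 ≤ ‖meanUpTo g x‖ + 6 * η := by positivity
  calc _ ≤ (3 * η * x) * (‖meanUpTo g x‖ + 6 * η) := by gcongr
    _ = _ := by ring

theorem sum_norm_meanUpTo_div_le {g : ℕ → ℂ} (hmult : ∀ m n, g (m * n) = g m * g n)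
    (hg : ∀ n, ‖g n‖ ≤ 1) (hnp : NonPretentious g) {ε : ℝ} (hε : 0 < ε) :
    ∃ C : ℝ, 0 ≤ C ∧ ∀ X : ℕ, 1 ≤ X →
      ∑ m ∈ Ioc 0 X, ‖meanUpTo g m‖ / m ≤ C + ε * Real.log X := by
  set κ : ℝ := min 1 (ε / 21) with hκ
  have hκ0 : 0 < κ := by positivity
  have hκ1 : κ ≤ 1 := min_le_left _ _
  have hκε : 21 * κ ≤ ε := by have := min_le_right 1 (ε / 21); linarith
  obtain ⟨η, hη0, hηκ, k₀, K₀, hK⟩ := exists_geomSample_mean_sq_le hmult hg hnp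
    (ε := κ ^ 2) (by positivity) (pow_le_one₀ hκ0.le hκ1)
  have hηκ' : η ≤ κ := hηκ.trans (by rw [pow_two]; exact mul_le_of_le_one_left hκ0.le hκ1)
  have hη1 : η ≤ 1 := hηκ'.trans hκ1
  obtain ⟨k₁, hk₁⟩ := exists_nat_gt (4 / η / η)
  have hexp : ∀ j ≥ k₁, 4 ≤ η * Real.exp (η * j) := by
    intro j hj
    have h1 : (k₁ : ℝ) ≤ j := by exact_mod_cast hj
    have h2 := Real.add_one_le_exp (η * j)
    rw [div_lt_iff₀ hη0, div_lt_iff₀ hη0] at hk₁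
    have h3 := mul_le_mul_of_nonneg_left h2 hη0.le
    have h4 := mul_le_mul_of_nonneg_left h1 (mul_nonneg hη0.le hη0.le)
    linarith
  set a : ℕ := k₀ + k₁ with ha
  set C₀ : ℝ := ∑ m ∈ Ioc 0 (geomSample η a), ‖meanUpTo g m‖ / m with hC₀
  have hC₀0 : 0 ≤ C₀ := sum_nonneg fun _ _ => by positivity
  have hblocks : ∀ J, ∑ m ∈ Ioc 0 (geomSample η (a + J)), ‖meanUpTo g m‖ / m
      ≤ C₀ + ∑ k ∈ range J, 3 * η * (‖meanUpTo g (geomSample η (a + k))‖ + 6 * η) := by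
    intro J
    induction J with
    | zero => simp [hC₀]
    | succ J ih =>
      rw [← add_assoc, ← sum_Ioc_consecutive _ (Nat.zero_le _)
        (geomSample_mono hη0.le (Nat.le_succ (a + J))), sum_range_succ, ← add_assoc]
      exact add_le_add ih (sum_norm_meanUpTo_block_le hg hη0 hη1 (hexp _ (by omega)))
  have hmean : ∀ J ≥ K₀, ∑ k ∈ range J, ‖meanUpTo g (geomSample η (a + k))‖ ≤ κ * (k₁ + J : ℕ) := by
    intro J hJ
    have h1 := hK (k₁ + J) (by omega)
    have h2 : ∑ k ∈ range (k₁ + J), ‖meanUpTo g (geomSample η (k₀ + k))‖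
        ≤ ∑ k ∈ range (k₁ + J), (κ / 2 + ‖meanUpTo g (geomSample η (k₀ + k))‖ ^ 2 / (2 * κ)) := by
      refine sum_le_sum fun k _ => ?_
      set u := ‖meanUpTo g (geomSample η (k₀ + k))‖
      have e : κ / 2 + u ^ 2 / (2 * κ) - u = (u - κ) ^ 2 / (2 * κ) := by field_simp; ring
      have : 0 ≤ (u - κ) ^ 2 / (2 * κ) := by positivity
      linarith
    rw [sum_add_distrib, sum_const, card_range, nsmul_eq_mul, ← sum_div] at h2
    have h3 : (∑ k ∈ range (k₁ + J), ‖meanUpTo g (geomSample η (k₀ + k))‖ ^ 2) / (2 * κ)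
        ≤ κ / 2 * (k₁ + J : ℕ) := by
      rw [div_le_iff₀ (by positivity)]
      calc _ ≤ _ := h1
        _ = _ := by ring
    rw [sum_range_add] at h2
    have h4 : 0 ≤ ∑ k ∈ range k₁, ‖meanUpTo g (geomSample η (k₀ + k))‖ :=
      sum_nonneg fun _ _ => norm_nonneg _
    simp only [← add_assoc, ← ha] at h2
    linarith
  set B : ℝ := 21 * η * κ * (k₁ + K₀ + 1) with hB
  refine ⟨C₀ + B, by positivity, fun X hX => ?_⟩
  have hX' : (0 : ℝ) < X := by exact_mod_cast hX
  have hlog : 0 ≤ Real.log X := Real.log_natCast_nonneg X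
  set J : ℕ := ⌈Real.log X / η⌉₊ + K₀ with hJ
  have hJ1 : (J : ℝ) ≤ Real.log X / η + 1 + K₀ := by
    have := (Nat.ceil_lt_add_one (div_nonneg hlog hη0.le)).le
    rw [hJ]; push_cast; linarith
  have hXJ : X ≤ geomSample η (a + J) := by
    refine Nat.le_floor ?_
    rw [← Real.exp_log hX']
    refine Real.exp_le_exp.2 ?_
    have h1 := Nat.le_ceil (Real.log X / η)
    rw [div_le_iff₀ hη0] at h1
    have h2 : ((⌈Real.log X / η⌉₊ : ℕ) : ℝ) ≤ (a + J : ℕ) := by exact_mod_cast (by omega)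
    have := mul_le_mul_of_nonneg_left h2 hη0.le
    linarith
  have h1 : ∑ m ∈ Ioc 0 X, ‖meanUpTo g m‖ / m
      ≤ ∑ m ∈ Ioc 0 (geomSample η (a + J)), ‖meanUpTo g m‖ / m :=
    sum_le_sum_of_subset_of_nonneg (Ioc_subset_Ioc_right hXJ) fun _ _ _ => by positivity
  refine h1.trans ((hblocks J).trans ?_)
  rw [← mul_sum, sum_add_distrib, sum_const, card_range, nsmul_eq_mul]
  have h2 := hmean J (by omega)
  push_cast at h2
  have h3 : 6 * η * J ≤ 6 * κ * (k₁ + J) := by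
    have : (J : ℝ) ≤ k₁ + J := by linarith [(Nat.cast_nonneg k₁ : (0:ℝ) ≤ k₁)]
    gcongr
  have h4 : 3 * η * (∑ k ∈ range J, ‖meanUpTo g (geomSample η (a + k))‖ + J * (6 * η))
      ≤ 3 * η * (7 * κ * (k₁ + J)) := by
    gcongr; linarith
  have h5 : 3 * η * (7 * κ * (k₁ + J)) ≤ 3 * η * (7 * κ * (k₁ + (Real.log X / η + 1 + K₀))) := by
    gcongr
  have h6 : 3 * η * (7 * κ * (k₁ + (Real.log X / η + 1 + K₀))) = B + 21 * κ * Real.log X := by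
    rw [hB]; field_simp; ring
  have h7 := mul_le_mul_of_nonneg_right hκε hlog
  linarith

theorem sum_log_sub_log_le (x : ℕ) : ∑ n ∈ Ioc 0 x, (Real.log x - Real.log n) ≤ x := by
  rcases Nat.eq_zero_or_pos x with rfl | hx
  · simp
  have h1 : ∀ y : ℕ, ∑ n ∈ Ioc 0 y, Real.log n = Real.log y.factorial := by
    intro y
    induction y with
    | zero => simp
    | succ y ih =>
      rw [sum_Ioc_succ_top (Nat.zero_le y), ih, Nat.factorial_succ, Nat.cast_mul,
        Real.log_mul (by positivity) (by positivity), add_comm]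
  have hx' : (0 : ℝ) < x := by exact_mod_cast hx
  have h2 := Real.pow_div_factorial_le_exp (x : ℝ) hx'.le x
  have h3 := Real.log_le_log (by positivity) h2
  rw [Real.log_exp, Real.log_div (by positivity) (by positivity), Real.log_pow] at h3
  rw [sum_sub_distrib, h1, sum_const, Nat.card_Ioc, nsmul_eq_mul, Nat.sub_zero]
  exact h3

theorem sum_mul_log_eq {g : ℕ → ℂ} (hmult : ∀ m n, g (m * n) = g m * g n) (x : ℕ) :
    ∑ n ∈ Ioc 0 x, g n * (Real.log n : ℂ)
      = ∑ d ∈ Ioc 0 x, (ArithmeticFunction.vonMangoldt d : ℂ) * (g d * ∑ n ∈ Ioc 0 (x / d), g n) := by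
  have h1 : ∀ n ∈ Ioc 0 x, g n * (Real.log n : ℂ)
      = ∑ d ∈ Ioc 0 x, (ArithmeticFunction.vonMangoldt d : ℂ) * (if d ∣ n then g n else 0) := by
    intro n hn
    rw [mem_Ioc] at hn
    rw [← ArithmeticFunction.vonMangoldt_sum]
    push_cast
    rw [mul_sum]
    have e : n.divisors = (Ioc 0 x).filter (fun d => d ∣ n) := by
      ext d
      simp only [Nat.mem_divisors, mem_filter, mem_Ioc]
      constructor
      · rintro ⟨h, h0⟩
        exact ⟨⟨Nat.pos_of_dvd_of_pos h hn.1, (Nat.le_of_dvd hn.1 h).trans hn.2⟩, h⟩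
      · rintro ⟨_, h⟩
        exact ⟨h, hn.1.ne'⟩
    rw [e, sum_filter]
    refine sum_congr rfl fun d _ => ?_
    split_ifs
    · ring
    · simp
  rw [sum_congr rfl h1, sum_comm]
  refine sum_congr rfl fun d hd => ?_
  rw [← mul_sum, sum_dvd_completely_multiplicative hmult (mem_Ioc.1 hd).1]

theorem norm_sum_mul_log_le {g : ℕ → ℂ} (hmult : ∀ m n, g (m * n) = g m * g n)
    (hg : ∀ n, ‖g n‖ ≤ 1) (x : ℕ) :
    ‖∑ n ∈ Ioc 0 x, g n‖ * Real.log x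
      ≤ x + ∑ d ∈ Ioc 0 x, ArithmeticFunction.vonMangoldt d * ‖∑ n ∈ Ioc 0 (x / d), g n‖ := by
  have e : (∑ n ∈ Ioc 0 x, g n) * (Real.log x : ℂ)
      = ∑ n ∈ Ioc 0 x, g n * ((Real.log x - Real.log n : ℝ) : ℂ)
        + ∑ n ∈ Ioc 0 x, g n * (Real.log n : ℂ) := by
    rw [← sum_add_distrib, sum_mul]
    refine sum_congr rfl fun n _ => ?_
    push_cast; ring
  have h1 : ‖(∑ n ∈ Ioc 0 x, g n) * (Real.log x : ℂ)‖ = ‖∑ n ∈ Ioc 0 x, g n‖ * Real.log x := by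
    rw [norm_mul, Complex.norm_real, Real.norm_of_nonneg (Real.log_natCast_nonneg x)]
  rw [← h1, e, sum_mul_log_eq hmult]
  refine (norm_add_le _ _).trans (add_le_add ?_ ?_)
  · refine ((norm_sum_le _ _).trans (sum_le_sum fun n hn => ?_)).trans (sum_log_sub_log_le x)
    rw [mem_Ioc] at hn
    have h2 : 0 ≤ Real.log x - Real.log n :=
      sub_nonneg.2 (Real.log_le_log (by exact_mod_cast hn.1) (by exact_mod_cast hn.2))
    rw [norm_mul, Complex.norm_real, Real.norm_of_nonneg h2]
    exact mul_le_of_le_one_left h2 (hg n)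
  · refine (norm_sum_le _ _).trans (sum_le_sum fun d _ => ?_)
    have h2 : 0 ≤ ArithmeticFunction.vonMangoldt d := ArithmeticFunction.vonMangoldt_nonneg
    rw [norm_mul, Complex.norm_real, Real.norm_of_nonneg h2, norm_mul]
    gcongr
    exact mul_le_of_le_one_left (norm_nonneg _) (hg d)

theorem card_filter_div_eq_le (s : Finset ℕ) {d : ℕ} (hd : 0 < d) (m : ℕ) :
    #{x ∈ s | x / d = m} ≤ d := by
  have : {x ∈ s | x / d = m} ⊆ Ico (m * d) (m * d + d) := by
    intro x hx
    rw [mem_filter] at hx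
    rw [mem_Ico, ← hx.2]
    exact ⟨Nat.div_mul_le_self x d, by
      have := Nat.lt_div_mul_add (a := x) hd; exact this⟩
  refine (card_le_card this).trans ?_
  simp

theorem sum_sum_div_le {a : ℕ → ℝ} (ha : ∀ n, 0 ≤ a n) (ha0 : a 0 = 0) {X Y : ℕ} (hY : Y ≤ X) :
    ∑ x ∈ Ioc X (X + Y), ∑ d ∈ Ioc 0 x, ArithmeticFunction.vonMangoldt d * a (x / d)
      ≤ 4 * (Real.log 4 + 4) * X ^ 2 * ∑ m ∈ Ioc 0 (2 * X), a m / m ^ 2 := by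
  set I := Ioc 0 (2 * X) with hI
  have hΛ : ∀ d, 0 ≤ ArithmeticFunction.vonMangoldt d := fun _ => ArithmeticFunction.vonMangoldt_nonneg
  have h1 : ∑ x ∈ Ioc X (X + Y), ∑ d ∈ Ioc 0 x, ArithmeticFunction.vonMangoldt d * a (x / d)
      ≤ ∑ d ∈ I, ArithmeticFunction.vonMangoldt d * ∑ x ∈ Ioc X (X + Y), a (x / d) := by
    simp_rw [mul_sum]
    rw [sum_comm (s := I)]
    refine sum_le_sum fun x hx => sum_le_sum_of_subset_of_nonneg ?_ fun d _ _ =>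
      mul_nonneg (hΛ d) (ha _)
    rw [mem_Ioc] at hx
    exact Ioc_subset_Ioc_right (by omega)
  have h2 : ∀ d ∈ I, ∑ x ∈ Ioc X (X + Y), a (x / d)
      ≤ ∑ m ∈ I, if d * m ≤ 2 * X then d * a m else 0 := by
    intro d hd
    rw [hI, mem_Ioc] at hd
    have h3 : ∀ x ∈ Ioc X (X + Y), a (x / d) = ∑ m ∈ I, if x / d = m then a m else 0 := by
      intro x hx
      rw [mem_Ioc] at hx
      rw [sum_ite_eq]
      split_ifs with hm
      · rfl
      · have : x / d = 0 := by
          by_contra h0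
          exact hm (by rw [hI, mem_Ioc]; exact ⟨Nat.pos_of_ne_zero h0, (Nat.div_le_self x d).trans (by omega)⟩)
        rw [this, ha0]
    rw [sum_congr rfl h3, sum_comm]
    refine sum_le_sum fun m _ => ?_
    split_ifs with hm
    · rw [← sum_filter, sum_const, nsmul_eq_mul]
      gcongr
      · exact ha m
      · exact card_filter_div_eq_le _ hd.1 m
    · refine (sum_eq_zero fun x hx => if_neg fun h => hm ?_).le
      rw [mem_Ioc] at hx
      rw [← h]
      exact (Nat.mul_div_le x d).trans (by omega)
  have h3 : ∀ m ∈ I, ∑ d ∈ I, ArithmeticFunction.vonMangoldt d * (if d * m ≤ 2 * X then d * a m else 0)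
      ≤ 4 * (Real.log 4 + 4) * X ^ 2 * (a m / m ^ 2) := by
    intro m hm
    rw [hI, mem_Ioc] at hm
    have hm0 : (0 : ℝ) < m := by exact_mod_cast hm.1
    set z : ℝ := 2 * X / m with hz
    have hz0 : 0 ≤ z := by positivity
    have hfloor : ⌊z⌋₊ = 2 * X / m := by
      rw [hz, show (2 * X : ℝ) / m = ((2 * X : ℕ) : ℝ) / m by push_cast; rfl, Nat.floor_div_eq_div]
    have h4 : ∑ d ∈ I, ArithmeticFunction.vonMangoldt d * (if d * m ≤ 2 * X then d * a m else 0)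
        ≤ ∑ d ∈ Ioc 0 ⌊z⌋₊, ArithmeticFunction.vonMangoldt d * (z * a m) := by
      simp_rw [mul_ite, mul_zero]
      rw [← sum_filter]
      have hsub : {d ∈ I | d * m ≤ 2 * X} ⊆ Ioc 0 ⌊z⌋₊ := by
        intro d hd
        rw [mem_filter, hI, mem_Ioc] at hd
        rw [mem_Ioc, hfloor, Nat.le_div_iff_mul_le hm.1]
        exact ⟨hd.1.1, hd.2⟩
      refine (sum_le_sum_of_subset_of_nonneg hsub fun d _ _ =>
        mul_nonneg (hΛ d) (mul_nonneg (Nat.cast_nonneg d) (ha m))).trans (sum_le_sum fun d hd => ?_)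
      have h5 : (d : ℝ) ≤ z := (Nat.le_floor_iff hz0).1 (mem_Ioc.1 hd).2
      exact mul_le_mul_of_nonneg_left (mul_le_mul_of_nonneg_right h5 (ha m)) (hΛ d)
    refine h4.trans ?_
    rw [← sum_mul]
    have h5 := Chebyshev.psi_le_const_mul_self hz0
    rw [Chebyshev.psi] at h5
    calc _ ≤ (Real.log 4 + 4) * z * (z * a m) :=
          mul_le_mul_of_nonneg_right h5 (mul_nonneg hz0 (ha m))
      _ = _ := by rw [hz]; field_simp; ring
  refine h1.trans ((sum_le_sum fun d hd => mul_le_mul_of_nonneg_left (h2 d hd) (hΛ d)).trans ?_)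
  simp_rw [mul_sum]
  rw [sum_comm]
  refine sum_le_sum fun m hm => h3 m hm

theorem norm_meanUpTo_mul_log_le {g : ℕ → ℂ} (hmult : ∀ m n, g (m * n) = g m * g n)
    (hg : ∀ n, ‖g n‖ ≤ 1) {X Y : ℕ} (hY0 : 0 < Y) (hY : Y ≤ X) :
    ‖meanUpTo g X‖ * Real.log X ≤ Y / X * Real.log X + 2
      + 4 * (Real.log 4 + 4) * X / Y * ∑ m ∈ Ioc 0 (2 * X), ‖meanUpTo g m‖ / m := by
  have hX0 : (0 : ℝ) < X := by exact_mod_cast hY0.trans_le hY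
  have hY0' : (0 : ℝ) < Y := by exact_mod_cast hY0
  have hlog : 0 ≤ Real.log X := Real.log_natCast_nonneg X
  have h1 := sum_sum_div_le (a := fun n => ‖∑ k ∈ Ioc 0 n, g k‖) (fun _ => norm_nonneg _) (by simp) hY
  have e1 : ∀ m ∈ Ioc 0 (2 * X), ‖∑ k ∈ Ioc 0 m, g k‖ / (m : ℝ) ^ 2 = ‖meanUpTo g m‖ / m := by
    intro m _
    rw [meanUpTo, norm_div, Complex.norm_natCast, div_div, pow_two]
  rw [sum_congr rfl e1] at h1
  set L := ∑ m ∈ Ioc 0 (2 * X), ‖meanUpTo g m‖ / m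
  set A := ‖∑ k ∈ Ioc 0 X, g k‖ with hA
  have h2 : ∀ x ∈ Ioc X (X + Y), (A - Y) * Real.log X ≤ 2 * X +
      ∑ d ∈ Ioc 0 x, ArithmeticFunction.vonMangoldt d * ‖∑ n ∈ Ioc 0 (x / d), g n‖ := by
    intro x hx
    rw [mem_Ioc] at hx
    have hx1 : (x : ℝ) ≤ 2 * X := by exact_mod_cast (by omega)
    have hx2 : (x : ℝ) - X ≤ Y := by
      have : (x : ℝ) ≤ X + Y := by exact_mod_cast hx.2
      linarith
    have hx3 : Real.log X ≤ Real.log x := Real.log_le_log hX0 (by exact_mod_cast hx.1.le)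
    have h3 := norm_sum_mul_log_le hmult hg x
    have h4 := norm_sum_Ioc_le hg X x hx.1.le
    have h5 : A - Y ≤ ‖∑ n ∈ Ioc 0 x, g n‖ := by
      rw [← sum_Ioc_consecutive g (Nat.zero_le X) hx.1.le]
      have := norm_sub_le_norm_add (∑ n ∈ Ioc 0 X, g n) (∑ n ∈ Ioc X x, g n)
      linarith
    have h6 : (A - Y) * Real.log X ≤ ‖∑ n ∈ Ioc 0 x, g n‖ * Real.log x :=
      (mul_le_mul_of_nonneg_right h5 hlog).trans (mul_le_mul_of_nonneg_left hx3 (norm_nonneg _))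
    linarith
  have h3 := sum_le_sum h2
  rw [sum_const, Nat.card_Ioc, sum_add_distrib, sum_const, Nat.card_Ioc, nsmul_eq_mul, nsmul_eq_mul,
    Nat.add_sub_cancel_left] at h3
  have h4 : (Y : ℝ) * ((A - Y) * Real.log X) ≤ Y * (2 * X) + 4 * (Real.log 4 + 4) * X ^ 2 * L := by
    linarith
  have e2 : ‖meanUpTo g X‖ = A / X := by rw [meanUpTo, norm_div, Complex.norm_natCast]
  rw [e2]
  have h5 : A / X * Real.log X - Y / X * Real.log X = (Y * ((A - Y) * Real.log X)) / (X * Y) := by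
    field_simp
  have h6 : (Y * (2 * X) + 4 * (Real.log 4 + 4) * X ^ 2 * L) / (X * Y)
      = 2 + 4 * (Real.log 4 + 4) * X / Y * L := by field_simp
  have h7 := div_le_div_of_nonneg_right h4 (by positivity : (0 : ℝ) ≤ X * Y)
  linarith

theorem NonPretentious.tendsto_meanUpTo {g : ℕ → ℂ} (hnp : NonPretentious g)
    (hmult : ∀ m n, g (m * n) = g m * g n) (hg : ∀ n, ‖g n‖ ≤ 1) :
    Tendsto (meanUpTo g) atTop (nhds 0) := by
  rw [Metric.tendsto_atTop]
  intro ε hε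
  set η : ℝ := min (1 / 2) (ε / 8) with hη
  have hη0 : 0 < η := by positivity
  have hη2 : η ≤ 1 / 2 := min_le_left _ _
  have hηε : 8 * η ≤ ε := by have := min_le_right (1 / 2) (ε / 8); linarith
  set C : ℝ := 4 * (Real.log 4 + 4) with hC
  have hC0 : 0 < C := by have := Real.log_nonneg (by norm_num : (1 : ℝ) ≤ 4); positivity
  obtain ⟨B, hB0, hB⟩ := sum_norm_meanUpTo_div_le hmult hg hnp (ε := η ^ 2 / (2 * C)) (by positivity)
  have hlim : Tendsto (fun X : ℕ => Real.log X) atTop atTop :=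
    Real.tendsto_log_atTop.comp tendsto_natCast_atTop_atTop
  obtain ⟨N₁, hN₁⟩ := eventually_atTop.1 (hlim.eventually_ge_atTop (1 + (2 + C / η * B) / η))
  obtain ⟨N₂, hN₂⟩ := exists_nat_gt (1 / η)
  refine ⟨max N₁ (N₂ + 2), fun X hX => ?_⟩
  rw [dist_zero_right]
  have hXN₁ := hN₁ X (le_trans (le_max_left _ _) hX)
  have hXN₂ : N₂ + 2 ≤ X := le_trans (le_max_right _ _) hX
  have hX2 : (2 : ℝ) ≤ X := by exact_mod_cast (by omega : 2 ≤ X)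
  have hX0 : (0 : ℝ) < X := by linarith
  have hηX : 1 ≤ η * X := by
    have : (N₂ : ℝ) ≤ X := by exact_mod_cast (by omega : N₂ ≤ X)
    have := (div_lt_iff₀ hη0).1 (hN₂.trans_le this)
    linarith
  set Y : ℕ := ⌈η * X⌉₊ with hY
  have hY1 : η * X ≤ Y := Nat.le_ceil _
  have hY2 : (Y : ℝ) ≤ 2 * (η * X) := by
    have := Nat.ceil_lt_add_one (by positivity : 0 ≤ η * X)
    linarith
  have hY0 : (0 : ℝ) < Y := by linarith
  have hYX : Y ≤ X := by
    have : (Y : ℝ) ≤ X := hY2.trans (by nlinarith)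
    exact_mod_cast this
  have h1 := norm_meanUpTo_mul_log_le hmult hg (by exact_mod_cast hY0) hYX
  have h2 := hB (2 * X) (by omega)
  set L := ∑ m ∈ Ioc 0 (2 * X), ‖meanUpTo g m‖ / m
  have hlog0 : 0 < Real.log X := lt_of_lt_of_le (by positivity) hXN₁
  have h3 : Real.log (2 * X : ℕ) ≤ 2 * Real.log X := by
    push_cast
    rw [Real.log_mul two_ne_zero hX0.ne']
    have := Real.log_le_log two_pos hX2
    linarith
  have h4 : L ≤ B + η ^ 2 / C * Real.log X := by
    refine h2.trans ?_
    have e : η ^ 2 / C * Real.log X = η ^ 2 / (2 * C) * (2 * Real.log X) := by field_simp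
    rw [e]
    gcongr
  have h5 : C * X / Y ≤ C / η := by
    rw [div_le_div_iff₀ hY0 hη0]
    have := mul_le_mul_of_nonneg_left hY1 hC0.le
    linarith
  have h6 : C * X / Y * L ≤ C / η * (B + η ^ 2 / C * Real.log X) := by
    gcongr
  have h7 : C / η * (B + η ^ 2 / C * Real.log X) = C / η * B + η * Real.log X := by
    field_simp
  have h8 : (Y : ℝ) / X * Real.log X ≤ 2 * η * Real.log X := by
    gcongr
    rw [div_le_iff₀ hX0]; linarith
  have h9 : 2 + C / η * B ≤ η * Real.log X := by
    have : (2 + C / η * B) / η ≤ Real.log X := by linarith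
    rw [div_le_iff₀ hη0] at this
    linarith
  have h10 : ‖meanUpTo g X‖ * Real.log X ≤ (4 * η) * Real.log X := by linarith
  have h11 := le_of_mul_le_mul_right h10 hlog0
  linarith

theorem norm_one_sub_mul_sq_le {z : ℝ} (hz0 : 0 ≤ z) (hz : z ≤ 1 / 2) {u : ℂ} (hu : ‖u‖ = 1) :
    ‖1 - (z : ℂ) * u‖ ^ 2 ≤ Real.exp (4 * (z * ‖1 - u‖ ^ 2)) * ‖1 - (z : ℂ)‖ ^ 2 := by
  have h0 : u.re ^ 2 + u.im ^ 2 = 1 := by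
    have := Complex.sq_norm u
    rw [hu, Complex.normSq_apply] at this
    linarith
  have h1 : ‖1 - (z : ℂ) * u‖ ^ 2 = (1 - z) ^ 2 + z * ‖1 - u‖ ^ 2 := by
    rw [Complex.sq_norm, Complex.sq_norm, Complex.normSq_apply, Complex.normSq_apply]
    simp only [Complex.sub_re, Complex.sub_im, Complex.mul_re, Complex.mul_im, Complex.ofReal_re,
      Complex.ofReal_im, Complex.one_re, Complex.one_im]
    linear_combination (z ^ 2 - z) * h0
  have h2 : ‖1 - (z : ℂ)‖ ^ 2 = (1 - z) ^ 2 := by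
    rw [← Complex.ofReal_one, ← Complex.ofReal_sub, Complex.norm_real, Real.norm_eq_abs, sq_abs]
  have h3 := Real.add_one_le_exp (4 * (z * ‖1 - u‖ ^ 2))
  have h4 : 0 ≤ z * ‖1 - u‖ ^ 2 := by positivity
  have h5 : (1 / 4 : ℝ) ≤ (1 - z) ^ 2 := by nlinarith
  rw [h1, h2]
  nlinarith [mul_le_mul_of_nonneg_right h3 (sq_nonneg (1 - z)), mul_le_mul_of_nonneg_left h5 h4]

theorem norm_zeta_sq_le {τ D : ℝ}
    (hD : ∀ P : Finset ℕ, (∀ p ∈ P, p.Prime) →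
      ∑ p ∈ P, (1 / p : ℝ) * ‖1 - Complex.exp (-(τ * Real.log p : ℝ) * Complex.I)‖ ^ 2 ≤ D)
    {σ : ℝ} (hσ : 1 < σ) :
    ‖riemannZeta σ‖ ^ 2 ≤ Real.exp (4 * D) * ‖riemannZeta (σ + τ * Complex.I)‖ ^ 2 := by
  have h1 := riemannZeta_eulerProduct (s := (σ : ℂ)) (by simpa using hσ)
  have h2 := riemannZeta_eulerProduct (s := (σ : ℂ) + τ * Complex.I) (by simpa using hσ)
  refine le_of_tendsto_of_tendsto' (h1.norm.pow 2) ((h2.norm.pow 2).const_mul _) fun n => ?_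
  rw [norm_prod, norm_prod, ← prod_pow, ← prod_pow]
  have hp : ∀ p ∈ Nat.primesBelow n, p.Prime := fun p hp => Nat.prime_of_mem_primesBelow hp
  have hterm : ∀ p ∈ Nat.primesBelow n, ‖(1 - (p : ℂ) ^ (-(σ : ℂ)))⁻¹‖ ^ 2 ≤
      Real.exp (4 * ((1 / p : ℝ) * ‖1 - Complex.exp (-(τ * Real.log p : ℝ) * Complex.I)‖ ^ 2)) *
        ‖(1 - (p : ℂ) ^ (-((σ : ℂ) + τ * Complex.I)))⁻¹‖ ^ 2 := by
    intro p hpn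
    have hp2 : (2 : ℝ) ≤ p := by exact_mod_cast (hp p hpn).two_le
    have hp0 : (0 : ℝ) < p := by linarith
    have hpC : (p : ℂ) ≠ 0 := by exact_mod_cast hp0.ne'
    set z : ℝ := (p : ℝ) ^ (-σ) with hz
    have hz0 : 0 < z := Real.rpow_pos_of_pos hp0 _
    have hz1 : z ≤ 1 / p := by
      rw [hz, one_div, ← Real.rpow_neg_one]
      exact Real.rpow_le_rpow_of_exponent_le (by linarith) (by linarith)
    have hz2 : z ≤ 1 / 2 := hz1.trans (one_div_le_one_div_of_le two_pos hp2)
    set u := Complex.exp (-(τ * Real.log p : ℝ) * Complex.I) with hu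
    have hu1 : ‖u‖ = 1 := by rw [hu, ← Complex.ofReal_neg, Complex.norm_exp_ofReal_mul_I]
    have e1 : (p : ℂ) ^ (-(σ : ℂ)) = z := by
      rw [hz, Complex.ofReal_cpow hp0.le]; push_cast; rfl
    have e2 : (p : ℂ) ^ (-((σ : ℂ) + τ * Complex.I)) = z * u := by
      rw [neg_add, Complex.cpow_add _ _ hpC, e1, hu, Complex.cpow_def_of_ne_zero hpC,
        Complex.ofReal_mul, Complex.ofReal_log hp0.le]
      congr 2
      push_cast; ring
    have h3 := norm_one_sub_mul_sq_le hz0.le hz2 hu1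
    have hne : ∀ v : ℂ, ‖v‖ = 1 → 0 < ‖1 - (z : ℂ) * v‖ := by
      intro v hv
      have := norm_sub_norm_le (1 : ℂ) ((z : ℂ) * v)
      rw [norm_mul, hv, Complex.norm_real, Real.norm_of_nonneg hz0.le, norm_one] at this
      linarith
    have h4 := hne u hu1
    have h5 := hne 1 (by simp)
    rw [mul_one] at h5
    rw [e1, e2, norm_inv, norm_inv, inv_pow, inv_pow, ← div_eq_mul_inv, inv_le_comm₀ (by positivity) (by positivity),
      inv_div, div_le_iff₀ (by positivity)]
    refine h3.trans (le_of_le_of_eq ?_ (mul_comm _ _))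
    gcongr
  calc _ ≤ ∏ p ∈ Nat.primesBelow n,
        Real.exp (4 * ((1 / p : ℝ) * ‖1 - Complex.exp (-(τ * Real.log p : ℝ) * Complex.I)‖ ^ 2)) *
        ‖(1 - (p : ℂ) ^ (-((σ : ℂ) + τ * Complex.I)))⁻¹‖ ^ 2 :=
        prod_le_prod (fun _ _ => by positivity) hterm
    _ ≤ _ := by
        rw [prod_mul_distrib, ← Real.exp_sum, ← mul_sum]
        gcongr
        exact hD _ hp

theorem exists_sum_norm_one_sub_exp_ge {τ : ℝ} (hτ : τ ≠ 0) (D : ℝ) :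
    ∃ P : Finset ℕ, (∀ p ∈ P, p.Prime) ∧
      D ≤ ∑ p ∈ P, (1 / p : ℝ) * ‖1 - Complex.exp (-(τ * Real.log p : ℝ) * Complex.I)‖ ^ 2 := by
  by_contra hcon
  push Not at hcon
  have hbound : ∀ σ : ℝ, 1 < σ →
      ‖riemannZeta σ‖ ^ 2 ≤ Real.exp (4 * D) * ‖riemannZeta (σ + τ * Complex.I)‖ ^ 2 :=
    fun σ hσ => norm_zeta_sq_le (fun P hP => (hcon P hP).le) hσ
  set s : ℕ → ℝ := fun n => 1 + 1 / ((n : ℝ) + 1) with hs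
  have hs1 : ∀ n, 1 < s n := fun n => by
    have : (0 : ℝ) < 1 / ((n : ℝ) + 1) := by positivity
    simp only [hs]; linarith
  have hslim : Tendsto s atTop (nhds 1) := by
    have := tendsto_one_div_add_atTop_nhds_zero_nat (𝕜 := ℝ)
    simpa [hs] using this.const_add 1
  have hsC : Tendsto (fun n => ((s n : ℝ) : ℂ)) atTop (nhds 1) := by
    have := (Complex.continuous_ofReal.tendsto 1).comp hslim
    rw [Complex.ofReal_one] at this
    exact this
  have hres : Tendsto (fun n => ((s n : ℂ) - 1) * riemannZeta (s n)) atTop (nhds 1) := by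
    refine riemannZeta_residue_one.comp (tendsto_nhdsWithin_iff.2 ⟨hsC, Eventually.of_forall fun n => ?_⟩)
    simp only [Set.mem_compl_iff, Set.mem_singleton_iff]
    exact_mod_cast (hs1 n).ne'
  have hcont : Tendsto (fun n => riemannZeta ((s n : ℂ) + τ * Complex.I)) atTop
      (nhds (riemannZeta (1 + τ * Complex.I))) := by
    have hne : (1 : ℂ) + τ * Complex.I ≠ 1 := by
      intro h
      have := congrArg Complex.im h
      simp at this
      exact hτ this
    exact (differentiableAt_riemannZeta hne).continuousAt.tendsto.comp (hsC.add_const _)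
  have hlim0 : Tendsto (fun n => ‖(s n : ℂ) - 1‖ ^ 2 *
      (Real.exp (4 * D) * ‖riemannZeta ((s n : ℂ) + τ * Complex.I)‖ ^ 2)) atTop (nhds 0) := by
    have h1 : Tendsto (fun n => ‖(s n : ℂ) - 1‖ ^ 2) atTop (nhds 0) := by
      have := (hsC.sub_const 1).norm.pow 2
      simpa using this
    have := h1.mul ((hcont.norm.pow 2).const_mul (Real.exp (4 * D)))
    simpa using this
  have hle : (1 : ℝ) ≤ 0 := by
    have h1 : Tendsto (fun n => ‖((s n : ℂ) - 1) * riemannZeta (s n)‖ ^ 2) atTop (nhds 1) := by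
      have := hres.norm.pow 2
      simpa using this
    refine le_of_tendsto_of_tendsto' h1 hlim0 fun n => ?_
    rw [norm_mul, mul_pow]
    exact mul_le_mul_of_nonneg_left (hbound (s n) (hs1 n)) (by positivity)
  linarith

theorem abs_le_prod_prime_dvd {f : ℕ → ℝ} (hmult : ∀ m n, f (m * n) = f m * f n)
    (hbound : ∀ n, |f n| ≤ 1) (P : Finset ℕ) (hP : ∀ p ∈ P, p.Prime) (n : ℕ) :
    |f n| ≤ ∏ p ∈ P, if p ∣ n then |f p| else 1 := by
  classical
  induction P using Finset.induction_on generalizing n with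
  | empty => simpa using hbound n
  | insert p P hp ih =>
    have hP' : ∀ q ∈ P, q.Prime := fun q hq => hP q (mem_insert_of_mem hq)
    rw [prod_insert hp]
    split_ifs with h
    · obtain ⟨m, rfl⟩ := h
      have e : ∏ q ∈ P, (if q ∣ p * m then |f q| else 1) = ∏ q ∈ P, if q ∣ m then |f q| else 1 := by
        refine prod_congr rfl fun q hq => ?_
        have hqp : ¬ q ∣ p := fun h => hp (by
          rwa [← (Nat.prime_dvd_prime_iff_eq (hP' q hq) (hP p (mem_insert_self _ _))).1 h])
        have : q ∣ p * m ↔ q ∣ m := by rw [(hP' q hq).dvd_mul]; tauto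
        simp only [this]
      rw [e, hmult, abs_mul]
      exact mul_le_mul_of_nonneg_left (ih hP' m) (abs_nonneg _)
    · rw [one_mul]; exact ih hP' n

theorem sum_abs_le_of_prime_sum {f : ℕ → ℝ} (hmult : ∀ m n, f (m * n) = f m * f n)
    (hbound : ∀ n, |f n| ≤ 1) (P : Finset ℕ) (hP : ∀ p ∈ P, p.Prime) {S : ℝ} (hS0 : 0 < S)
    (hS : S = ∑ p ∈ P, (1 / p : ℝ) * (1 - |f p|)) {N : ℕ} (hN : ∑ p ∈ P, p ≤ N) :
    ∑ n ∈ Ioc 0 N, |f n| ≤ 10 / S * N := by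
  set c : ℕ → ℝ := fun p => 1 - |f p| with hc
  have hc0 : ∀ p, 0 ≤ c p := fun p => sub_nonneg.2 (hbound p)
  have hc1 : ∀ p, c p ≤ 1 := fun p => by simp only [hc]; linarith [abs_nonneg (f p)]
  have htk := turan_kubilius P hP c N hN
  have hsq : ∑ p ∈ P, c p ^ 2 / p ≤ S := by
    rw [hS]
    refine sum_le_sum fun p _ => ?_
    rw [div_eq_mul_one_div, mul_comm]
    gcongr
    rw [pow_two]
    exact mul_le_of_le_one_left (hc0 p) (hc1 p)
  have hpt : ∀ n ∈ Ioc 0 N, |f n| ≤ 2 / S + 4 / S ^ 2 * (∑ p ∈ P, c p * balancedDvd p n) ^ 2 := by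
    intro n _
    set w : ℝ := ∑ p ∈ P, if p ∣ n then c p else 0 with hw
    have hW : ∑ p ∈ P, c p * balancedDvd p n = w - S := by
      rw [hw, hS, ← sum_sub_distrib]
      refine sum_congr rfl fun p _ => ?_
      rw [balancedDvd]
      split_ifs <;> ring
    have h1 : |f n| ≤ Real.exp (-w) := by
      refine (abs_le_prod_prime_dvd hmult hbound P hP n).trans ?_
      rw [hw, ← sum_neg_distrib, Real.exp_sum]
      refine prod_le_prod (fun p _ => by split_ifs <;> positivity) fun p _ => ?_
      split_ifs
      · have := Real.add_one_le_exp (-c p)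
        simp only [hc] at this ⊢
        linarith
      · simp
    rw [hW]
    rcases le_or_gt (S / 2) w with h | h
    · have h2 : Real.exp (-w) ≤ 2 / S := by
        rw [Real.exp_neg, inv_le_comm₀ (Real.exp_pos _) (by positivity), inv_div]
        have := Real.add_one_le_exp w
        linarith
      have : 0 ≤ 4 / S ^ 2 * (w - S) ^ 2 := by positivity
      linarith
    · have h2 : 1 ≤ 4 / S ^ 2 * (w - S) ^ 2 := by
        rw [div_mul_eq_mul_div, one_le_div (by positivity)]
        nlinarith
      have := hbound n
      have : 0 ≤ 2 / S := by positivity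
      linarith
  refine (sum_le_sum hpt).trans ?_
  rw [sum_add_distrib, sum_const, Nat.card_Ioc, nsmul_eq_mul, ← mul_sum, Nat.sub_zero]
  have h1 : 4 / S ^ 2 * ∑ n ∈ Ioc 0 N, (∑ p ∈ P, c p * balancedDvd p n) ^ 2
      ≤ 4 / S ^ 2 * (2 * N * S) := by
    gcongr
    exact htk.trans (by gcongr)
  have h2 : 4 / S ^ 2 * (2 * N * S) = 8 / S * N := by field_simp; ring
  have h3 : (N : ℝ) * (2 / S) + 8 / S * N = 10 / S * N := by ring
  linarith

theorem aperiodic_of_prime_sum {f : ℕ → ℝ} (hmult : ∀ m n, f (m * n) = f m * f n)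
    (hbound : ∀ n, |f n| ≤ 1)
    (hdiv : ∀ D : ℝ, ∃ P : Finset ℕ, (∀ p ∈ P, p.Prime) ∧ D ≤ ∑ p ∈ P, (1 / p : ℝ) * (1 - |f p|)) :
    Aperiodic f := by
  intro d _ r
  rw [Metric.tendsto_atTop]
  intro ε hε
  obtain ⟨P, hP, hD⟩ := hdiv (20 / ε)
  refine ⟨∑ p ∈ P, p + 1, fun N hN => ?_⟩
  have hS0 : 0 < ∑ p ∈ P, (1 / p : ℝ) * (1 - |f p|) := lt_of_lt_of_le (by positivity) hD
  have h1 := sum_abs_le_of_prime_sum hmult hbound P hP hS0 rfl (N := N) (by omega)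
  have hN0 : (0 : ℝ) < N := by exact_mod_cast (by omega : 0 < N)
  have h2 : |residueSum f d r N| ≤ ∑ n ∈ Ioc 0 N, |f n| := by
    refine (abs_sum_le_sum_abs _ _).trans (sum_le_sum fun n _ => ?_)
    split_ifs
    · exact le_rfl
    · simp
  have h3 : 10 / (∑ p ∈ P, (1 / p : ℝ) * (1 - |f p|)) ≤ ε / 2 := by
    rw [div_le_iff₀ hS0]
    rw [div_le_iff₀ hε] at hD
    linarith
  rw [Real.dist_eq, sub_zero, abs_div, abs_of_pos hN0, div_lt_iff₀ hN0]
  have h4 := mul_le_mul_of_nonneg_right h3 hN0.le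
  have := mul_pos hε hN0
  linarith

theorem norm_one_sub_pow_le {z : ℂ} (hz : ‖z‖ ≤ 1) (R : ℕ) : ‖1 - z ^ R‖ ≤ R * ‖1 - z‖ := by
  induction R with
  | zero => simp
  | succ R ih =>
    have e : 1 - z ^ (R + 1) = (1 - z) + z * (1 - z ^ R) := by ring
    rw [e]
    refine (norm_add_le _ _).trans ?_
    rw [norm_mul]
    have := mul_le_of_le_one_left (norm_nonneg (1 - z ^ R)) hz
    push_cast
    linarith

theorem one_le_mul_norm_one_sub_of_pow_eq_one {z : ℂ} {R : ℕ} (hR : 0 < R) (hz : z ^ R = 1)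
    (h1 : z ≠ 1) : 1 ≤ R * ‖1 - z‖ := by
  have hnorm : ‖z‖ = 1 := Complex.norm_eq_one_of_pow_eq_one hz hR.ne'
  have hsum : ∑ j ∈ range R, z ^ j = 0 := by
    have := geom_sum_mul z R
    rw [hz, sub_self] at this
    exact (mul_eq_zero.1 this).resolve_right (sub_ne_zero.2 h1)
  have h2 : (R : ℂ) = ∑ j ∈ range R, (1 - z ^ j) := by
    rw [sum_sub_distrib, hsum]; simp
  have h3 : (R : ℝ) ≤ R * (R * ‖1 - z‖) := by
    calc (R : ℝ) = ‖(R : ℂ)‖ := (Complex.norm_natCast R).symm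
      _ ≤ ∑ j ∈ range R, ‖1 - z ^ j‖ := by rw [h2]; exact norm_sum_le _ _
      _ ≤ ∑ _j ∈ range R, R * ‖1 - z‖ := sum_le_sum fun j hj => by
          refine (norm_one_sub_pow_le hnorm.le j).trans ?_
          have : (j : ℝ) ≤ R := by exact_mod_cast (mem_range.1 hj).le
          gcongr
      _ = _ := by rw [sum_const, card_range, nsmul_eq_mul]
  have hR' : (0 : ℝ) < R := by exact_mod_cast hR
  nlinarith

/-- A unimodular twist by a root of unity. -/
theorem norm_one_sub_le_of_root_of_unity {z : ℂ} {R : ℕ} (hR : 0 < R) (hz : z ^ R = 1) {ρ : ℝ}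
    (hρ0 : 0 ≤ ρ) (hρ1 : ρ ≤ 1) :
    ‖1 - ρ * z‖ ≤ 2 * R * ‖1 - ρ * z‖ ^ 2 + (1 - ρ) := by
  have hnorm : ‖z‖ = 1 := Complex.norm_eq_one_of_pow_eq_one hz hR.ne'
  by_cases h1 : z = 1
  · rw [h1, mul_one]
    have e : ‖(1 : ℂ) - ρ‖ = 1 - ρ := by
      rw [← Complex.ofReal_one, ← Complex.ofReal_sub, Complex.norm_real,
        Real.norm_of_nonneg (by linarith)]
    have : 0 ≤ 2 * R * ‖(1 : ℂ) - ρ‖ ^ 2 := by positivity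
    linarith
  · have h2 := one_le_mul_norm_one_sub_of_pow_eq_one hR hz h1
    have h3 : 1 - ρ ≤ ‖1 - ρ * z‖ := by
      have := norm_sub_norm_le (1 : ℂ) (ρ * z)
      rw [norm_mul, hnorm, Complex.norm_real, Real.norm_of_nonneg hρ0, norm_one] at this
      linarith
    have h4 : ‖1 - z‖ ≤ 2 * ‖1 - ρ * z‖ := by
      have e : 1 - z = (1 - ρ * z) - ((1 - ρ : ℝ) : ℂ) * z := by push_cast; ring
      have : ‖1 - z‖ ≤ ‖1 - ρ * z‖ + (1 - ρ) := by
        rw [e]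
        refine (norm_sub_le _ _).trans ?_
        rw [norm_mul ((1 - ρ : ℝ) : ℂ), hnorm, Complex.norm_real, Real.norm_of_nonneg (by linarith), mul_one]
      linarith
    have hR' : (0 : ℝ) < R := by exact_mod_cast hR
    have h5 : 1 ≤ 2 * R * ‖1 - ρ * z‖ := by nlinarith
    have h6 := mul_le_mul_of_nonneg_right h5 (norm_nonneg (1 - ρ * z))
    nlinarith

theorem norm_one_sub_pow_sq_le {z v : ℂ} {R : ℕ} (hR : 0 < R) (hz : z ^ R = 1) (hv : ‖v‖ = 1)
    {ρ : ℝ} (hρ0 : 0 ≤ ρ) (hρ1 : ρ ≤ 1) :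
    ‖1 - v ^ R‖ ^ 2 ≤ 2 * R ^ 2 * ‖1 - ρ * z * v‖ ^ 2 + 2 * R ^ 2 * (1 - ρ) := by
  have hnorm : ‖z‖ = 1 := Complex.norm_eq_one_of_pow_eq_one hz hR.ne'
  have hρn : ‖(ρ : ℂ)‖ = ρ := by rw [Complex.norm_real, Real.norm_of_nonneg hρ0]
  have h1 := norm_one_sub_pow_le (z := ρ * z * v) (by
    rw [norm_mul, norm_mul, hnorm, hv, hρn]; linarith) R
  have h2 := norm_one_sub_pow_le (z := (ρ : ℂ)) (by rw [hρn]; exact hρ1) R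
  have e2 : ‖(1 : ℂ) - ρ‖ = 1 - ρ := by
    rw [← Complex.ofReal_one, ← Complex.ofReal_sub, Complex.norm_real,
      Real.norm_of_nonneg (by linarith)]
  rw [e2] at h2
  have e1 : (ρ * z * v) ^ R = ρ ^ R * v ^ R := by rw [mul_pow, mul_pow, hz, mul_one]
  rw [e1] at h1
  have h3 : ‖1 - v ^ R‖ ≤ R * ‖1 - ρ * z * v‖ + R * (1 - ρ) := by
    have e : 1 - v ^ R = (1 - ρ ^ R * v ^ R) - (1 - ρ ^ R) * v ^ R := by ring
    rw [e]
    refine (norm_sub_le _ _).trans (add_le_add h1 ?_)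
    rw [norm_mul, norm_pow, hv, one_pow, mul_one]
    exact h2
  have h4 := sq_le_two_mul_sq_add (norm_nonneg _) h3
  have h5 : (1 - ρ) ^ 2 ≤ 1 - ρ := by nlinarith
  have h6 : 2 * (R * (1 - ρ)) ^ 2 ≤ 2 * (R : ℝ) ^ 2 * (1 - ρ) := by
    rw [mul_pow, ← mul_assoc]; gcongr
  calc _ ≤ _ := h4
    _ ≤ 2 * (R * ‖1 - ρ * z * v‖) ^ 2 + 2 * (R : ℝ) ^ 2 * (1 - ρ) := by gcongr
    _ = _ := by ring

/-- The values at primes of a bounded real function twisted by a Dirichlet character. -/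
theorem twist_value (f : ℕ → ℝ) {r : ℕ} [NeZero r]
    (χ : DirichletCharacter ℂ r) (n : ℕ) :
    (f n : ℂ) * χ n = 0 ∨ ∃ z : ℂ, z ^ (2 * r.totient) = 1 ∧ (f n : ℂ) * χ n = (|f n| : ℝ) * z := by
  by_cases hu : IsUnit (n : ZMod r)
  · right
    obtain ⟨u, hu⟩ := hu
    have h1 : χ n ^ r.totient = 1 := by
      rw [← hu, ← map_pow, ← Units.val_pow_eq_pow_val, ZMod.pow_totient, Units.val_one, map_one]
    rcases le_total 0 (f n) with h | h
    · refine ⟨χ n, by rw [mul_comm 2, pow_mul, h1, one_pow], by rw [abs_of_nonneg h]⟩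
    · refine ⟨-χ n, ?_, ?_⟩
      · rw [pow_mul, neg_sq, ← pow_mul, mul_comm 2, pow_mul, h1, one_pow]
      · rw [abs_of_nonpos h]; push_cast; ring
  · left
    rw [MulChar.map_nonunit χ hu, mul_zero]

theorem sum_norm_one_sub_le_of_not_nonPretentious {f : ℕ → ℝ} (hbound : ∀ n, |f n| ≤ 1)
    {E : ℝ} (hE : ∀ P : Finset ℕ, (∀ p ∈ P, p.Prime) → ∑ p ∈ P, (1 / p : ℝ) * (1 - |f p|) ≤ E)
    {r : ℕ} [NeZero r] (χ : DirichletCharacter ℂ r)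
    (hnot : ¬ NonPretentious fun n => (f n : ℂ) * χ n) :
    ∃ D : ℝ, ∀ P : Finset ℕ, (∀ p ∈ P, p.Prime) →
      ∑ p ∈ P, (1 / p : ℝ) * ‖1 - (f p : ℂ) * χ p‖ ≤ D := by
  unfold NonPretentious at hnot
  push Not at hnot
  obtain ⟨t, D, hD⟩ := hnot
  set R := 2 * r.totient with hR
  have hR0 : 0 < R := by have := Nat.totient_pos.2 (Nat.pos_of_ne_zero (NeZero.ne r)); omega
  have hρ0 : ∀ p, 0 ≤ |f p| := fun p => abs_nonneg _
  by_cases ht : t = 0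
  · refine ⟨(2 * R + 1) * D + E, fun P hP => ?_⟩
    have h1 := (hD P hP).le
    have h2 := hE P hP
    have h3 : ∀ p ∈ P, (1 / p : ℝ) * ‖1 - (f p : ℂ) * χ p‖ ≤ (2 * R + 1) *
        ((1 / p : ℝ) * ‖1 - (f p : ℂ) * χ p * Complex.exp (-(t * Real.log p : ℝ) * Complex.I)‖ ^ 2)
        + (1 / p : ℝ) * (1 - |f p|) := by
      intro p _
      have e : Complex.exp (-(t * Real.log p : ℝ) * Complex.I) = 1 := by simp [ht]
      rw [e, mul_one]
      have h4 : ‖1 - (f p : ℂ) * χ p‖ ≤ (2 * R + 1) * ‖1 - (f p : ℂ) * χ p‖ ^ 2 + (1 - |f p|) := by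
        have hb := hbound p
        rcases twist_value f χ p with h | ⟨z, hz, h⟩
        · rw [h, sub_zero, norm_one]
          have : (0 : ℝ) ≤ R := Nat.cast_nonneg R
          linarith
        · rw [h]
          have := norm_one_sub_le_of_root_of_unity hR0 hz (hρ0 p) hb
          have := sq_nonneg ‖1 - ((|f p| : ℝ) : ℂ) * z‖
          linarith
      have := mul_le_mul_of_nonneg_left h4 (by positivity : (0 : ℝ) ≤ 1 / p)
      linarith
    refine (sum_le_sum h3).trans ?_
    rw [sum_add_distrib, ← mul_sum]
    gcongr
  · exfalso
    have hRt : (R : ℝ) * t ≠ 0 := mul_ne_zero (by exact_mod_cast hR0.ne') ht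
    obtain ⟨P, hP, hbig⟩ := exists_sum_norm_one_sub_exp_ge hRt
      ((2 * R ^ 2 + 4) * D + 2 * R ^ 2 * E + 1)
    have h1 := (hD P hP).le
    have h2 := hE P hP
    have h3 : ∀ p ∈ P, (1 / p : ℝ) * ‖1 - Complex.exp (-(R * t * Real.log p : ℝ) * Complex.I)‖ ^ 2
        ≤ (2 * R ^ 2 + 4) *
        ((1 / p : ℝ) * ‖1 - (f p : ℂ) * χ p * Complex.exp (-(t * Real.log p : ℝ) * Complex.I)‖ ^ 2)
        + 2 * R ^ 2 * ((1 / p : ℝ) * (1 - |f p|)) := by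
      intro p _
      set v := Complex.exp (-(t * Real.log p : ℝ) * Complex.I) with hv
      have hv1 : ‖v‖ = 1 := by rw [hv, ← Complex.ofReal_neg, Complex.norm_exp_ofReal_mul_I]
      have e : Complex.exp (-(R * t * Real.log p : ℝ) * Complex.I) = v ^ R := by
        rw [hv, ← Complex.exp_nat_mul]; congr 1; push_cast; ring
      rw [e]
      have h4 : ‖1 - v ^ R‖ ^ 2 ≤ (2 * R ^ 2 + 4) * ‖1 - (f p : ℂ) * χ p * v‖ ^ 2
          + 2 * R ^ 2 * (1 - |f p|) := by
        have hb := hbound p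
        rcases twist_value f χ p with h | ⟨z, hz, h⟩
        · rw [h, zero_mul, sub_zero, norm_one]
          have h5 : ‖1 - v ^ R‖ ≤ 2 := by
            refine (norm_sub_le _ _).trans ?_
            rw [norm_pow, hv1, norm_one, one_pow]; norm_num
          have h6 : (0 : ℝ) ≤ 2 * R ^ 2 * (1 - |f p|) := mul_nonneg (by positivity) (by linarith)
          have h7 : (0 : ℝ) ≤ (R : ℝ) ^ 2 := by positivity
          have h8 : ‖1 - v ^ R‖ ^ 2 ≤ 2 ^ 2 := by gcongr
          linarith
        · rw [h]
          have := norm_one_sub_pow_sq_le hR0 hz hv1 (hρ0 p) hb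
          have := sq_nonneg ‖1 - ((|f p| : ℝ) : ℂ) * z * v‖
          linarith
      have := mul_le_mul_of_nonneg_left h4 (by positivity : (0 : ℝ) ≤ 1 / p)
      linarith
    have h4 := sum_le_sum h3
    rw [sum_add_distrib, ← mul_sum, ← mul_sum] at h4
    have h5 : (2 * (R : ℝ) ^ 2 + 4) * ∑ p ∈ P, ((1 / p : ℝ) * ‖1 - (f p : ℂ) * χ p *
        Complex.exp (-(t * Real.log p : ℝ) * Complex.I)‖ ^ 2) ≤ (2 * R ^ 2 + 4) * D := by gcongr
    have h6 : 2 * (R : ℝ) ^ 2 * ∑ p ∈ P, ((1 / p : ℝ) * (1 - |f p|)) ≤ 2 * R ^ 2 * E := by gcongr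
    linarith

theorem residueSum_eq_gcd {f : ℕ → ℝ} (hmult : ∀ m n, f (m * n) = f m * f n) {d : ℕ} (hd : 0 < d)
    (r N : ℕ) :
    residueSum f d r N
      = f (Nat.gcd d r) * residueSum f (d / Nat.gcd d r) (r / Nat.gcd d r) (N / Nat.gcd d r) := by
  set e := Nat.gcd d r with he
  have he0 : 0 < e := Nat.gcd_pos_of_pos_left r hd
  have hed : e ∣ d := Nat.gcd_dvd_left d r
  have her : e ∣ r := Nat.gcd_dvd_right d r
  unfold residueSum
  rw [← sum_filter, ← sum_filter, mul_sum]
  have hiff : ∀ m, e * m ≡ r [MOD d] ↔ m ≡ r / e [MOD d / e] := by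
    intro m
    have h1 : r = e * (r / e) := (Nat.mul_div_cancel' her).symm
    have h2 : d = e * (d / e) := (Nat.mul_div_cancel' hed).symm
    conv_lhs => rw [h1, h2]
    exact Nat.ModEq.mul_left_cancel_iff' he0.ne'
  symm
  refine sum_bij' (fun n _ => e * n) (fun n _ => n / e) (fun n hn => ?_) (fun n hn => ?_)
    (fun n hn => Nat.mul_div_cancel_left n he0) (fun n hn => ?_) (fun n _ => (hmult e n).symm)
  · rw [mem_filter, mem_Ioc] at hn ⊢
    exact ⟨⟨Nat.mul_pos he0 hn.1.1, by rw [mul_comm]; exact (Nat.le_div_iff_mul_le he0).1 hn.1.2⟩,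
      (hiff n).2 hn.2⟩
  · rw [mem_filter, mem_Ioc] at hn ⊢
    have hen : e ∣ n := (hn.2.dvd_iff hed).2 her
    refine ⟨⟨Nat.div_pos (Nat.le_of_dvd hn.1.1 hen) he0, Nat.div_le_div_right hn.1.2⟩, ?_⟩
    rw [← hiff, Nat.mul_div_cancel' hen]
    exact hn.2
  · rw [mem_filter] at hn
    exact Nat.mul_div_cancel' ((hn.2.dvd_iff hed).2 her)

theorem residueSum_coprime_eq (f : ℕ → ℝ) {d : ℕ} [NeZero d] {r : ℕ} (hr : Nat.Coprime r d) (N : ℕ) :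
    (d.totient : ℂ) * residueSum f d r N
      = ∑ χ : DirichletCharacter ℂ d, χ (r : ZMod d)⁻¹ * ∑ n ∈ Ioc 0 N, (f n : ℂ) * χ n := by
  have hu : IsUnit (r : ZMod d) := (ZMod.isUnit_iff_coprime r d).2 hr
  simp_rw [mul_sum]
  rw [sum_comm]
  unfold residueSum
  push_cast
  rw [mul_sum]
  refine sum_congr rfl fun n _ => ?_
  have h1 := DirichletCharacter.sum_char_inv_mul_char_eq ℂ hu (n : ZMod d)
  have e : ∑ χ : DirichletCharacter ℂ d, χ (r : ZMod d)⁻¹ * ((f n : ℂ) * χ n)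
      = f n * ∑ χ : DirichletCharacter ℂ d, χ (r : ZMod d)⁻¹ * χ n := by
    rw [mul_sum]
    exact sum_congr rfl fun χ _ => by ring
  rw [e, h1]
  have h2 : (r : ZMod d) = n ↔ n ≡ r [MOD d] := by
    rw [ZMod.natCast_eq_natCast_iff]; exact ⟨Nat.ModEq.symm, Nat.ModEq.symm⟩
  simp only [h2]
  split_ifs
  · ring
  · simp

theorem aperiodic_of_characters {f : ℕ → ℝ} (hmult : ∀ m n, f (m * n) = f m * f n)
    (hbound : ∀ n, |f n| ≤ 1)
    (h : ∀ r : ℕ, [NeZero r] → ∀ χ : DirichletCharacter ℂ r,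
      Tendsto (meanUpTo fun n => (f n : ℂ) * χ n) atTop (nhds 0)) : Aperiodic f := by
  have hcop : ∀ d > 0, ∀ r, Nat.Coprime r d →
      Tendsto (fun N : ℕ => residueSum f d r N / N) atTop (nhds 0) := by
    intro d hd r hr
    have : NeZero d := ⟨hd.ne'⟩
    have hφ : (d.totient : ℂ) ≠ 0 := by exact_mod_cast (Nat.totient_pos.2 hd).ne'
    have h1 : Tendsto (fun N : ℕ => (d.totient : ℂ)⁻¹ * ∑ χ : DirichletCharacter ℂ d,
        χ (r : ZMod d)⁻¹ * meanUpTo (fun n => (f n : ℂ) * χ n) N) atTop (nhds 0) := by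
      have := (tendsto_finsetSum univ fun (χ : DirichletCharacter ℂ d) _ =>
        (h d χ).const_mul (χ (r : ZMod d)⁻¹)).const_mul (d.totient : ℂ)⁻¹
      simpa using this
    have h2 : ∀ N : ℕ, (d.totient : ℂ)⁻¹ * ∑ χ : DirichletCharacter ℂ d,
        χ (r : ZMod d)⁻¹ * meanUpTo (fun n => (f n : ℂ) * χ n) N
        = ((residueSum f d r N / N : ℝ) : ℂ) := by
      intro N
      unfold meanUpTo
      simp_rw [mul_div_assoc']
      rw [← sum_div, ← residueSum_coprime_eq f hr N]
      push_cast
      field_simp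
    simp_rw [h2] at h1
    have h3 := (Complex.continuous_re.tendsto 0).comp h1
    simpa [Function.comp_def] using h3
  intro d hd r
  set e := Nat.gcd d r with he
  have he0 : 0 < e := Nat.gcd_pos_of_pos_left r hd
  have h1 := hcop (d / e) (Nat.div_pos (Nat.gcd_le_left r hd) he0) (r / e)
    (Nat.coprime_div_gcd_div_gcd he0).symm
  have h2 := h1.comp (Nat.tendsto_div_const_atTop he0.ne')
  refine squeeze_zero_norm (fun N => ?_) (by simpa using h2.abs)
  rw [residueSum_eq_gcd hmult hd, ← he, Real.norm_eq_abs, abs_div, abs_mul, Nat.abs_cast]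
  rw [abs_div, Nat.abs_cast]
  rcases Nat.eq_zero_or_pos (N / e) with h0 | h0
  · rw [h0]; simp [residueSum]
  · have h3 : ((N / e : ℕ) : ℝ) ≤ N := by exact_mod_cast Nat.div_le_self N e
    have h4 : (0 : ℝ) < (N / e : ℕ) := by exact_mod_cast h0
    gcongr
    exact mul_le_of_le_one_left (abs_nonneg _) (hbound e)

/-- Approximable in mean by periodic functions. -/
def LimitPeriodic (f : ℕ → ℝ) : Prop :=
  ∀ ε > 0, ∃ m > 0, ∃ φ : ℕ → ℝ, Function.Periodic φ m ∧ (∀ n, |φ n| ≤ 1) ∧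
    ∀ N : ℕ, ∑ n ∈ Ioc 0 N, |f n - φ n| ≤ ε * N

theorem norm_one_sub_le_factorization_sum {h : ℕ → ℂ} (h1 : h 1 = 1)
    (hmult : ∀ m n, h (m * n) = h m * h n) (hh : ∀ n, ‖h n‖ ≤ 1) (n : ℕ) (hn : n ≠ 0) :
    ‖1 - h n‖ ≤ n.factorization.sum fun p v => v * ‖1 - h p‖ := by
  induction n using Nat.recOnMul with
  | zero => exact absurd rfl hn
  | one => simp [h1]
  | prime p hp => rw [hp.factorization, Finsupp.sum_single_index] <;> simp
  | mul a b iha ihb =>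
    have ha : a ≠ 0 := left_ne_zero_of_mul hn
    have hb : b ≠ 0 := right_ne_zero_of_mul hn
    rw [Nat.factorization_mul ha hb, Finsupp.sum_add_index' (by simp) (by
      intros; push_cast; ring)]
    refine le_trans ?_ (add_le_add (iha ha) (ihb hb))
    rw [hmult]
    have : 1 - h a * h b = (1 - h a) + h a * (1 - h b) := by ring
    rw [this]
    refine (norm_add_le _ _).trans ?_
    rw [norm_mul]
    gcongr
    exact mul_le_of_le_one_left (norm_nonneg _) (hh a)

theorem sum_factorization_Ioc_le (N : ℕ) {p : ℕ} (hp : p.Prime) :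
    ∑ n ∈ Ioc 0 N, (n.factorization p : ℝ) ≤ 2 * N * (1 / p : ℝ) := by
  have h1 : ∑ n ∈ Ioc 0 N, n.factorization p = (N.factorial).factorization p := by
    have : N.factorial = ∏ n ∈ Ioc 0 N, n := by
      rw [← prod_Ico_id_eq_factorial]
      refine prod_congr ?_ fun _ _ => rfl
      ext; simp; omega
    rw [this, Nat.factorization_prod (by intro x hx; simp at hx; omega), Finsupp.finsetSum_apply]
  have : Fact p.Prime := ⟨hp⟩
  have h2 : (p - 1) * (N.factorial).factorization p ≤ N := by
    rw [Nat.factorization_def _ hp, sub_one_mul_padicValNat_factorial]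
    exact Nat.sub_le _ _
  have h3 : p * (N.factorial).factorization p ≤ 2 * N := by
    have : p ≤ 2 * (p - 1) := by have := hp.two_le; omega
    calc _ ≤ 2 * (p - 1) * (N.factorial).factorization p := Nat.mul_le_mul_right _ this
      _ = 2 * ((p - 1) * (N.factorial).factorization p) := by ring
      _ ≤ _ := by omega
  have h4 : ∑ n ∈ Ioc 0 N, (n.factorization p : ℝ) = ((N.factorial).factorization p : ℝ) := by
    rw [← h1]; push_cast; rfl
  rw [h4, mul_one_div, le_div_iff₀ (by exact_mod_cast hp.pos), mul_comm]
  exact_mod_cast h3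

theorem pow_succ_dvd_of_dvd_div_gcd {n M K p : ℕ} (hn : n ≠ 0) (hM : M ≠ 0) (hp : p.Prime)
    (hpM : p ∣ M) (h : p ∣ n / Nat.gcd n (M ^ K)) : p ^ (K + 1) ∣ n := by
  have h0 : M ^ K ≠ 0 := pow_ne_zero _ hM
  have hg : Nat.gcd n (M ^ K) ≠ 0 := Nat.gcd_ne_zero_left hn
  have h1 : p * Nat.gcd n (M ^ K) ∣ n :=
    Nat.mul_dvd_of_dvd_div (Nat.gcd_dvd_left _ _) (by exact h) |> fun h => by
      rwa [mul_comm] at h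
  by_contra hnd
  have h2 : n.factorization p < K + 1 := by
    by_contra hc
    exact hnd ((hp.pow_dvd_iff_le_factorization hn).2 (not_lt.1 hc))
  have h3 : p ^ n.factorization p ∣ Nat.gcd n (M ^ K) :=
    Nat.dvd_gcd (Nat.ordProj_dvd _ _)
      ((pow_dvd_pow p (Nat.lt_succ_iff.1 h2)).trans (pow_dvd_pow_of_dvd hpM K))
  have h4 : p ^ (n.factorization p + 1) ∣ n := by
    rw [pow_succ, mul_comm]; exact (mul_dvd_mul_left p h3).trans h1
  have := (hp.pow_dvd_iff_le_factorization hn).1 h4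
  omega

theorem card_filter_dvd_Ioc_le (N d : ℕ) :
    (((Ioc 0 N).filter (d ∣ ·)).card : ℝ) ≤ N / d := by
  rw [Nat.Ioc_filter_dvd_card_eq_div]
  exact Nat.cast_div_le

theorem limitPeriodic_of_prime_sum {f : ℕ → ℝ} (h1 : f 1 = 1)
    (hmult : ∀ m n, f (m * n) = f m * f n) (hbound : ∀ n, |f n| ≤ 1)
    {r : ℕ} [NeZero r] (χ : DirichletCharacter ℂ r) {D : ℝ}
    (hD : ∀ P : Finset ℕ, (∀ p ∈ P, p.Prime) →
      ∑ p ∈ P, (1 / p : ℝ) * ‖1 - (f p : ℂ) * χ p‖ ≤ D) : LimitPeriodic f := by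
  intro ε hε
  set h : ℕ → ℂ := fun n => (f n : ℂ) * χ n with hh
  have hh1 : h 1 = 1 := by simp [hh, h1]
  have hhm : ∀ m n, h (m * n) = h m * h n := by
    intro m n; simp only [hh, hmult]; push_cast; rw [map_mul]; ring
  have hhb : ∀ n, ‖h n‖ ≤ 1 := by
    intro n
    simp only [hh, norm_mul, Complex.norm_real, Real.norm_eq_abs]
    exact mul_le_one₀ (hbound n) (norm_nonneg _) (χ.norm_le_one _)
  set w : ℕ → ℝ := fun p => if p.Prime then (1 / p : ℝ) * ‖1 - h p‖ else 0 with hw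
  have hw0 : ∀ p, 0 ≤ w p := by intro p; simp only [hw]; split_ifs <;> positivity
  have hws : Summable w := by
    refine summable_of_sum_le hw0 (c := D) fun u => ?_
    rw [← sum_filter]
    exact hD _ (by intro p hp; exact (mem_filter.1 hp).2)
  obtain ⟨s, hs⟩ := summable_iff_vanishing_norm.1 hws (ε / 4) (by positivity)
  set M : ℕ := r * ∏ p ∈ s.filter Nat.Prime, p with hM
  have hM0 : M ≠ 0 := mul_ne_zero (NeZero.ne r)
    (prod_ne_zero_iff.2 fun p hp => (mem_filter.1 hp).2.ne_zero)
  obtain ⟨K, hK⟩ : ∃ K : ℕ, 2 * M.primeFactors.card * (1 / 2 : ℝ) ^ K ≤ ε / 2 := by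
    have := (tendsto_pow_atTop_nhds_zero_of_lt_one (r := (1 / 2 : ℝ)) (by norm_num)
      (by norm_num)).const_mul (2 * M.primeFactors.card : ℝ)
    rw [mul_zero] at this
    exact (this.eventually (ge_mem_nhds (by positivity : (0 : ℝ) < ε / 2))).exists
  set φ : ℕ → ℝ := fun n =>
    f (Nat.gcd n (M ^ K)) * (starRingEnd ℂ (χ ((n / Nat.gcd n (M ^ K) : ℕ) : ZMod r))).re with hφ
  have hφb : ∀ n, |φ n| ≤ 1 := by
    intro n
    simp only [hφ, abs_mul]
    refine mul_le_one₀ (hbound _) (abs_nonneg _) ((Complex.abs_re_le_norm _).trans ?_)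
    rw [RCLike.norm_conj]; exact χ.norm_le_one _
  refine ⟨r * M ^ K, Nat.pos_of_ne_zero (mul_ne_zero (NeZero.ne r) (pow_ne_zero _ hM0)), φ, ?_,
    hφb, fun N => ?_⟩
  · intro n
    have e1 : Nat.gcd (n + r * M ^ K) (M ^ K) = Nat.gcd n (M ^ K) := by simp
    have e2 : (((n + r * M ^ K) / Nat.gcd n (M ^ K) : ℕ) : ZMod r)
        = ((n / Nat.gcd n (M ^ K) : ℕ) : ZMod r) := by
      rw [Nat.add_div_of_dvd_right (Nat.gcd_dvd_left _ _),
        Nat.mul_div_assoc _ (Nat.gcd_dvd_right _ _)]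
      push_cast; simp
    simp only [hφ, e1, e2]
  · have key : ∀ n ∈ Ioc 0 N, |f n - φ n| ≤
        (∑ p ∈ M.primeFactors, if p ^ (K + 1) ∣ n then (2 : ℝ) else 0)
        + ∑ p ∈ (Ioc 0 N \ s).filter Nat.Prime, (n.factorization p : ℝ) * ‖1 - h p‖ := by
      intro n hn
      have hn0 : n ≠ 0 := by simp at hn; omega
      have hA : 0 ≤ ∑ p ∈ M.primeFactors, if p ^ (K + 1) ∣ n then (2 : ℝ) else 0 :=
        sum_nonneg fun _ _ => by split_ifs <;> norm_num
      have hB : 0 ≤ ∑ p ∈ (Ioc 0 N \ s).filter Nat.Prime,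
          (n.factorization p : ℝ) * ‖1 - h p‖ := sum_nonneg fun _ _ => by positivity
      by_cases hbad : ∃ p ∈ M.primeFactors, p ^ (K + 1) ∣ n
      · obtain ⟨p, hp, hpn⟩ := hbad
        have h2 : (2 : ℝ) ≤ ∑ p ∈ M.primeFactors, if p ^ (K + 1) ∣ n then (2 : ℝ) else 0 := by
          have := single_le_sum (f := fun p => if p ^ (K + 1) ∣ n then (2 : ℝ) else 0)
            (fun _ _ => by positivity) hp
          simpa [hpn] using this
        have h3 : |f n - φ n| ≤ 2 := by
          refine (abs_sub _ _).trans ?_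
          linarith [hbound n, hφb n]
        linarith
      · push Not at hbad
        set d := Nat.gcd n (M ^ K) with hd
        set n' := n / d with hn'
        have hdn : d ∣ n := Nat.gcd_dvd_left _ _
        have hnd : d * n' = n := Nat.mul_div_cancel' hdn
        have hn'0 : n' ≠ 0 := by intro h; rw [h, mul_zero] at hnd; exact hn0 hnd.symm
        have hcop : ∀ p, p.Prime → p ∣ M → ¬ p ∣ n' := fun p hp hpM hpn =>
          hbad p (Nat.mem_primeFactors.2 ⟨hp, hpM, hM0⟩)
            (pow_succ_dvd_of_dvd_div_gcd hn0 hM0 hp hpM hpn)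
        have hunit : IsUnit ((n' : ℕ) : ZMod r) := by
          rw [ZMod.isUnit_iff_coprime]
          refine Nat.Coprime.symm (Nat.Coprime.symm (Nat.coprime_of_dvd fun p hp hpn hpr =>
            hcop p hp (hpr.trans (Dvd.intro _ rfl)) hpn))
        have hχ1 : ‖χ ((n' : ℕ) : ZMod r)‖ = 1 := by
          obtain ⟨u, hu⟩ := hunit
          rw [← hu]; exact χ.unit_norm_eq_one u
        have hconj : χ ((n' : ℕ) : ZMod r) * starRingEnd ℂ (χ ((n' : ℕ) : ZMod r)) = 1 := by
          rw [RCLike.mul_conj, hχ1]; simp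
        have e1 : f n - φ n = f d *
            ((starRingEnd ℂ (χ ((n' : ℕ) : ZMod r))) * (h n' - 1)).re := by
          have : (starRingEnd ℂ (χ ((n' : ℕ) : ZMod r))) * (h n' - 1)
              = (f n' : ℂ) - starRingEnd ℂ (χ ((n' : ℕ) : ZMod r)) := by
            simp only [hh]
            linear_combination (f n' : ℂ) * hconj
          rw [this, Complex.sub_re, Complex.ofReal_re, mul_sub, ← hmult, hnd]
        have e2 : |f n - φ n| ≤ ‖1 - h n'‖ := by
          rw [e1, abs_mul]
          refine (mul_le_of_le_one_left (abs_nonneg _) (hbound d)).trans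
            ((Complex.abs_re_le_norm _).trans ?_)
          rw [norm_mul, RCLike.norm_conj, hχ1, one_mul, norm_sub_rev]
        refine e2.trans (le_trans ?_ (le_add_of_nonneg_left hA))
        refine (norm_one_sub_le_factorization_sum hh1 hhm hhb n' hn'0).trans ?_
        rw [Finsupp.sum, Nat.support_factorization]
        refine (sum_le_sum_of_subset_of_nonneg (t := (Ioc 0 N \ s).filter Nat.Prime) ?_
          (fun _ _ _ => by positivity)).trans (sum_le_sum fun p _ => ?_)
        · intro p hp
          have hpp := Nat.prime_of_mem_primeFactors hp
          have hpn := Nat.dvd_of_mem_primeFactors hp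
          refine mem_filter.2 ⟨mem_sdiff.2 ⟨mem_Ioc.2 ⟨hpp.pos, ?_⟩, fun hps => ?_⟩, hpp⟩
          · refine (Nat.le_of_dvd (Nat.pos_of_ne_zero hn0) (hpn.trans ?_)).trans (mem_Ioc.1 hn).2
            exact ⟨d, by rw [mul_comm]; exact hnd.symm⟩
          · exact hcop p hpp (Dvd.dvd.mul_left (dvd_prod_of_mem _ (mem_filter.2 ⟨hps, hpp⟩)) _) hpn
        · gcongr
          exact (Nat.factorization_le_iff_dvd hn'0 hn0).2 ⟨d, by rw [mul_comm]; exact hnd.symm⟩ p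
    refine (sum_le_sum key).trans ?_
    rw [sum_add_distrib, sum_comm, sum_comm (s := Ioc 0 N) (t := (Ioc 0 N \ s).filter Nat.Prime)]
    have hN0 : (0 : ℝ) ≤ N := Nat.cast_nonneg N
    have hfirst : ∑ p ∈ M.primeFactors, ∑ n ∈ Ioc 0 N, (if p ^ (K + 1) ∣ n then (2 : ℝ) else 0)
        ≤ ε / 2 * N := by
      have : ∀ p ∈ M.primeFactors, ∑ n ∈ Ioc 0 N, (if p ^ (K + 1) ∣ n then (2 : ℝ) else 0)
          ≤ 2 * (1 / 2 : ℝ) ^ K * N := by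
        intro p hp
        have hpp := Nat.prime_of_mem_primeFactors hp
        rw [← sum_filter, sum_const, nsmul_eq_mul, mul_comm, mul_assoc]
        have h3 := card_filter_dvd_Ioc_le N (p ^ (K + 1))
        have h4 : (2 : ℝ) ^ K ≤ ((p ^ (K + 1) : ℕ) : ℝ) := by
          have : 2 ^ K ≤ p ^ (K + 1) := (Nat.pow_le_pow_left hpp.two_le K).trans
            (Nat.pow_le_pow_right hpp.pos (Nat.le_succ K))
          exact_mod_cast this
        have h5 : (N : ℝ) / ((p ^ (K + 1) : ℕ) : ℝ) ≤ (1 / 2 : ℝ) ^ K * N := by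
          rw [one_div, inv_pow, inv_mul_eq_div]
          gcongr
        linarith
      refine (sum_le_sum this).trans ?_
      rw [sum_const, nsmul_eq_mul]
      calc _ = 2 * M.primeFactors.card * (1 / 2 : ℝ) ^ K * N := by ring
        _ ≤ _ := by gcongr
    have hsecond : ∑ p ∈ (Ioc 0 N \ s).filter Nat.Prime, ∑ n ∈ Ioc 0 N,
        (n.factorization p : ℝ) * ‖1 - h p‖ ≤ ε / 2 * N := by
      have h3 := hs (Ioc 0 N \ s) sdiff_disjoint
      rw [← sum_filter, Real.norm_eq_abs] at h3
      have h4 := (le_abs_self _).trans h3.le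
      calc _ ≤ ∑ p ∈ (Ioc 0 N \ s).filter Nat.Prime, 2 * N * ((1 / p : ℝ) * ‖1 - h p‖) := by
            refine sum_le_sum fun p hp => ?_
            rw [← sum_mul, ← mul_assoc]
            gcongr
            exact sum_factorization_Ioc_le N (mem_filter.1 hp).2
        _ ≤ 2 * N * (ε / 4) := by rw [← mul_sum]; gcongr
        _ = _ := by ring
    linarith

theorem aperiodic_or_limitPeriodic {f : ℕ → ℝ} (hmult : ∀ m n, f (m * n) = f m * f n)
    (hbound : ∀ n, |f n| ≤ 1) : Aperiodic f ∨ LimitPeriodic f := by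
  by_cases h1 : f 1 = 0
  · left
    have h0 : ∀ n, f n = 0 := fun n => by rw [← mul_one n, hmult, h1, mul_zero]
    intro d _ r
    simp [residueSum, h0]
  have h1' : f 1 = 1 := by
    have := hmult 1 1
    rw [mul_one] at this
    exact mul_left_cancel₀ h1 (by rw [mul_one]; exact this.symm)
  by_cases hdiv : ∀ D : ℝ, ∃ P : Finset ℕ, (∀ p ∈ P, p.Prime) ∧ D ≤ ∑ p ∈ P, (1 / p : ℝ) * (1 - |f p|)
  · exact Or.inl (aperiodic_of_prime_sum hmult hbound hdiv)
  push Not at hdiv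
  obtain ⟨E, hE⟩ := hdiv
  by_cases hall : ∀ r : ℕ, [NeZero r] → ∀ χ : DirichletCharacter ℂ r,
      NonPretentious fun n => (f n : ℂ) * χ n
  · left
    refine aperiodic_of_characters hmult hbound fun r _ χ => ?_
    refine (hall r χ).tendsto_meanUpTo ?_ ?_
    · intro m n; simp only [hmult]; push_cast; rw [map_mul]; ring
    · intro n
      simp only [norm_mul, Complex.norm_real, Real.norm_eq_abs]
      exact mul_le_one₀ (hbound n) (norm_nonneg _) (χ.norm_le_one _)
  · right
    push Not at hall
    obtain ⟨r, hr, χ, hχ⟩ := hall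
    obtain ⟨D, hD⟩ := sum_norm_one_sub_le_of_not_nonPretentious hbound
      (fun P hP => (hE P hP).le) χ hχ
    exact limitPeriodic_of_prime_sum h1' hmult hbound χ hD

theorem sum_zmod_Icc {q : ℕ} [Fact q.Prime] {N : ℕ} (hN : N < q) (h : ℕ → ℝ) :
    ∑ x : ZMod q, (if x.val ∈ Icc 1 N then h x.val else 0) = ∑ n ∈ Icc 1 N, h n := by
  rw [sum_zmod (q := q) fun n => if n ∈ Icc 1 N then h n else 0, sum_ite_mem,
    inter_eq_right.2]
  intro n hn
  simp only [mem_Icc] at hn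
  exact mem_range.2 (by omega)

theorem abs_tent_sum_le {t : ℕ} {g₀ : ℕ → ℝ} {g : Fin t → ℕ → ℝ} {a₀ b₀ : ℕ} {a b : Fin t → ℕ}
    (hg : ∀ i n, |g i n| ≤ 1) {q N W : ℕ} [Fact q.Prime]
    (hW : (a₀ + b₀) * N ≤ W) (hq : 2 * W ≤ q) (hab : ∀ i, (a i + b i) * N < q) (hNq : N < q)
    (ha₀ : (a₀ : ZMod q) ≠ 0) (hb₀ : (b₀ : ZMod q) ≠ 0) (hpos : 0 < a₀)
    (hcross : ∀ i, (a₀ : ZMod q) * b i - b₀ * a i ≠ 0) {δ : ℝ} (hδ : 0 ≤ δ)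
    (hU : gowersU (t + 2) (localFn q W g₀) ≤ δ ^ 2 ^ (t + 2)) :
    |∑ m ∈ Icc 1 N, ∑ n ∈ Icc 1 N, g₀ (a₀ * m + b₀ * n) * ((W - (a₀ * m + b₀ * n) : ℕ) / W)
      * ∏ i, g i (a i * m + b i * n)| ≤ q ^ 2 * δ := by
  set ψ : Fin (t + 1 + 1) → ZMod q × ZMod q → ℝ :=
    Fin.cons (fun X => if X.1.val ∈ Icc 1 N then 1 else 0)
      (Fin.cons (fun X => if X.2.val ∈ Icc 1 N then 1 else 0)
        fun i X => g i (a i * X.1 + b i * X.2).val) with hψ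
  set M : Fin (t + 1 + 1) → ZMod q × ZMod q :=
    Fin.cons (0, 1) (Fin.cons (1, 0) fun i => ((b i : ZMod q), -(a i : ZMod q))) with hM
  set L : ZMod q × ZMod q →ₗ[ZMod q] ZMod q :=
    (a₀ : ZMod q) • LinearMap.fst (ZMod q) (ZMod q) (ZMod q)
      + (b₀ : ZMod q) • LinearMap.snd (ZMod q) (ZMod q) (ZMod q) with hL
  have hLX : ∀ X, L X = a₀ * X.1 + b₀ * X.2 := fun X => by simp [hL]
  have h1 := generalized_von_neumann L (t + 1) M (by
    intro i
    refine Fin.cases ?_ (fun i => Fin.cases ?_ (fun i => ?_) i) i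
    · simpa [hM, hLX] using hb₀
    · simpa [hM, hLX] using ha₀
    · have := hcross i
      simp only [hM, hLX, Fin.cons_succ]
      rwa [mul_neg, ← sub_eq_add_neg]) ψ (by
    intro i X
    refine Fin.cases ?_ (fun i => Fin.cases ?_ (fun i => ?_) i) i
    · simp only [hψ, Fin.cons_zero]; split_ifs <;> simp
    · simp only [hψ, Fin.cons_zero, Fin.cons_succ]; split_ifs <;> simp
    · simpa [hψ] using hg i _) (by
    intro i s X
    refine Fin.cases ?_ (fun i => Fin.cases ?_ (fun i => ?_) i) i
    · simp [hψ, hM]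
    · simp [hψ, hM]
    · simp only [hψ, hM, Fin.cons_succ, Prod.fst_add, Prod.snd_add, Prod.smul_fst, Prod.smul_snd,
        smul_eq_mul]
      congr 2; ring) (localFn q W g₀)
  have h2 : |𝔼 X, localFn q W g₀ (L X) * ∏ i, ψ i X| ≤ δ := by
    refine le_of_pow_le_pow_left₀ (pow_ne_zero _ two_ne_zero) hδ (h1.trans hU)
  have hq0 : (0 : ℝ) < q := by exact_mod_cast (Fact.out : q.Prime).pos
  have h3 : ∑ X : ZMod q × ZMod q, localFn q W g₀ (L X) * ∏ i, ψ i X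
      = ∑ m ∈ Icc 1 N, ∑ n ∈ Icc 1 N, g₀ (a₀ * m + b₀ * n) * ((W - (a₀ * m + b₀ * n) : ℕ) / W)
        * ∏ i, g i (a i * m + b i * n) := by
    rw [Fintype.sum_prod_type, ← sum_zmod_Icc (q := q) hNq]
    refine sum_congr rfl fun x _ => ?_
    by_cases hx : x.val ∈ Icc 1 N
    · rw [if_pos hx, ← sum_zmod_Icc (q := q) hNq]
      refine sum_congr rfl fun y _ => ?_
      rw [Fin.prod_univ_succ, Fin.prod_univ_succ]
      by_cases hy : y.val ∈ Icc 1 N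
      · rw [if_pos hy]
        simp only [hψ, Fin.cons_zero, Fin.cons_succ, if_pos hx, if_pos hy, one_mul, hLX]
        rw [mem_Icc] at hx hy
        have hcast : ∀ c d : ℕ, (c + d) * N < q →
            ((c : ZMod q) * x + d * y) = ((c * x.val + d * y.val : ℕ) : ZMod q) ∧
            ((c : ZMod q) * x + d * y).val = c * x.val + d * y.val := by
          intro c d hcd
          have e : ((c : ZMod q) * x + d * y) = ((c * x.val + d * y.val : ℕ) : ZMod q) := by
            push_cast; simp
          refine ⟨e, ?_⟩
          rw [e, ZMod.val_cast_of_lt]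
          refine lt_of_le_of_lt ?_ hcd
          rw [add_mul]
          exact add_le_add (Nat.mul_le_mul_left _ hx.2) (Nat.mul_le_mul_left _ hy.2)
        have hu : a₀ * x.val + b₀ * y.val ≤ W := by
          refine le_trans ?_ hW
          rw [add_mul]
          exact add_le_add (Nat.mul_le_mul_left _ hx.2) (Nat.mul_le_mul_left _ hy.2)
        have hu0 : 0 < a₀ * x.val + b₀ * y.val :=
          Nat.add_pos_left (Nat.mul_pos hpos hx.1) _
        have h0 := hcast a₀ b₀ (by omega)
        congr 1
        · unfold localFn
          rw [h0.2, if_pos (mem_Ioc.2 ⟨hu0, hu⟩), h0.1, tent_natCast (by omega)]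
        · exact prod_congr rfl fun i _ => by rw [(hcast _ _ (hab i)).2]
      · simp only [hψ, Fin.cons_zero, Fin.cons_succ, if_neg hy, zero_mul, mul_zero]
    · rw [if_neg hx]
      refine sum_eq_zero fun y _ => ?_
      rw [Fin.prod_univ_succ]
      simp only [hψ, Fin.cons_zero, if_neg hx, zero_mul, mul_zero]
  rw [Fintype.expect_eq_sum_div_card, h3, Fintype.card_prod, ZMod.card, abs_div] at h2
  have hqq : (0 : ℝ) < ((q * q : ℕ) : ℝ) := by push_cast; positivity
  rw [abs_of_pos hqq, div_le_iff₀ hqq] at h2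
  refine h2.trans (le_of_eq ?_)
  push_cast
  ring

theorem tendsto_box_average_of_locallyUniform {t : ℕ} {g₀ : ℕ → ℝ} {g : Fin t → ℕ → ℝ}
    {a₀ b₀ : ℕ} {a b : Fin t → ℕ} (hg₀ : ∀ n, |g₀ n| ≤ 1) (hg : ∀ i n, |g i n| ≤ 1)
    (ha₀ : 0 < a₀) (hb₀ : 0 < b₀) (hcross : ∀ i, a₀ * b i ≠ b₀ * a i)
    (hU : LocallyUniform (t + 2) g₀) :
    Tendsto (fun N : ℕ => (∑ m ∈ Icc 1 N, ∑ n ∈ Icc 1 N,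
      g₀ (a₀ * m + b₀ * n) * ∏ i, g i (a i * m + b i * n)) / (N : ℝ) ^ 2) atTop (nhds 0) := by
  obtain ⟨B, hB₀, hB⟩ : ∃ B, a₀ + b₀ ≤ B ∧ ∀ i, a i + b i ≤ B :=
    ⟨a₀ + b₀ + ∑ i, (a i + b i), Nat.le_add_right _ _, fun i =>
      (single_le_sum (f := fun i => a i + b i) (fun _ _ => Nat.zero_le _) (mem_univ i)).trans
        (Nat.le_add_left _ _)⟩
  rw [Metric.tendsto_atTop]
  intro ε hε
  obtain ⟨R, hR⟩ := exists_nat_gt (4 / ε)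
  have hR0 : (0 : ℝ) < R := lt_trans (by positivity) hR
  have hR0' : 0 < R := by exact_mod_cast hR0
  set δ : ℝ := ε / 4 / (20 * R * B) ^ 2 with hδ
  have hB1 : 0 < B := by omega
  have hBr : (0 : ℝ) < B := by exact_mod_cast hB1
  have hδ0 : 0 < δ := by positivity
  obtain ⟨N₀, hN₀⟩ := hU (δ ^ 2 ^ (t + 2)) (by positivity)
  refine ⟨max N₀ (B ^ 2 + 1), fun N hN => ?_⟩
  have hN1 : N₀ ≤ N := (le_max_left _ _).trans hN
  have hN2 : B ^ 2 + 1 ≤ N := (le_max_right _ _).trans hN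
  set W := R * B * N with hW
  have hNW : B * N ≤ W := by rw [hW, mul_assoc]; exact Nat.le_mul_of_pos_left _ hR0'
  have hNW' : N ≤ W := (Nat.le_mul_of_pos_left _ hB1).trans hNW
  obtain ⟨q, hqp, hq1, hq2⟩ := Nat.exists_prime_lt_and_le_two_mul (10 * W) (by omega)
  have : Fact q.Prime := ⟨hqp⟩
  have hBB : B ≤ B ^ 2 := by nlinarith
  have hsmall : ∀ c : ℕ, 0 < c → c ≤ B → (c : ZMod q) ≠ 0 := fun c h1 h2 =>
    natCast_zmod_ne_zero h1 (by omega)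
  have hcr : ∀ i, (a₀ : ZMod q) * b i - b₀ * a i ≠ 0 := by
    intro i h
    rw [sub_eq_zero] at h
    have h' : ((a₀ * b i : ℕ) : ZMod q) = ((b₀ * a i : ℕ) : ZMod q) := by push_cast; exact h
    rw [ZMod.natCast_eq_natCast_iff] at h'
    have hi := hB i
    have l1 : a₀ * b i ≤ B ^ 2 := by rw [sq]; exact Nat.mul_le_mul (by omega) (by omega)
    have l2 : b₀ * a i ≤ B ^ 2 := by rw [sq]; exact Nat.mul_le_mul (by omega) (by omega)
    exact hcross i (Nat.ModEq.eq_of_lt_of_lt h' (by omega) (by omega))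
  have hmain := abs_tent_sum_le (g₀ := g₀) (a₀ := a₀) (b₀ := b₀) (a := a) (b := b) hg (q := q)
    (N := N) (W := W) ((Nat.mul_le_mul_right _ hB₀).trans hNW) (by omega)
    (fun i => lt_of_le_of_lt ((Nat.mul_le_mul_right _ (hB i)).trans hNW) (by omega)) (by omega)
    (hsmall a₀ ha₀ (by omega)) (hsmall b₀ hb₀ (by omega)) ha₀ hcr hδ0.le
    (hN₀ W (by omega) q (by omega) (by omega))
  have hNr : (0 : ℝ) < N := by
    have : 0 < N := by omega
    exact_mod_cast this
  have hWr : (0 : ℝ) < W := by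
    have : 0 < W := by omega
    exact_mod_cast this
  have hdiff : |(∑ m ∈ Icc 1 N, ∑ n ∈ Icc 1 N,
      g₀ (a₀ * m + b₀ * n) * ∏ i, g i (a i * m + b i * n))
      - ∑ m ∈ Icc 1 N, ∑ n ∈ Icc 1 N, g₀ (a₀ * m + b₀ * n) * ((W - (a₀ * m + b₀ * n) : ℕ) / W)
      * ∏ i, g i (a i * m + b i * n)| ≤ N ^ 2 * (1 / R) := by
    simp_rw [← sum_sub_distrib]
    refine (abs_sum_le_sum_abs _ _).trans ?_
    have hpt : ∀ m ∈ Icc 1 N, |∑ n ∈ Icc 1 N, (g₀ (a₀ * m + b₀ * n) * ∏ i, g i (a i * m + b i * n)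
        - g₀ (a₀ * m + b₀ * n) * ((W - (a₀ * m + b₀ * n) : ℕ) / W)
        * ∏ i, g i (a i * m + b i * n))| ≤ N * (1 / R) := by
      intro m hm
      refine (abs_sum_le_sum_abs _ _).trans ?_
      refine (sum_le_card_nsmul _ _ (1 / R : ℝ) fun n hn => ?_).trans (by simp)
      rw [mem_Icc] at hm hn
      have hu : a₀ * m + b₀ * n ≤ B * N := by
        refine le_trans ?_ (Nat.mul_le_mul_right _ hB₀)
        rw [add_mul]
        exact add_le_add (Nat.mul_le_mul_left _ hm.2) (Nat.mul_le_mul_left _ hn.2)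
      have e : g₀ (a₀ * m + b₀ * n) * ∏ i, g i (a i * m + b i * n)
        - g₀ (a₀ * m + b₀ * n) * ((W - (a₀ * m + b₀ * n) : ℕ) / W)
        * ∏ i, g i (a i * m + b i * n) = g₀ (a₀ * m + b₀ * n) * (∏ i, g i (a i * m + b i * n))
          * ((a₀ * m + b₀ * n : ℕ) / W) := by
        rw [Nat.cast_sub (hu.trans hNW), sub_div, div_self hWr.ne']; ring
      rw [e, abs_mul, abs_mul]
      have h5 : |∏ i, g i (a i * m + b i * n)| ≤ 1 := by
        rw [abs_prod]; exact prod_le_one (fun _ _ => abs_nonneg _) fun i _ => hg i _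
      refine (mul_le_of_le_one_left (abs_nonneg _)
        (mul_le_one₀ (hg₀ _) (abs_nonneg _) h5)).trans ?_
      rw [abs_of_nonneg (by positivity), div_le_div_iff₀ hWr hR0, one_mul]
      have : (a₀ * m + b₀ * n) * R ≤ W := by
        rw [hW, mul_assoc, mul_comm R]; exact Nat.mul_le_mul_right _ hu
      exact_mod_cast this
    refine (sum_le_card_nsmul _ _ _ hpt).trans (le_of_eq ?_)
    simp; ring
  rw [dist_zero_right, Real.norm_eq_abs, abs_div, abs_of_pos (by positivity : (0 : ℝ) < N ^ 2),
    div_lt_iff₀ (by positivity)]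
  have hqr : (q : ℝ) ≤ 20 * R * B * N := by
    have : q ≤ 20 * R * B * N := by
      calc q ≤ 20 * W := by omega
        _ = _ := by rw [hW]; ring
    exact_mod_cast this
  have h6 : (q : ℝ) ^ 2 * δ ≤ ε / 4 * N ^ 2 := by
    calc (q : ℝ) ^ 2 * δ ≤ (20 * R * B * N) ^ 2 * δ := by gcongr
      _ = ε / 4 * N ^ 2 := by rw [hδ]; field_simp
  have h7 : (N : ℝ) ^ 2 * (1 / R) ≤ ε / 4 * N ^ 2 := by
    rw [mul_comm]
    refine mul_le_mul_of_nonneg_right ?_ (by positivity)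
    rw [div_lt_iff₀ hε] at hR
    rw [div_le_iff₀ hR0]; linarith
  have h8 := abs_sub_abs_le_abs_sub (∑ m ∈ Icc 1 N, ∑ n ∈ Icc 1 N,
      g₀ (a₀ * m + b₀ * n) * ∏ i, g i (a i * m + b i * n))
      (∑ m ∈ Icc 1 N, ∑ n ∈ Icc 1 N, g₀ (a₀ * m + b₀ * n) * ((W - (a₀ * m + b₀ * n) : ℕ) / W)
      * ∏ i, g i (a i * m + b i * n))
  have h9 : 0 < ε * (N : ℝ) ^ 2 := by positivity
  linarith

/-- The number of `n ≤ N` with `n ≡ r` modulo `M`, divided by `N`, converges. -/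
theorem tendsto_residue_density {M : ℕ} (hM : 0 < M) (r : ℕ) :
    Tendsto (fun N : ℕ => (((Icc 1 N).filter (· % M = r)).card : ℝ) / N) atTop
      (nhds (if r < M then 1 / M else 0)) := by
  split_ifs with hr
  · have hMr : (0 : ℝ) < M := by exact_mod_cast hM
    have hb : ∀ N : ℕ, |((((Icc 1 N).filter (· % M = r)).card : ℝ)) - N / M| ≤ 2 := by
      intro N
      have h1 : (Icc 1 N).filter (· % M = r) = (Ioc 0 N).filter (· ≡ r [MOD M]) := by
        ext n
        simp only [mem_filter, mem_Icc, mem_Ioc, Nat.ModEq, Nat.mod_eq_of_lt hr]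
        rfl
      have h2 := Nat.Ioc_filter_modEq_card 0 N hM r
      rw [h1]
      have h3 : ⌊((0 : ℕ) - (r : ℚ)) / M⌋ ≤ ⌊((N : ℚ) - r) / M⌋ := by
        apply Int.floor_le_floor; gcongr; simp
      rw [max_eq_left (by linarith)] at h2
      have h4 : (((((Ioc 0 N).filter (· ≡ r [MOD M])).card : ℤ) : ℚ))
          = ⌊((N : ℚ) - r) / M⌋ - ⌊((0 : ℕ) - (r : ℚ)) / M⌋ := by
        rw [h2]; push_cast; rfl
      have a1 := Int.floor_le (((N : ℚ) - r) / M)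
      have a2 := Int.lt_floor_add_one (((N : ℚ) - r) / M)
      have a3 := Int.floor_le (((0 : ℕ) - (r : ℚ)) / M)
      have a4 := Int.lt_floor_add_one (((0 : ℕ) - (r : ℚ)) / M)
      have e : ((N : ℚ) - r) / M - ((0 : ℕ) - (r : ℚ)) / M = N / M := by push_cast; ring
      have h5 : |((((Ioc 0 N).filter (· ≡ r [MOD M])).card : ℚ)) - N / M| ≤ 2 := by
        rw [abs_le]
        push_cast at h4 e a3 a4
        constructor <;> linarith
      have h6 := (Rat.cast_le (K := ℝ)).2 h5
      push_cast at h6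
      exact h6
    have h1 : Tendsto (fun N : ℕ => ((((Icc 1 N).filter (· % M = r)).card : ℝ) - N / M) / N)
        atTop (nhds 0) := by
      refine squeeze_zero_norm (fun N => ?_) (tendsto_const_div_atTop_nhds_zero_nat 2)
      rw [norm_div, Real.norm_eq_abs, RCLike.norm_natCast]
      gcongr
      exact hb N
    have h2 := h1.add_const (1 / M : ℝ)
    rw [zero_add] at h2
    refine h2.congr' ?_
    filter_upwards [eventually_gt_atTop 0] with N hN
    have : (N : ℝ) ≠ 0 := by exact_mod_cast hN.ne'
    field_simp
    ring
  · have : ∀ N : ℕ, (Icc 1 N).filter (· % M = r) = ∅ := by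
      intro N
      refine filter_eq_empty_iff.2 fun n _ h => hr ?_
      rw [← h]; exact Nat.mod_lt _ hM
    simp [this]

theorem sum_periodic {M : ℕ} (hM : 0 < M) {u : ℕ → ℝ} (hu : Function.Periodic u M) (N : ℕ) :
    ∑ n ∈ Icc 1 N, u n = ∑ r ∈ range M, u r * ((Icc 1 N).filter (· % M = r)).card := by
  rw [← sum_fiberwise_of_maps_to (g := fun n => n % M) (t := range M)
    fun n _ => mem_range.2 (Nat.mod_lt _ hM)]
  refine sum_congr rfl fun r _ => ?_
  rw [mul_comm, ← nsmul_eq_mul, ← sum_const]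
  refine sum_congr rfl fun n hn => ?_
  rw [← (mem_filter.1 hn).2, hu.map_mod_nat]

theorem tendsto_average_of_periodic {M : ℕ} (hM : 0 < M) {G : ℕ → ℕ → ℝ}
    (h1 : ∀ n, Function.Periodic (fun m => G m n) M) (h2 : ∀ m, Function.Periodic (G m) M) :
    ∃ A : ℝ, Tendsto (fun N : ℕ => (∑ m ∈ Icc 1 N, ∑ n ∈ Icc 1 N, G m n) / (N : ℝ) ^ 2) atTop
      (nhds A) := by
  have e : ∀ N : ℕ, (∑ m ∈ Icc 1 N, ∑ n ∈ Icc 1 N, G m n) / (N : ℝ) ^ 2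
      = ∑ r ∈ range M, ∑ s ∈ range M, G r s * ((((Icc 1 N).filter (· % M = r)).card : ℝ) / N)
        * ((((Icc 1 N).filter (· % M = s)).card : ℝ) / N) := by
    intro N
    rw [sum_periodic hM (u := fun m => ∑ n ∈ Icc 1 N, G m n) fun m =>
      sum_congr rfl fun n _ => h1 n m, sum_div]
    refine sum_congr rfl fun r _ => ?_
    rw [sum_periodic hM (h2 r), sum_mul, sum_div]
    refine sum_congr rfl fun s _ => ?_
    ring
  simp_rw [e]
  exact ⟨_, tendsto_finsetSum _ fun r _ => tendsto_finsetSum _ fun s _ =>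
    ((tendsto_residue_density hM r).const_mul _).mul (tendsto_residue_density hM s)⟩

theorem exists_tendsto_of_approx {u : ℕ → ℝ}
    (h : ∀ ε > 0, ∃ v : ℕ → ℝ, (∃ A : ℝ, Tendsto v atTop (nhds A)) ∧
      ∀ᶠ N in atTop, |u N - v N| ≤ ε) : ∃ A : ℝ, Tendsto u atTop (nhds A) := by
  refine cauchySeq_tendsto_of_complete (Metric.cauchySeq_iff'.2 fun ε hε => ?_)
  obtain ⟨v, ⟨A, hA⟩, hv⟩ := h (ε / 8) (by positivity)
  obtain ⟨N₀, hN₀⟩ := eventually_atTop.1 (hv.and (hA.eventually (Metric.ball_mem_nhds A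
    (by positivity : 0 < ε / 8))))
  refine ⟨N₀, fun n hn => ?_⟩
  obtain ⟨a1, a2⟩ := hN₀ n hn
  obtain ⟨b1, b2⟩ := hN₀ N₀ le_rfl
  rw [Real.dist_eq] at a2 b2
  rw [Real.dist_eq]
  rw [abs_lt] at a2 b2 ⊢
  rw [abs_le] at a1 b1
  constructor <;> linarith

theorem abs_prod_sub_prod_le {ι : Type*} (S : Finset ι) {u v : ι → ℝ} (hu : ∀ i, |u i| ≤ 1)
    (hv : ∀ i, |v i| ≤ 1) : |∏ i ∈ S, u i - ∏ i ∈ S, v i| ≤ ∑ i ∈ S, |u i - v i| := by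
  classical
  induction S using Finset.induction_on with
  | empty => simp
  | insert i S hi ih =>
    rw [prod_insert hi, prod_insert hi, sum_insert hi]
    have e : u i * ∏ j ∈ S, u j - v i * ∏ j ∈ S, v j
        = (u i - v i) * ∏ j ∈ S, u j + v i * (∏ j ∈ S, u j - ∏ j ∈ S, v j) := by ring
    have h1 : |∏ j ∈ S, u j| ≤ 1 := by
      rw [abs_prod]; exact prod_le_one (fun _ _ => abs_nonneg _) fun i _ => hu i
    rw [e]
    refine (abs_add_le _ _).trans ?_
    rw [abs_mul, abs_mul]
    exact add_le_add (mul_le_of_le_one_right (abs_nonneg _) h1)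
      ((mul_le_of_le_one_left (abs_nonneg _) (hv i)).trans ih)

theorem sum_linear_form_le {a b : ℕ} (hb : 0 < b) {w : ℕ → ℝ} (hw : ∀ n, 0 ≤ w n) (N : ℕ) :
    ∑ m ∈ Icc 1 N, ∑ n ∈ Icc 1 N, w (a * m + b * n) ≤ N * ∑ x ∈ Ioc 0 ((a + b) * N), w x := by
  refine (sum_le_card_nsmul _ _ (∑ x ∈ Ioc 0 ((a + b) * N), w x) fun m hm => ?_).trans
    (le_of_eq (by simp))
  have hinj : Set.InjOn (fun n => a * m + b * n) (Icc 1 N : Finset ℕ) := by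
    intro x _ y _ hxy
    exact Nat.eq_of_mul_eq_mul_left hb (Nat.add_left_cancel hxy)
  rw [← sum_image (f := w) hinj]
  refine sum_le_sum_of_subset_of_nonneg ?_ fun _ _ _ => hw _
  intro x hx
  obtain ⟨n, hn, rfl⟩ := mem_image.1 hx
  rw [mem_Icc] at hm hn
  refine mem_Ioc.2 ⟨Nat.add_pos_right _ (Nat.mul_pos hb hn.1), ?_⟩
  rw [add_mul]
  exact add_le_add (Nat.mul_le_mul_left _ hm.2) (Nat.mul_le_mul_left _ hn.2)

theorem exists_tendsto_of_limitPeriodic {ι : Type*} (S : Finset ι) {g : ι → ℕ → ℝ}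
    (hg : ∀ i n, |g i n| ≤ 1) {a b : ι → ℕ} (hb : ∀ i ∈ S, 0 < b i)
    (h : ∀ i ∈ S, LimitPeriodic (g i)) :
    ∃ A : ℝ, Tendsto (fun N : ℕ => (∑ m ∈ Icc 1 N, ∑ n ∈ Icc 1 N,
      ∏ i ∈ S, g i (a i * m + b i * n)) / (N : ℝ) ^ 2) atTop (nhds A) := by
  refine exists_tendsto_of_approx fun ε hε => ?_
  set C : ℝ := ∑ i ∈ S, ((a i + b i : ℕ) : ℝ) with hC
  have hC0 : 0 ≤ C := sum_nonneg fun _ _ => Nat.cast_nonneg _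
  set δ : ℝ := ε / (C + 1) with hδ
  have hδ0 : 0 < δ := by positivity
  have h' : ∀ i, ∃ m > 0, ∃ φ : ℕ → ℝ, Function.Periodic φ m ∧ (∀ n, |φ n| ≤ 1) ∧
      (i ∈ S → ∀ N : ℕ, ∑ n ∈ Ioc 0 N, |g i n - φ n| ≤ δ * N) := by
    intro i
    by_cases hi : i ∈ S
    · obtain ⟨m, hm, φ, h1, h2, h3⟩ := h i hi δ hδ0
      exact ⟨m, hm, φ, h1, h2, fun _ => h3⟩
    · exact ⟨1, one_pos, fun _ => 0, fun _ => rfl, by simp, fun h => absurd h hi⟩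
  choose M hM φ hφ hφ1 hφ2 using h'
  refine ⟨fun N : ℕ => (∑ m ∈ Icc 1 N, ∑ n ∈ Icc 1 N,
      ∏ i ∈ S, φ i (a i * m + b i * n)) / (N : ℝ) ^ 2, ?_, ?_⟩
  · have hper : ∀ i ∈ S, ∀ x c : ℕ, φ i (x + c * ∏ j ∈ S, M j) = φ i x := by
      intro i hi x c
      obtain ⟨k, hk⟩ := dvd_prod_of_mem M hi
      rw [hk, show x + c * (M i * k) = x + (c * k) * M i by ring]
      exact (hφ i).nat_mul (c * k) x
    refine tendsto_average_of_periodic (M := ∏ j ∈ S, M j) (prod_pos fun i _ => hM i) ?_ ?_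
    · intro n m
      refine prod_congr rfl fun i hi => ?_
      rw [← hper i hi (a i * m + b i * n) (a i)]
      congr 1; ring
    · intro m n
      refine prod_congr rfl fun i hi => ?_
      rw [← hper i hi (a i * m + b i * n) (b i)]
      congr 1; ring
  · filter_upwards [eventually_gt_atTop 0] with N hN
    have hNr : (0 : ℝ) < N := by exact_mod_cast hN
    rw [← sub_div, abs_div, abs_of_pos (by positivity : (0 : ℝ) < N ^ 2),
      div_le_iff₀ (by positivity)]
    simp_rw [← sum_sub_distrib]
    calc _ ≤ ∑ m ∈ Icc 1 N, ∑ n ∈ Icc 1 N, ∑ i ∈ S,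
          |g i (a i * m + b i * n) - φ i (a i * m + b i * n)| := by
          refine (abs_sum_le_sum_abs _ _).trans (sum_le_sum fun m _ => ?_)
          refine (abs_sum_le_sum_abs _ _).trans (sum_le_sum fun n _ => ?_)
          exact abs_prod_sub_prod_le S (fun i => hg i _) (fun i => hφ1 i _)
      _ = ∑ i ∈ S, ∑ m ∈ Icc 1 N, ∑ n ∈ Icc 1 N,
          |g i (a i * m + b i * n) - φ i (a i * m + b i * n)| := by
          rw [sum_comm (s := S)]
          exact sum_congr rfl fun m _ => sum_comm
      _ ≤ ∑ i ∈ S, ((a i + b i : ℕ) : ℝ) * (δ * N ^ 2) := by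
          refine sum_le_sum fun i hi => ?_
          refine (sum_linear_form_le (hb i hi) (w := fun x => |g i x - φ i x|)
            (fun _ => abs_nonneg _) N).trans ?_
          have := hφ2 i hi ((a i + b i) * N)
          calc _ ≤ (N : ℝ) * (δ * (((a i + b i) * N : ℕ) : ℝ)) := by gcongr
            _ = _ := by push_cast; ring
      _ = C * (δ * N ^ 2) := by rw [← sum_mul]
      _ ≤ ε * N ^ 2 := by
          rw [← mul_assoc]
          gcongr
          rw [hδ, mul_div_assoc', div_le_iff₀ (by positivity)]
          nlinarith

theorem exists_tendsto_of_pairwise_independent (S : Finset (ℕ × ℕ))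
    (hpos : ∀ s ∈ S, 0 < s.1 ∧ 0 < s.2)
    (hind : ∀ s ∈ S, ∀ s' ∈ S, s ≠ s' → s.1 * s'.2 ≠ s.2 * s'.1) {g : ℕ × ℕ → ℕ → ℝ}
    (hmult : ∀ s m n, g s (m * n) = g s m * g s n) (hg : ∀ s n, |g s n| ≤ 1) :
    ∃ A : ℝ, Tendsto (fun N : ℕ => (∑ m ∈ Icc 1 N, ∑ n ∈ Icc 1 N,
      ∏ s ∈ S, g s (s.1 * m + s.2 * n)) / (N : ℝ) ^ 2) atTop (nhds A) := by
  by_cases h : ∀ s ∈ S, LimitPeriodic (g s)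
  · exact exists_tendsto_of_limitPeriodic S hg (a := Prod.fst) (b := Prod.snd)
      (fun s hs => (hpos s hs).2) h
  · push Not at h
    obtain ⟨s₀, hs₀, hn⟩ := h
    have hap := (aperiodic_or_limitPeriodic (hmult s₀) (hg s₀)).resolve_right hn
    set e := (S.erase s₀).equivFin.symm with he
    have hU := hap.locallyUniform (hmult s₀) (hg s₀) (S.erase s₀).card
    have h1 := tendsto_box_average_of_locallyUniform (g₀ := g s₀)
      (g := fun i => g (e i)) (a₀ := s₀.1) (b₀ := s₀.2) (a := fun i => (e i).1.1)
      (b := fun i => (e i).1.2) (hg s₀) (fun i => hg _) (hpos s₀ hs₀).1 (hpos s₀ hs₀).2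
      (fun i => hind s₀ hs₀ _ (mem_of_mem_erase (e i).2) (ne_of_mem_erase (e i).2).symm) hU
    refine ⟨0, h1.congr fun N => ?_⟩
    congr 1
    refine sum_congr rfl fun m _ => sum_congr rfl fun n _ => ?_
    rw [← mul_prod_erase S _ hs₀, ← prod_coe_sort (S.erase s₀), ← e.prod_comp]

theorem eq_of_coprime_of_mul_eq {a b a' b' : ℕ} (h : Nat.Coprime a b) (h' : Nat.Coprime a' b')
    (ha : 0 < a) (e : a * b' = b * a') : a = a' ∧ b = b' := by
  have h1 : a ∣ a' := h.dvd_of_dvd_mul_left (Dvd.intro _ e)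
  have h2 : a' ∣ a := h'.dvd_of_dvd_mul_right (Dvd.intro_left _ e.symm)
  have h3 := Nat.dvd_antisymm h1 h2
  subst h3
  refine ⟨rfl, ?_⟩
  rw [mul_comm b] at e
  exact (Nat.eq_of_mul_eq_mul_left ha e).symm

theorem homogeneous_product_convergence
    (f : ℕ → ℝ)
    (hmult : ∀ m n : ℕ, f (m * n) = f m * f n)
    (hbound : ∀ n, |f n| ≤ 1)
    (ℓ : ℕ) (k₁ k₂ : Fin ℓ → ℕ) (hk₁ : ∀ j, 0 < k₁ j) (hk₂ : ∀ j, 0 < k₂ j) :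
    ∃ A : ℝ, Tendsto (fun N : ℕ =>
        (∑ m ∈ Finset.Icc 1 N, ∑ n ∈ Finset.Icc 1 N,
          f (∏ j, (k₁ j * m + k₂ j * n))) / (N : ℝ) ^ 2)
      atTop (nhds A) := by
  by_cases h1 : f 1 = 0
  · have h0 : ∀ n, f n = 0 := fun n => by rw [← mul_one n, hmult, h1, mul_zero]
    exact ⟨0, by simp [h0]⟩
  have h1' : f 1 = 1 := by
    have := hmult 1 1
    rw [mul_one] at this
    exact mul_left_cancel₀ h1 (by rw [mul_one]; exact this.symm)
  set F : ℕ →* ℝ := ⟨⟨f, h1'⟩, hmult⟩ with hF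
  set c : Fin ℓ → ℕ := fun j => Nat.gcd (k₁ j) (k₂ j) with hc
  set d : Fin ℓ → ℕ × ℕ := fun j => (k₁ j / c j, k₂ j / c j) with hd
  have hc0 : ∀ j, 0 < c j := fun j => Nat.gcd_pos_of_pos_left _ (hk₁ j)
  have hdpos : ∀ j, 0 < (d j).1 ∧ 0 < (d j).2 := fun j =>
    ⟨Nat.div_pos (Nat.gcd_le_left _ (hk₁ j)) (hc0 j),
      Nat.div_pos (Nat.gcd_le_right _ (hk₂ j)) (hc0 j)⟩
  have hcop : ∀ j, Nat.Coprime (d j).1 (d j).2 := fun j => Nat.coprime_div_gcd_div_gcd (hc0 j)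
  set S := univ.image d with hS
  set e : ℕ × ℕ → ℕ := fun s => (univ.filter fun j => d j = s).card with he
  obtain ⟨A, hA⟩ := exists_tendsto_of_pairwise_independent S
    (by
      intro s hs
      obtain ⟨j, _, rfl⟩ := mem_image.1 hs
      exact hdpos j)
    (by
      intro s hs s' hs' hne heq
      obtain ⟨j, _, rfl⟩ := mem_image.1 hs
      obtain ⟨j', _, rfl⟩ := mem_image.1 hs'
      have := eq_of_coprime_of_mul_eq (hcop j) (hcop j') (hdpos j).1 heq
      exact hne (Prod.ext this.1 this.2))
    (g := fun s n => f n ^ e s)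
    (fun s m n => by simp only [hmult, mul_pow])
    (fun s n => by rw [abs_pow]; exact pow_le_one₀ (abs_nonneg _) (hbound n))
  refine ⟨(∏ j, f (c j)) * A, (hA.const_mul (∏ j, f (c j))).congr fun N => ?_⟩
  rw [← mul_div_assoc, mul_sum]
  congr 1
  refine sum_congr rfl fun m _ => ?_
  rw [mul_sum]
  refine sum_congr rfl fun n _ => ?_
  have hprod : ∏ s ∈ S, f (s.1 * m + s.2 * n) ^ e s = ∏ j, f ((d j).1 * m + (d j).2 * n) :=
    (prod_comp (fun s : ℕ × ℕ => f (s.1 * m + s.2 * n)) d).symm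
  have hmap : f (∏ j, (k₁ j * m + k₂ j * n)) = ∏ j, f (k₁ j * m + k₂ j * n) :=
    map_prod F _ _
  rw [hprod, hmap, ← prod_mul_distrib]
  refine prod_congr rfl fun j _ => ?_
  rw [← hmult]
  congr 1
  rw [mul_add, ← mul_assoc, ← mul_assoc, Nat.mul_div_cancel' (Nat.gcd_dvd_left _ _),
    Nat.mul_div_cancel' (Nat.gcd_dvd_right _ _)]
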